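/- Let F and F′ be finite groups. The lamplighter groups ℤ ≀ F and ℤ ≀ F′ are quasi-isometric — i.e. there exist finite symmetric generating sets S of ℤ ≀ F and S′ of ℤ ≀ F′ such that (ℤ ≀ F, d_S) and (ℤ ≀ F′, d_{S′}) are quasi-isometric metric spaces — if and only if there exist positive integers d, s, r such that |F| = dˢ and |F′| = dʳ. -/

import Mathlib

open Set

noncomputable section

/-- The (unrestricted) wreath product `(ℤ → F) ⋊ ℤ`, with `ℤ` acting by shifts. -/
def WreathZ (F : Type*) := (ℤ → F) × ℤ

namespace WreathZ

variable {F : Type*} [Group F]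

instance : Group (WreathZ F) where
  mul a b := (fun i => a.1 i * b.1 (i - a.2), a.2 + b.2)
  one := (fun _ => 1, 0)
  inv a := (fun i => (a.1 (i + a.2))⁻¹, -a.2)
  mul_assoc a b c := by
    show ((fun i => (a.1 i * b.1 (i - a.2)) * c.1 (i - (a.2 + b.2)), (a.2 + b.2) + c.2)
        : (ℤ → F) × ℤ)
      = (fun i => a.1 i * (b.1 (i - a.2) * c.1 (i - a.2 - b.2)), a.2 + (b.2 + c.2))
    refine Prod.ext ?_ ?_
    · funext i
      show (a.1 i * b.1 (i - a.2)) * c.1 (i - (a.2 + b.2))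
        = a.1 i * (b.1 (i - a.2) * c.1 (i - a.2 - b.2))
      rw [mul_assoc, sub_add_eq_sub_sub]
    · exact add_assoc _ _ _
  one_mul a := by
    show ((fun i => 1 * a.1 (i - 0), 0 + a.2) : (ℤ → F) × ℤ) = a
    refine Prod.ext ?_ ?_
    · funext i
      show 1 * a.1 (i - 0) = a.1 i
      rw [one_mul, sub_zero]
    · exact zero_add _
  mul_one a := by
    show ((fun i => a.1 i * 1, a.2 + 0) : (ℤ → F) × ℤ) = a
    refine Prod.ext ?_ ?_
    · funext i
      show a.1 i * 1 = a.1 i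
      rw [mul_one]
    · exact add_zero _
  inv_mul_cancel a := by
    show ((fun i => (a.1 (i + a.2))⁻¹ * a.1 (i - -a.2), -a.2 + a.2) : (ℤ → F) × ℤ)
      = ((fun _ => 1, 0) : (ℤ → F) × ℤ)
    refine Prod.ext ?_ ?_
    · funext i
      show (a.1 (i + a.2))⁻¹ * a.1 (i - -a.2) = 1
      rw [sub_neg_eq_add, inv_mul_cancel]
    · simp

@[simp] theorem mul_fst (a b : WreathZ F) :
    (a * b).1 = fun i => a.1 i * b.1 (i - a.2) := rfl
@[simp] theorem mul_snd (a b : WreathZ F) : (a * b).2 = a.2 + b.2 := rfl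
@[simp] theorem one_fst : ((1 : WreathZ F)).1 = fun _ => 1 := rfl
@[simp] theorem one_snd : ((1 : WreathZ F)).2 = 0 := rfl
@[simp] theorem inv_fst (a : WreathZ F) : (a⁻¹).1 = fun i => (a.1 (i + a.2))⁻¹ := rfl
@[simp] theorem inv_snd (a : WreathZ F) : (a⁻¹).2 = -a.2 := rfl

end WreathZ

/-- The lamplighter group `ℤ ≀ F = (⊕_{i ∈ ℤ} F) ⋊ ℤ`: the subgroup of the unrestricted
wreath product consisting of finitely supported configurations of lamps. -/
def Lamp (F : Type*) [Group F] : Subgroup (WreathZ F) where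
  carrier := {a : WreathZ F | {i : ℤ | a.1 i ≠ 1}.Finite}
  mul_mem' := by
    intro a b ha hb
    refine Set.Finite.subset (Set.Finite.union ha (Set.Finite.image (· + a.2) hb)) ?_
    intro i hi
    by_cases h1 : a.1 i = 1
    · right
      refine ⟨i - a.2, ?_, by ring⟩
      intro hcon
      exact hi (by show a.1 i * b.1 (i - a.2) = 1; rw [h1, hcon, one_mul])
    · exact Or.inl h1
  one_mem' := by
    show {i : ℤ | ((1 : WreathZ F)).1 i ≠ 1}.Finite
    have h : {i : ℤ | ((1 : WreathZ F)).1 i ≠ 1} = ∅ := by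
      ext i
      simp [WreathZ.one_fst]
    rw [h]
    exact Set.finite_empty
  inv_mem' := by
    intro a ha
    refine Set.Finite.subset (Set.Finite.image (· - a.2) ha) ?_
    intro i hi
    refine ⟨i + a.2, ?_, by ring⟩
    intro hcon
    exact hi (by show (a.1 (i + a.2))⁻¹ = 1; rw [hcon, inv_one])

/-- The word norm of `g` with respect to a generating set `S`. -/
def wordNorm {Γ : Type*} [Group Γ] (S : Set Γ) (g : Γ) : ℕ :=
  sInf {m : ℕ | ∃ l : List Γ, (∀ x ∈ l, x ∈ S) ∧ l.prod = g ∧ l.length = m}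

/-- The word metric on a group `Γ` with respect to a generating set `S`. -/
def wordDist {Γ : Type*} [Group Γ] (S : Set Γ) (a b : Γ) : ℝ :=
  (wordNorm S (a⁻¹ * b) : ℝ)

/-- `S` is a finite symmetric generating set of `Γ`. -/
def IsFinSymmGen {Γ : Type*} [Group Γ] (S : Set Γ) : Prop :=
  S.Finite ∧ (∀ s ∈ S, s⁻¹ ∈ S) ∧ Subgroup.closure S = ⊤

/-- `f` is a `(K, C)`-quasi-isometric embedding with respect to the given distances. -/
def IsQIE {X Y : Type*} (dX : X → X → ℝ) (dY : Y → Y → ℝ) (K C : ℝ) (f : X → Y) : Prop :=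
  ∀ a b : X, (1 / K) * dX a b - C ≤ dY (f a) (f b) ∧ dY (f a) (f b) ≤ K * dX a b + C

/-- `f` is a `(K, C)`-quasi-isometry with respect to the given distances. -/
def IsQI {X Y : Type*} (dX : X → X → ℝ) (dY : Y → Y → ℝ) (K C : ℝ) (f : X → Y) : Prop :=
  IsQIE dX dY K C f ∧ ∀ y : Y, ∃ x : X, dY (f x) y ≤ C

/-- Two "metric spaces", given by distance functions, are quasi-isometric. -/
def QuasiIsometric {X Y : Type*} (dX : X → X → ℝ) (dY : Y → Y → ℝ) : Prop :=
  ∃ (K C : ℝ) (f : X → Y), 1 ≤ K ∧ 0 ≤ C ∧ IsQI dX dY K C f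

namespace LampQI

open scoped Classical BigOperators

section Prob

variable {ι κ : Type*}

/-- The proportion of elements of `s` satisfying `p`. -/
def pr (s : Finset ι) (p : ι → Prop) : ℝ := 𝔼 x ∈ s, if p x then (1 : ℝ) else 0

lemma pr_nonneg (s : Finset ι) (p : ι → Prop) : 0 ≤ pr s p :=
  Finset.expect_nonneg fun x _ => by split_ifs <;> norm_num

lemma pr_mono {s : Finset ι} {p q : ι → Prop} (h : ∀ x ∈ s, p x → q x) : pr s p ≤ pr s q := by
  refine Finset.expect_le_expect fun x hx => ?_
  by_cases hp : p x
  · simp [hp, h x hx hp]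
  · simp only [hp, if_false]; split_ifs <;> norm_num

lemma expect_le_of_forall {s : Finset ι} {f : ι → ℝ} {B : ℝ} (hB : 0 ≤ B)
    (h : ∀ x ∈ s, f x ≤ B) : 𝔼 x ∈ s, f x ≤ B := by
  rcases s.eq_empty_or_nonempty with rfl | hs
  · simpa using hB
  · exact Finset.expect_le hs h

lemma pr_le_one (s : Finset ι) (p : ι → Prop) : pr s p ≤ 1 :=
  expect_le_of_forall zero_le_one fun x _ => by split_ifs <;> norm_num

lemma pr_or_le (s : Finset ι) (p q : ι → Prop) : pr s (fun x => p x ∨ q x) ≤ pr s p + pr s q := by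
  unfold pr
  rw [← Finset.expect_add_distrib]
  refine Finset.expect_le_expect fun x _ => ?_
  by_cases hp : p x <;> by_cases hq : q x <;> simp [hp, hq]

lemma pr_exists_le {τ : Type*} (s : Finset ι) (T : Finset τ) (p : τ → ι → Prop) :
    pr s (fun x => ∃ t ∈ T, p t x) ≤ ∑ t ∈ T, pr s (p t) := by
  unfold pr
  rw [← Finset.expect_sum_comm]
  refine Finset.expect_le_expect fun x _ => ?_
  split_ifs with h
  · obtain ⟨t, ht, hp⟩ := h
    refine le_trans ?_ (Finset.single_le_sum (f := fun t => if p t x then (1 : ℝ) else 0)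
      (fun t _ => by split_ifs <;> norm_num) ht)
    simp [hp]
  · exact Finset.sum_nonneg fun t _ => by split_ifs <;> norm_num

lemma pr_eq_card_div (s : Finset ι) (p : ι → Prop) :
    pr s p = ((s.filter p).card : ℝ) / s.card := by
  unfold pr
  rw [Finset.expect_eq_sum_div_card, Finset.sum_ite]
  simp

lemma pr_add_not {s : Finset ι} (hs : s.Nonempty) (p : ι → Prop) :
    pr s p + pr s (fun x => ¬ p x) = 1 := by
  unfold pr
  rw [← Finset.expect_add_distrib]
  refine (Finset.expect_congr rfl fun x _ => ?_).trans (Finset.expect_const hs (1 : ℝ))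
  by_cases hp : p x <;> simp [hp]

lemma pr_markov {s : Finset ι} {φ : ι → ℝ} (h0 : ∀ x ∈ s, 0 ≤ φ x) {t B : ℝ} (ht : 0 < t)
    (hB : 𝔼 x ∈ s, φ x ≤ B) : pr s (fun x => t ≤ φ x) ≤ B / t := by
  rw [le_div_iff₀ ht]
  refine le_trans ?_ hB
  unfold pr
  rw [Finset.expect_mul]
  refine Finset.expect_le_expect fun x hx => ?_
  split_ifs with h
  · simpa using h
  · simpa using h0 x hx

lemma exists_not_of_pr_lt {s : Finset ι} (hs : s.Nonempty) {p : ι → Prop} (h : pr s p < 1) :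
    ∃ x ∈ s, ¬ p x := by
  by_contra! hc
  have := pr_add_not hs p
  have h2 : pr s (fun x => ¬ p x) ≤ pr s (fun _ => False) := pr_mono fun x hx hn => hn (hc x hx)
  have h3 : pr s (fun _ => False) = 0 := by simp [pr]
  linarith

lemma exists_of_pr_pos {s : Finset ι} {p : ι → Prop} (h : 0 < pr s p) : ∃ x ∈ s, p x := by
  by_contra! hc
  have h2 : pr s p ≤ pr s (fun _ => False) := pr_mono fun x hx hn => hc x hx hn
  have h3 : pr s (fun _ => False) = 0 := by simp [pr]
  linarith

lemma pr_prod (s : Finset ι) (t : Finset κ) (p : ι × κ → Prop) :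
    pr (s ×ˢ t) p = 𝔼 x ∈ s, pr t (fun y => p (x, y)) := by
  unfold pr; rw [Finset.expect_product]

lemma pr_prod' (s : Finset ι) (t : Finset κ) (p : ι × κ → Prop) :
    pr (s ×ˢ t) p = 𝔼 y ∈ t, pr s (fun x => p (x, y)) := by
  rw [pr_prod]; unfold pr; rw [Finset.expect_comm]

end Prob

section Config

variable {α β : Type*} [Zero α] [Zero β]

/-- `a` strictly below `r`, `b` from `r` on. -/
def sp (r : ℤ) (a b : ℤ →₀ α) : ℤ →₀ α :=
  Finsupp.ofSupportFinite (fun i => if i < r then a i else b i) <| by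
    refine Set.Finite.subset (a.support ∪ b.support).finite_toSet fun i hi => ?_
    simp only [Function.mem_support, ne_eq, Finset.coe_union, Set.mem_union, Finset.mem_coe,
      Finsupp.mem_support_iff] at hi ⊢
    by_contra! hc
    exact hi (by rw [hc.1, hc.2, ite_self])

@[simp] lemma sp_apply (r : ℤ) (a b : ℤ →₀ α) (i : ℤ) :
    sp r a b i = if i < r then a i else b i := rfl

variable [Fintype α] [Fintype β]

/-- The configurations that agree with `a` off `[k, l)`. -/
def Bx (a : ℤ →₀ α) (k l : ℤ) : Finset (ℤ →₀ α) :=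
  (Finset.univ : Finset (Finset.Ico k l → α)).image fun w =>
    Finsupp.ofSupportFinite (fun i => if h : i ∈ Finset.Ico k l then w ⟨i, h⟩ else a i) <| by
      refine Set.Finite.subset (a.support ∪ Finset.Ico k l).finite_toSet fun i hi => ?_
      simp only [Function.mem_support, ne_eq, Finset.coe_union, Set.mem_union, Finset.mem_coe,
        Finsupp.mem_support_iff] at hi ⊢
      by_contra! hc
      exact hi (by rw [dif_neg hc.2, hc.1])

lemma mem_Bx {a c : ℤ →₀ α} {k l : ℤ} : c ∈ Bx a k l ↔ ∀ i, i < k ∨ l ≤ i → c i = a i := by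
  simp only [Bx, Finset.mem_image, Finset.mem_univ, true_and]
  constructor
  · rintro ⟨w, rfl⟩ i hi
    have : i ∉ Finset.Ico k l := by simp only [Finset.mem_Ico]; omega
    simp only [Finsupp.ofSupportFinite_coe]
    rw [dif_neg this]
  · intro h
    refine ⟨fun i => c i, ?_⟩
    ext i
    simp only [Finsupp.ofSupportFinite_coe]
    split_ifs with hi
    · rfl
    · refine (h i ?_).symm
      simp only [Finset.mem_Ico] at hi; omega

lemma card_Bx (a : ℤ →₀ α) (k l : ℤ) : (Bx a k l).card = Fintype.card α ^ (l - k).toNat := by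
  unfold Bx
  rw [Finset.card_image_of_injective]
  · simp
  · intro w w' h
    funext i
    have := DFunLike.congr_fun h (i : ℤ)
    simp only [Finsupp.ofSupportFinite_coe] at this
    simpa using this

lemma self_mem_Bx (a : ℤ →₀ α) (k l : ℤ) : a ∈ Bx a k l := mem_Bx.2 fun _ _ => rfl

lemma Bx_nonempty (a : ℤ →₀ α) (k l : ℤ) : (Bx a k l).Nonempty := ⟨a, self_mem_Bx a k l⟩

lemma Bx_congr {a b : ℤ →₀ α} {k l : ℤ} (h : ∀ i, i < k ∨ l ≤ i → a i = b i) :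
    Bx a k l = Bx b k l := by
  ext c
  simp only [mem_Bx]
  exact forall_congr' fun i => by
    constructor <;> intro h1 h2
    · rw [h1 h2, h i h2]
    · rw [h1 h2, h i h2]

lemma Bx_eq_of_mem {a b : ℤ →₀ α} {k l : ℤ} (h : b ∈ Bx a k l) : Bx b k l = Bx a k l :=
  Bx_congr (mem_Bx.1 h)

lemma mem_Bx_comm {a b : ℤ →₀ α} {k l : ℤ} : b ∈ Bx a k l ↔ a ∈ Bx b k l := by
  simp only [mem_Bx, eq_comm]

lemma Bx_subset {o a : ℤ →₀ α} {k l k' l' : ℤ} (hk : k ≤ k') (hl : l' ≤ l) (ha : a ∈ Bx o k l) :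
    Bx a k' l' ⊆ Bx o k l := fun b hb => mem_Bx.2 fun i hi => by
  rw [mem_Bx.1 hb i (by omega), mem_Bx.1 ha i hi]

lemma card_Bx_pos (a : ℤ →₀ α) (k l : ℤ) : 0 < (Bx a k l).card := (Bx_nonempty a k l).card_pos

lemma card_Bx_real (a : ℤ →₀ α) {k l : ℤ} (h : k ≤ l) :
    ((Bx a k l).card : ℝ) = (Fintype.card α : ℝ) ^ ((l : ℝ) - k) := by
  rw [card_Bx, Nat.cast_pow, ← Real.rpow_natCast]
  congr 1
  have : ((l - k).toNat : ℤ) = l - k := Int.toNat_of_nonneg (by omega)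
  rw [← Int.cast_natCast, this]; push_cast; rfl

/-- Resampling part of a box does not change averages. -/
lemma expect_resample (o : ℤ →₀ α) {k l k' l' : ℤ} (hk : k ≤ k') (hl : l' ≤ l)
    (φ : (ℤ →₀ α) → ℝ) :
    𝔼 a ∈ Bx o k l, 𝔼 b ∈ Bx a k' l', φ b = 𝔼 a ∈ Bx o k l, φ a := by
  have hN : ((Fintype.card α ^ (l' - k').toNat : ℕ) : ℝ) ≠ 0 := by
    rw [← card_Bx o k' l']; exact_mod_cast (card_Bx_pos o k' l').ne'
  simp only [Finset.expect_eq_sum_div_card, card_Bx]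
  congr 1
  rw [← Finset.sum_div, div_eq_iff hN]
  have h1 : ∀ a ∈ Bx o k l, ∑ b ∈ Bx a k' l', φ b
      = ∑ b ∈ Bx o k l, if a ∈ Bx b k' l' then φ b else 0 := by
    intro a ha
    rw [← Finset.sum_filter]
    refine Finset.sum_congr ?_ fun _ _ => rfl
    ext b
    simp only [Finset.mem_filter]
    exact ⟨fun hb => ⟨Bx_subset hk hl ha hb, mem_Bx_comm.1 hb⟩, fun hb => mem_Bx_comm.1 hb.2⟩
  rw [Finset.sum_congr rfl h1, Finset.sum_comm, Finset.sum_mul]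
  refine Finset.sum_congr rfl fun b hb => ?_
  rw [← Finset.sum_filter, Finset.sum_const]
  have h2 : (Bx o k l).filter (fun a => a ∈ Bx b k' l') = Bx b k' l' := by
    ext a
    simp only [Finset.mem_filter, and_iff_right_iff_imp]
    exact fun ha => Bx_subset hk hl hb ha
  rw [h2, card_Bx, nsmul_eq_mul, mul_comm]

/-- A map between boxes that only moves the frozen coordinates preserves averages. -/
lemma expect_Bx_map {a b : ℤ →₀ α} {k l : ℤ} (T : (ℤ →₀ α) → ℤ →₀ α)
    (hT : ∀ w ∈ Bx a k l, T w ∈ Bx b k l) (hT' : ∀ w ∈ Bx a k l, ∀ i, k ≤ i → i < l → T w i = w i)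
    (φ : (ℤ →₀ α) → ℝ) : 𝔼 w ∈ Bx a k l, φ (T w) = 𝔼 w ∈ Bx b k l, φ w := by
  refine Finset.expect_nbij' T (fun w => sp k a (sp l w a)) hT ?_ ?_ ?_ fun _ _ => rfl
  · intro w hw
    refine mem_Bx.2 fun i hi => ?_
    simp only [sp_apply]; split_ifs <;> first | rfl | omega
  · intro w hw
    ext i
    simp only [sp_apply]
    split_ifs with h1 h2
    · exact (mem_Bx.1 hw i (Or.inl h1)).symm
    · exact hT' w hw i (by omega) h2
    · exact (mem_Bx.1 hw i (Or.inr (by omega))).symm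
  · intro w hw
    have hm : sp k a (sp l w a) ∈ Bx a k l := by
      refine mem_Bx.2 fun i hi => ?_
      simp only [sp_apply]; split_ifs <;> first | rfl | omega
    ext i
    by_cases hi : k ≤ i ∧ i < l
    · rw [hT' _ hm i hi.1 hi.2]
      simp only [sp_apply]; split_ifs <;> first | rfl | omega
    · rw [mem_Bx.1 (hT _ hm) i (by omega), mem_Bx.1 hw i (by omega)]

lemma expect_sp_right (o c : ℤ →₀ α) {k l r : ℤ} (hk : k ≤ r) (φ : (ℤ →₀ α) → ℝ) :
    𝔼 q ∈ Bx o k l, φ (sp r c q) = 𝔼 w ∈ Bx (sp r c o) r l, φ w := by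
  rw [← expect_resample o hk le_rfl]
  rw [← Finset.expect_const (Bx_nonempty o k l) (𝔼 w ∈ Bx (sp r c o) r l, φ w)]
  refine Finset.expect_congr rfl fun q hq => ?_
  refine expect_Bx_map _ (fun w hw => mem_Bx.2 fun i hi => ?_) (fun w hw i h1 h2 => ?_) _
  · simp only [sp_apply]
    split_ifs with h
    · rfl
    · rw [mem_Bx.1 hw i hi, mem_Bx.1 hq i (by omega)]
  · simp only [sp_apply]; rw [if_neg (by omega)]

lemma expect_sp_left (o q : ℤ →₀ α) {k l r : ℤ} (hl : r ≤ l) (φ : (ℤ →₀ α) → ℝ) :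
    𝔼 c ∈ Bx o k l, φ (sp r c q) = 𝔼 w ∈ Bx (sp r o q) k r, φ w := by
  rw [← expect_resample o le_rfl hl]
  rw [← Finset.expect_const (Bx_nonempty o k l) (𝔼 w ∈ Bx (sp r o q) k r, φ w)]
  refine Finset.expect_congr rfl fun c hc => ?_
  refine expect_Bx_map _ (fun w hw => mem_Bx.2 fun i hi => ?_) (fun w hw i h1 h2 => ?_) _
  · simp only [sp_apply]
    split_ifs with h
    · rw [mem_Bx.1 hw i hi, mem_Bx.1 hc i (by omega)]
    · rfl
  · simp only [sp_apply]; rw [if_pos (by omega)]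

/-- Pairs (bottom, top) of configurations in a box. -/
def Bx2 (o : ℤ →₀ α) (k l : ℤ) : Finset ((ℤ →₀ α) × (ℤ →₀ α)) := Bx o k l ×ˢ Bx o k l

lemma mem_Bx2 {o : ℤ →₀ α} {k l : ℤ} {x : (ℤ →₀ α) × (ℤ →₀ α)} :
    x ∈ Bx2 o k l ↔ x.1 ∈ Bx o k l ∧ x.2 ∈ Bx o k l := Finset.mem_product

lemma Bx2_nonempty (o : ℤ →₀ α) (k l : ℤ) : (Bx2 o k l).Nonempty :=
  (Bx_nonempty o k l).product (Bx_nonempty o k l)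

/-- The portion of a vertical path between levels `r` and `s` is a uniformly distributed vertical
path in a random sub-box. -/
lemma expect_subbox (o : ℤ →₀ α) {k l r s : ℤ} (hk : k ≤ r) (hrs : r ≤ s) (hl : s ≤ l)
    (ψ : (ℤ →₀ α) × (ℤ →₀ α) → ℝ) :
    𝔼 x ∈ Bx2 o k l, ψ (sp r x.2 x.1, sp s x.2 x.1)
      = 𝔼 x ∈ Bx2 o k l, 𝔼 y ∈ Bx2 (sp r x.2 x.1) r s, ψ y := by
  unfold Bx2
  simp only [Finset.expect_product]
  rw [← expect_resample o hk hl]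
  refine Finset.expect_congr rfl fun q hq => ?_
  have h1 : ∀ q' : ℤ →₀ α, 𝔼 c ∈ Bx o k l, ψ (sp r c q', sp s c q')
      = 𝔼 c ∈ Bx o k l, 𝔼 c' ∈ Bx c r s, ψ (sp r c' q', sp s c' q') := fun q' =>
    (expect_resample o hk hl _).symm
  simp only [h1]
  rw [Finset.expect_comm]
  refine Finset.expect_congr rfl fun c hc => ?_
  rw [← expect_Bx_map (a := q) (b := sp r c q) (sp r c)]
  · refine Finset.expect_congr rfl fun q' hq' => ?_
    rw [← expect_Bx_map (a := c) (b := sp r c q) (fun c' => sp s c' q)]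
    · refine Finset.expect_congr rfl fun c' hc' => ?_
      congr 2
      · ext i
        simp only [sp_apply]
        split_ifs with h
        · exact mem_Bx.1 hc' i (Or.inl h)
        · rfl
      · ext i
        simp only [sp_apply]
        split_ifs with h
        · rfl
        · exact mem_Bx.1 hq' i (Or.inr (by omega))
    · intro c' hc'
      refine mem_Bx.2 fun i hi => ?_
      simp only [sp_apply]
      split_ifs <;> first | rfl | omega | exact mem_Bx.1 hc' i hi
    · intro c' hc' i h1 h2
      simp only [sp_apply]; rw [if_pos (by omega)]
  · intro q' hq'
    refine mem_Bx.2 fun i hi => ?_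
    simp only [sp_apply]
    split_ifs <;> first | rfl | omega | exact mem_Bx.1 hq' i hi
  · intro q' hq' i h1 h2
    simp only [sp_apply]; rw [if_neg (by omega)]

lemma expect_subbox_le (o : ℤ →₀ α) {k l r s : ℤ} (hk : k ≤ r) (hrs : r ≤ s) (hl : s ≤ l)
    (ψ : (ℤ →₀ α) × (ℤ →₀ α) → ℝ) {B : ℝ} (hB : ∀ o', 𝔼 y ∈ Bx2 o' r s, ψ y ≤ B) :
    𝔼 x ∈ Bx2 o k l, ψ (sp r x.2 x.1, sp s x.2 x.1) ≤ B := by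
  rw [expect_subbox o hk hrs hl]
  exact Finset.expect_le (Bx2_nonempty o k l) fun x _ => hB _

lemma pr_subbox_le (o : ℤ →₀ α) {k l r s : ℤ} (hk : k ≤ r) (hrs : r ≤ s) (hl : s ≤ l)
    (p : (ℤ →₀ α) × (ℤ →₀ α) → Prop) {B : ℝ} (hB : ∀ o', pr (Bx2 o' r s) p ≤ B) :
    pr (Bx2 o k l) (fun x => p (sp r x.2 x.1, sp s x.2 x.1)) ≤ B :=
  expect_subbox_le o hk hrs hl (fun x => if p x then (1 : ℝ) else 0) hB

omit [Fintype α] in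
lemma sp_sp_sub (c q : ℤ →₀ α) {r t s : ℤ} (h1 : r ≤ t) (h2 : t ≤ s) :
    sp t (sp s c q) (sp r c q) = sp t c q := by
  ext i; simp only [sp_apply]; split_ifs <;> first | rfl | omega

/-- At a fixed level a random vertical path is uniformly distributed. -/
lemma expect_level (o : ℤ →₀ α) {k l r : ℤ} (hk : k ≤ r)
    (φ : (ℤ →₀ α) → ℝ) :
    𝔼 x ∈ Bx2 o k l, φ (sp r x.2 x.1) = 𝔼 w ∈ Bx o k l, φ w := by
  unfold Bx2
  rw [Finset.expect_product, Finset.expect_comm]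
  have h1 : ∀ c : ℤ →₀ α, 𝔼 q ∈ Bx o k l, φ (sp r c q) = 𝔼 w ∈ Bx (sp r c o) r l, φ w :=
    fun c => expect_sp_right o c hk φ
  simp only [h1]
  rw [← expect_resample o hk le_rfl φ]
  refine Finset.expect_congr rfl fun c hc => ?_
  have h2 : Bx (sp r c o) r l = Bx c r l := Bx_congr fun i hi => by
    simp only [sp_apply]
    split_ifs
    · rfl
    · exact (mem_Bx.1 hc i (by omega)).symm
  rw [h2]

end Config

section Geometry

variable {α β : Type*} [Zero α] [Zero β]

/-- `p` and `p'` differ inside, and their levels lie in, an interval of length at most `r`. -/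
def cl (r : ℤ) (p p' : (ℤ →₀ α) × ℤ) : Prop :=
  ∃ lo hi : ℤ, hi ≤ lo + r ∧ lo ≤ p.2 ∧ p.2 ≤ hi ∧ lo ≤ p'.2 ∧ p'.2 ≤ hi ∧
    ∀ i, i < lo ∨ hi ≤ i → p.1 i = p'.1 i

lemma cl.symm {r : ℤ} {p p' : (ℤ →₀ α) × ℤ} (h : cl r p p') : cl r p' p := by
  obtain ⟨lo, hi, h1, h2, h3, h4, h5, h6⟩ := h
  exact ⟨lo, hi, h1, h4, h5, h2, h3, fun i hi => (h6 i hi).symm⟩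

lemma cl.mono {r s : ℤ} (hrs : r ≤ s) {p p' : (ℤ →₀ α) × ℤ} (h : cl r p p') : cl s p p' := by
  obtain ⟨lo, hi, h1, h2⟩ := h
  exact ⟨lo, hi, by omega, h2⟩

lemma cl.trans {r s : ℤ} {p q t : (ℤ →₀ α) × ℤ} (h : cl r p q) (h' : cl s q t) :
    cl (r + s) p t := by
  obtain ⟨lo, hi, h1, h2, h3, h4, h5, h6⟩ := h
  obtain ⟨lo', hi', h1', h2', h3', h4', h5', h6'⟩ := h'
  refine ⟨min lo lo', max hi hi', by omega, by omega, by omega, by omega, by omega, fun i hi => ?_⟩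
  rw [h6 i (by omega), h6' i (by omega)]

lemma cl.snd_le {r : ℤ} {p p' : (ℤ →₀ α) × ℤ} (h : cl r p p') : p.2 ≤ p'.2 + r := by
  obtain ⟨lo, hi, h1, h2, h3, h4, h5, h6⟩ := h; omega

lemma cl.eq_below {r : ℤ} {p p' : (ℤ →₀ α) × ℤ} (h : cl r p p') {i : ℤ} (hi : i < p.2 - r) :
    p.1 i = p'.1 i := by
  obtain ⟨lo, hi, h1, h2, h3, h4, h5, h6⟩ := h; exact h6 i (by omega)

lemma cl.eq_above {r : ℤ} {p p' : (ℤ →₀ α) × ℤ} (h : cl r p p') {i : ℤ} (hi : p.2 + r ≤ i) :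
    p.1 i = p'.1 i := by
  obtain ⟨lo, hi, h1, h2, h3, h4, h5, h6⟩ := h; exact h6 i (by omega)

lemma cl_refl {r : ℤ} (hr : 0 ≤ r) (p : (ℤ →₀ α) × ℤ) : cl r p p :=
  ⟨p.2, p.2, by omega, le_rfl, le_rfl, le_rfl, le_rfl, fun _ _ => rfl⟩

lemma cl_sp (c q : ℤ →₀ α) (r : ℤ) : cl 1 (sp r c q, r) (sp (r + 1) c q, r + 1) := by
  refine ⟨r, r + 1, by omega, by simp, by simp, by simp, by simp, fun i hi => ?_⟩
  simp only [sp_apply]; split_ifs <;> first | rfl | omega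

lemma cl_vert (a : ℤ →₀ α) (r : ℤ) : cl 1 (a, r) (a, r + 1) :=
  ⟨r, r + 1, by omega, by simp, by simp, by simp, by simp, fun _ _ => rfl⟩

section Walk

variable {K : ℤ} {γ : ℤ → (ℤ →₀ β) × ℤ} (h : ∀ r, cl K (γ r) (γ (r + 1))) {a b : ℤ}
include h

lemma walk_cl (hab : a ≤ b) : cl (K * (b - a)) (γ a) (γ b) := by
  induction b, hab using Int.leInduction with
  | base => exact cl_refl (by simp) _
  | succ b hab ih => exact (ih.trans (h b)).mono (by ring_nf; rfl)

lemma walk_lip (hab : a ≤ b) : |(γ b).2 - (γ a).2| ≤ K * (b - a) := by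
  have h1 := walk_cl h hab
  have h2 := h1.snd_le
  have h3 := h1.symm.snd_le
  exact abs_le.2 ⟨by linarith, by linarith⟩

lemma walk_eq_below (hab : a ≤ b) {v : ℤ} (hv : ∀ r, a ≤ r → r ≤ b → v ≤ (γ r).2) {i : ℤ}
    (hi : i < v - K) : (γ b).1 i = (γ a).1 i := by
  induction b, hab using Int.leInduction with
  | base => rfl
  | succ b hab ih =>
    rw [← ih fun r h1 h2 => hv r h1 (by omega)]
    have := hv b hab (by omega)
    exact ((h b).eq_below (by omega)).symm

lemma walk_eq_above (hab : a ≤ b) {v : ℤ} (hv : ∀ r, a ≤ r → r ≤ b → (γ r).2 ≤ v) {i : ℤ}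
    (hi : v + K ≤ i) : (γ b).1 i = (γ a).1 i := by
  induction b, hab using Int.leInduction with
  | base => rfl
  | succ b hab ih =>
    rw [← ih fun r h1 h2 => hv r h1 (by omega)]
    have := hv b hab (by omega)
    exact ((h b).eq_above (by omega)).symm

end Walk

/-- `f` and `g` are coarse inverse to each other and coarsely Lipschitz with constant `K`. -/
structure CQ (f : (ℤ →₀ α) × ℤ → (ℤ →₀ β) × ℤ) (g : (ℤ →₀ β) × ℤ → (ℤ →₀ α) × ℤ) (K : ℤ) :
    Prop where
  one_le : 1 ≤ K
  f_cl : ∀ p p', cl 1 p p' → cl K (f p) (f p')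
  g_cl : ∀ p p', cl 1 p p' → cl K (g p) (g p')
  gf : ∀ p, cl K (g (f p)) p
  fg : ∀ p, cl K (f (g p)) p

variable {f : (ℤ →₀ α) × ℤ → (ℤ →₀ β) × ℤ} {g : (ℤ →₀ β) × ℤ → (ℤ →₀ α) × ℤ} {K : ℤ}

lemma CQ.symm (h : CQ f g K) : CQ g f K := ⟨h.one_le, h.g_cl, h.f_cl, h.fg, h.gf⟩

lemma CQ.path (h : CQ f g K) (c q : ℤ →₀ α) (r : ℤ) :
    cl K (f (sp r c q, r)) (f (sp (r + 1) c q, r + 1)) := h.f_cl _ _ (cl_sp c q r)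

lemma CQ.vert (h : CQ f g K) (a : ℤ →₀ α) (r : ℤ) :
    cl K (f (a, r)) (f (a, r + 1)) := h.f_cl _ _ (cl_vert a r)

lemma CQ.path_lip (h : CQ f g K) (c q : ℤ →₀ α) {r s : ℤ} (hrs : r ≤ s) :
    |(f (sp s c q, s)).2 - (f (sp r c q, r)).2| ≤ K * (s - r) :=
  walk_lip (γ := fun r => f (sp r c q, r)) (h.path c q) hrs

lemma CQ.path_lip_real (h : CQ f g K) (c q : ℤ →₀ α) {r s : ℤ} (hrs : r ≤ s) :
    |((f (sp s c q, s)).2 : ℝ) - (f (sp r c q, r)).2| ≤ K * (s - r) := by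
  exact_mod_cast h.path_lip c q hrs

lemma CQ.f_cl_of (h : CQ f g K) {r : ℤ} {p p' : (ℤ →₀ α) × ℤ} (hp : cl r p p') :
    cl (3 * K * r) (f p) (f p') := by
  obtain ⟨lo, hi, h1, h2, h3, h4, h5, h6⟩ := hp
  have hK := h.one_le
  have e1 := walk_cl (γ := fun r => f (p.1, r)) (h.vert p.1) h2
  have e2 := walk_cl (γ := fun r => f (sp r p'.1 p.1, r)) (h.path p'.1 p.1) (h2.trans h3)
  have e3 := walk_cl (γ := fun r => f (p'.1, r)) (h.vert p'.1) h5
  have i1 : sp lo p'.1 p.1 = p.1 := by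
    ext i; simp only [sp_apply]; split_ifs with hh
    · exact (h6 i (Or.inl hh)).symm
    · rfl
  have i2 : sp hi p'.1 p.1 = p'.1 := by
    ext i; simp only [sp_apply]; split_ifs with hh
    · rfl
    · exact h6 i (Or.inr (by omega))
  simp only [i1, i2] at e2
  refine ((e1.symm.trans e2).trans e3.symm).mono ?_
  nlinarith

lemma CQ.cl_of_f_eq (h : CQ f g K) {p p' : (ℤ →₀ α) × ℤ} (e : f p = f p') : cl (K + K) p p' :=
  ((h.gf p).symm.trans (by rw [e]; exact h.gf p'))

variable [Fintype α] [Fintype β]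

omit [Fintype β] in
/-- The fibres of `f` at a given level are small. -/
lemma CQ.card_fibre_le (h : CQ f g K) (i : ℤ) (y : (ℤ →₀ β) × ℤ) (S : Finset (ℤ →₀ α)) :
    (S.filter fun a => f (a, i) = y).card ≤ Fintype.card α ^ (4 * K).toNat := by
  rcases (S.filter fun a => f (a, i) = y).eq_empty_or_nonempty with h0 | ⟨a0, ha0⟩
  · rw [h0]; simp
  · rw [Finset.mem_filter] at ha0
    have h1 : (S.filter fun a => f (a, i) = y) ⊆ Bx a0 (i - 2 * K) (i + 2 * K) := by
      intro a ha
      rw [Finset.mem_filter] at ha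
      have := h.cl_of_f_eq (ha.2.trans ha0.2.symm)
      refine mem_Bx.2 fun j hj => ?_
      rcases hj with hj | hj
      · exact this.eq_below (by simp only; omega)
      · exact this.eq_above (by simp only; omega)
    refine (Finset.card_le_card h1).trans ?_
    rw [card_Bx]
    exact le_of_eq (by congr 2; omega)

lemma CQ.count (h : CQ f g K) {S : Finset (ℤ →₀ α)} {i h1 h2 lo hi : ℤ} {A0 : ℤ →₀ β}
    (hS : ∀ a ∈ S, h1 ≤ (f (a, i)).2 ∧ (f (a, i)).2 ≤ h2 ∧
      ∀ j, j < lo ∨ hi ≤ j → (f (a, i)).1 j = A0 j) :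
    S.card ≤ Fintype.card α ^ (4 * K).toNat *
      ((h2 + 1 - h1).toNat * Fintype.card β ^ (hi - lo).toNat) := by
  have e1 := Finset.card_le_mul_card_image (f := fun a => f (a, i)) S
    (Fintype.card α ^ (4 * K).toNat) fun y _ => h.card_fibre_le i y S
  refine e1.trans (Nat.mul_le_mul_left _ ?_)
  have e2 : S.image (fun a => f (a, i)) ⊆ Bx A0 lo hi ×ˢ Finset.Icc h1 h2 := by
    intro y hy
    obtain ⟨a, ha, rfl⟩ := Finset.mem_image.1 hy
    obtain ⟨b1, b2, b3⟩ := hS a ha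
    exact Finset.mem_product.2 ⟨mem_Bx.2 b3, Finset.mem_Icc.2 ⟨b1, b2⟩⟩
  refine (Finset.card_le_card e2).trans ?_
  rw [Finset.card_product, card_Bx, Int.card_Icc, mul_comm]

/-- Few vertical paths from a given point have small oscillation under `f`. -/
lemma CQ.count_osc (h : CQ f g K) (a : ℤ →₀ α) {i l W : ℤ} (hil : i ≤ l) (hW : 0 ≤ W) :
    ((Bx a i l).filter fun c => ∀ r s, i ≤ r → r ≤ l → i ≤ s → s ≤ l →
      (f (sp s c a, s)).2 - (f (sp r c a, r)).2 ≤ W).card ≤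
    (W + 1).toNat * (Fintype.card α ^ (4 * K).toNat *
      ((W + 1).toNat * Fintype.card β ^ (W + 2 * K).toNat)) := by
  set S := (Bx a i l).filter fun c => ∀ r s, i ≤ r → r ≤ l → i ≤ s → s ≤ l →
      (f (sp s c a, s)).2 - (f (sp r c a, r)).2 ≤ W
  set v := (f (a, i)).2
  have hstart : ∀ c ∈ Bx a i l, sp i c a = a := fun c hc => by
    ext j; simp only [sp_apply]; split_ifs with hj
    · exact mem_Bx.1 hc j (Or.inl hj)
    · rfl
  have hend : ∀ c ∈ Bx a i l, sp l c a = c := fun c hc => by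
    ext j; simp only [sp_apply]; split_ifs with hj
    · rfl
    · exact (mem_Bx.1 hc j (Or.inr (by omega))).symm
  have hsub : S ⊆ (Finset.Icc (v - W) v).biUnion fun h0 => S.filter fun c =>
      ∀ r, i ≤ r → r ≤ l → h0 ≤ (f (sp r c a, r)).2 ∧ (f (sp r c a, r)).2 ≤ h0 + W := by
    intro c hc
    obtain ⟨hcB, hc2⟩ := Finset.mem_filter.1 hc
    obtain ⟨r0, hr0, hmin⟩ := Finset.exists_min_image (Finset.Icc i l)
      (fun r => (f (sp r c a, r)).2) ⟨i, by simp [hil]⟩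
    rw [Finset.mem_Icc] at hr0
    have hv : (f (sp i c a, i)).2 = v := by rw [hstart c hcB]
    refine Finset.mem_biUnion.2 ⟨(f (sp r0 c a, r0)).2, Finset.mem_Icc.2 ⟨?_, ?_⟩,
      Finset.mem_filter.2 ⟨hc, fun r h1 h2 => ⟨hmin r (Finset.mem_Icc.2 ⟨h1, h2⟩), ?_⟩⟩⟩
    · have := hc2 r0 i hr0.1 hr0.2 le_rfl hil; omega
    · have := hmin i (Finset.mem_Icc.2 ⟨le_rfl, hil⟩); omega
    · have := hc2 r0 r hr0.1 hr0.2 h1 h2; omega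
  refine (Finset.card_le_card hsub).trans ?_
  refine (Finset.card_biUnion_le_card_mul _ _ _ fun h0 _ => ?_).trans
    (Nat.mul_le_mul_right _ (by rw [Int.card_Icc]; omega))
  refine (h.count (i := l) (h1 := h0) (h2 := h0 + W) (lo := h0 - K) (hi := h0 + W + K)
    (A0 := (f (a, i)).1) fun c hc => ?_).trans ?_
  · obtain ⟨hc1, hc2⟩ := Finset.mem_filter.1 hc
    have hcB := (Finset.mem_filter.1 hc1).1
    have e := hc2 l hil le_rfl
    rw [hend c hcB] at e
    refine ⟨e.1, e.2, fun j hj => ?_⟩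
    have hj' : (f (sp l c a, l)).1 j = (f (sp i c a, i)).1 j := by
      rcases hj with hj | hj
      · exact walk_eq_below (γ := fun r => f (sp r c a, r)) (h.path c a) hil
          (fun r h1 h2 => (hc2 r h1 h2).1) hj
      · exact walk_eq_above (γ := fun r => f (sp r c a, r)) (h.path c a) hil
          (fun r h1 h2 => (hc2 r h1 h2).2) hj
    rwa [hstart c hcB, hend c hcB] at hj'
  · rw [show h0 + W + 1 - h0 = W + 1 by ring, show h0 + W + K - (h0 - K) = W + 2 * K by ring]

end Geometry

/-- The expected vertical scaling factor `log |α| / log |β|`. -/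
def lam (α β : Type*) [Fintype α] [Fintype β] : ℝ :=
  Real.log (Fintype.card α) / Real.log (Fintype.card β)

section Lam

variable {α β : Type*} [Fintype α] [Fintype β]

lemma log_card_pos (hα : 2 ≤ Fintype.card α) : 0 < Real.log (Fintype.card α) :=
  Real.log_pos (by exact_mod_cast (by omega : 1 < Fintype.card α))

lemma lam_pos (hα : 2 ≤ Fintype.card α) (hβ : 2 ≤ Fintype.card β) : 0 < lam α β :=
  div_pos (log_card_pos hα) (log_card_pos hβ)

lemma lam_inv : lam β α = (lam α β)⁻¹ := (inv_div _ _).symm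

lemma card_rpow_lam (hα : 2 ≤ Fintype.card α) (hβ : 2 ≤ Fintype.card β) (x : ℝ) :
    (Fintype.card β : ℝ) ^ (lam α β * x) = (Fintype.card α : ℝ) ^ x := by
  have hα' : (0 : ℝ) < Fintype.card α := by exact_mod_cast (by omega : 0 < Fintype.card α)
  have hβ' : (0 : ℝ) < Fintype.card β := by exact_mod_cast (by omega : 0 < Fintype.card β)
  rw [Real.rpow_def_of_pos hα', Real.rpow_def_of_pos hβ', lam]
  congr 1
  have := (log_card_pos hβ).ne'
  field_simp

end Lam

section StepA

variable {α β : Type*} [Zero α] [Zero β] [Fintype α] [Fintype β]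
variable {f : (ℤ →₀ α) × ℤ → (ℤ →₀ β) × ℤ} {g : (ℤ →₀ β) × ℤ → (ℤ →₀ α) × ℤ} {K : ℤ}

lemma exists_sq_mul_pow_le {x : ℝ} (hx0 : 0 ≤ x) (hx : x < 1) (C : ℝ) {θ : ℝ} (hθ : 0 < θ) :
    ∃ N : ℕ, ∀ n ≥ N, C * ((n : ℝ) ^ 2 * x ^ n) ≤ θ := by
  have h1 := (tendsto_pow_const_mul_const_pow_of_abs_lt_one 2
    (by rwa [abs_of_nonneg hx0] : |x| < 1)).const_mul C
  rw [mul_zero] at h1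
  exact Filter.eventually_atTop.1 (h1.eventually (ge_mem_nhds hθ))

/-- Most vertical paths have oscillation at least about `lam * length` under `f`. -/
lemma CQ.osc_lower (h : CQ f g K) (hα : 2 ≤ Fintype.card α) (hβ : 2 ≤ Fintype.card β)
    {δ θ : ℝ} (hδ : 0 < δ) (hθ : 0 < θ) : ∃ L0 : ℤ, 1 ≤ L0 ∧ ∀ L : ℤ, L0 ≤ L →
    ∀ (a : ℤ →₀ α) (i : ℤ), pr (Bx a i (i + L)) (fun c => ∀ r s, i ≤ r → r ≤ i + L → i ≤ s →
      s ≤ i + L → ((f (sp s c a, s)).2 : ℝ) - (f (sp r c a, r)).2 ≤ (lam α β - δ) * L) ≤ θ := by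
  have hK := h.one_le
  set n : ℝ := (Fintype.card α : ℝ) with hn
  set m : ℝ := (Fintype.card β : ℝ) with hm
  have hn1 : 1 ≤ n := by rw [hn]; exact_mod_cast (by omega : 1 ≤ Fintype.card α)
  have hm1 : 1 < m := by rw [hm]; exact_mod_cast (by omega : 1 < Fintype.card β)
  have hm0 : 0 < m := by linarith
  have hlam := lam_pos hα hβ
  set C : ℝ := (lam α β + 1) ^ 2 * n ^ (4 * K).toNat * m ^ (2 * K : ℝ) with hC
  have hC0 : 0 ≤ C := by positivity
  obtain ⟨N, hN⟩ := exists_sq_mul_pow_le (x := m ^ (-δ)) (by positivity)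
    (Real.rpow_lt_one_of_one_lt_of_neg hm1 (by linarith)) C hθ
  refine ⟨max 1 N, le_max_left _ _, fun L hL a i => ?_⟩
  have hL1 : 1 ≤ L := le_trans (le_max_left _ _) hL
  lift L to ℕ using by omega with l
  have hlN : N ≤ l := by exact_mod_cast le_trans (le_max_right _ _) hL
  have hl1 : (1 : ℝ) ≤ l := by exact_mod_cast hL1
  set W : ℤ := ⌊(lam α β - δ) * l⌋ with hWdef
  by_cases hW : 0 ≤ W
  · have hWle : (W : ℝ) ≤ (lam α β - δ) * l := Int.floor_le _
    have hW0 : (0 : ℝ) ≤ W := by exact_mod_cast hW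
    have e1 := h.count_osc a (i := i) (l := i + l) (W := W) (by omega) hW
    refine le_trans ?_ (hN l hlN)
    have e2 : pr (Bx a i (i + l)) (fun c => ∀ r s, i ≤ r → r ≤ i + l → i ≤ s →
        s ≤ i + l → ((f (sp s c a, s)).2 : ℝ) - (f (sp r c a, r)).2 ≤ (lam α β - δ) * (l : ℤ))
        ≤ pr (Bx a i (i + l)) (fun c => ∀ r s, i ≤ r → r ≤ i + l → i ≤ s →
        s ≤ i + l → (f (sp s c a, s)).2 - (f (sp r c a, r)).2 ≤ W) := by
      refine pr_mono fun c _ hc r s h1 h2 h3 h4 => ?_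
      have := hc r s h1 h2 h3 h4
      rw [hWdef, Int.le_floor]
      push_cast at this ⊢
      exact this
    refine e2.trans ?_
    rw [pr_eq_card_div, card_Bx_real _ (by omega : i ≤ i + l)]
    have e3 : (((i + l : ℤ) : ℝ) - i) = l := by push_cast; ring
    rw [e3, ← hn, div_le_iff₀ (by positivity)]
    have e4 : (((W + 1).toNat * (Fintype.card α ^ (4 * K).toNat *
      ((W + 1).toNat * Fintype.card β ^ (W + 2 * K).toNat)) : ℕ) : ℝ)
      = (W + 1) ^ 2 * n ^ (4 * K).toNat * m ^ ((W : ℝ) + 2 * K) := by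
      have t1 : (((W + 1).toNat : ℕ) : ℝ) = W + 1 := by
        have : (((W + 1).toNat : ℤ)) = W + 1 := Int.toNat_of_nonneg (by omega)
        exact_mod_cast congrArg (Int.cast : ℤ → ℝ) this
      have t2 : (Fintype.card β : ℝ) ^ (W + 2 * K).toNat = m ^ ((W : ℝ) + 2 * K) := by
        rw [← Real.rpow_natCast]
        congr 1
        have : (((W + 2 * K).toNat : ℤ)) = W + 2 * K := Int.toNat_of_nonneg (by omega)
        exact_mod_cast congrArg (Int.cast : ℤ → ℝ) this
      push_cast
      rw [t1, t2]; ring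
    have e5 : m ^ ((W : ℝ) + 2 * K) ≤ (m ^ (-δ)) ^ l * n ^ (l : ℝ) * m ^ (2 * K : ℝ) := by
      rw [← card_rpow_lam hα hβ, ← Real.rpow_natCast, ← Real.rpow_mul hm0.le,
        ← hm, ← Real.rpow_add hm0, ← Real.rpow_add hm0]
      exact Real.rpow_le_rpow_of_exponent_le hm1.le (by linarith)
    have e6 : ((W : ℝ) + 1) ^ 2 ≤ (lam α β + 1) ^ 2 * l ^ 2 := by
      rw [← mul_pow]
      refine pow_le_pow_left₀ (by positivity) ?_ 2
      nlinarith
    refine le_trans (Nat.cast_le.2 e1) ?_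
    rw [e4]
    calc ((W : ℝ) + 1) ^ 2 * n ^ (4 * K).toNat * m ^ ((W : ℝ) + 2 * K)
        ≤ ((lam α β + 1) ^ 2 * l ^ 2) * n ^ (4 * K).toNat
            * ((m ^ (-δ)) ^ l * n ^ (l : ℝ) * m ^ (2 * K : ℝ)) := by gcongr
      _ = C * ((l : ℝ) ^ 2 * (m ^ (-δ)) ^ l) * n ^ (l : ℝ) := by rw [hC]; ring
  · refine le_trans ?_ hθ.le
    refine (pr_mono (q := fun _ => False) fun c _ hc => ?_).trans (by simp [pr])
    have := hc i i le_rfl (by omega) le_rfl (by omega)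
    rw [sub_self] at this
    exact hW (Int.floor_nonneg.2 (by exact_mod_cast this))

end StepA

section Paths

variable {α β : Type*} [Zero α] [Zero β]
variable {f : (ℤ →₀ α) × ℤ → (ℤ →₀ β) × ℤ} {g : (ℤ →₀ β) × ℤ → (ℤ →₀ α) × ℤ} {K : ℤ}

/-- The height of the `f`-image of the point at level `r` of the vertical path `x`. -/
def pth (f : (ℤ →₀ α) × ℤ → (ℤ →₀ β) × ℤ) (x : (ℤ →₀ α) × (ℤ →₀ α)) (r : ℤ) : ℝ :=
  ((f (sp r x.2 x.1, r)).2 : ℝ)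

lemma pth_sub (x : (ℤ →₀ α) × (ℤ →₀ α)) {r t s : ℤ} (h1 : r ≤ t) (h2 : t ≤ s) :
    pth f (sp r x.2 x.1, sp s x.2 x.1) t = pth f x t := by
  simp only [pth]; rw [sp_sp_sub _ _ h1 h2]

lemma pth_congr {q c q' c' : ℤ →₀ α} {r : ℤ} (e : sp r c q = sp r c' q') :
    pth f (q, c) r = pth f (q', c') r := by simp only [pth, e]

lemma CQ.pth_lip (h : CQ f g K) (x : (ℤ →₀ α) × (ℤ →₀ α)) {r s : ℤ} (hrs : r ≤ s) :
    |pth f x s - pth f x r| ≤ K * (s - r) := h.path_lip_real x.2 x.1 hrs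

variable [Fintype α] [Fintype β]

lemma sp_bot {o q c : ℤ →₀ α} {k l : ℤ} (hq : q ∈ Bx o k l) (hc : c ∈ Bx o k l) :
    sp k c q = q := by
  ext i; simp only [sp_apply]; split_ifs with h
  · rw [mem_Bx.1 hc i (Or.inl h), mem_Bx.1 hq i (Or.inl h)]
  · rfl

lemma sp_top {o q c : ℤ →₀ α} {k l : ℤ} (hq : q ∈ Bx o k l) (hc : c ∈ Bx o k l) :
    sp l c q = c := by
  ext i; simp only [sp_apply]; split_ifs with h
  · rfl
  · rw [mem_Bx.1 hc i (by omega), mem_Bx.1 hq i (by omega)]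

lemma expect_pair (q c : ℤ →₀ α) {r s : ℤ} (hrs : r ≤ s) (ψ : (ℤ →₀ α) × (ℤ →₀ α) → ℝ) :
    𝔼 q' ∈ Bx q r s, 𝔼 c' ∈ Bx c r s, ψ (sp r c q', sp s c' q)
      = 𝔼 y ∈ Bx2 (sp r c q) r s, ψ y := by
  unfold Bx2
  rw [Finset.expect_product, ← expect_Bx_map (a := q) (b := sp r c q) (sp r c)]
  · refine Finset.expect_congr rfl fun q' hq' => ?_
    refine expect_Bx_map (fun c' => sp s c' q) ?_ ?_ fun c' => ψ (sp r c q', c')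
    · intro c' hc'
      refine mem_Bx.2 fun i hi => ?_
      simp only [sp_apply]
      split_ifs <;> first | rfl | omega | exact mem_Bx.1 hc' i hi
    · intro c' hc' i h1 h2
      simp only [sp_apply]; rw [if_pos (by omega)]
  · intro q' hq'
    refine mem_Bx.2 fun i hi => ?_
    simp only [sp_apply]
    split_ifs <;> first | rfl | omega | exact mem_Bx.1 hq' i hi
  · intro q' hq' i h1 h2
    simp only [sp_apply]; rw [if_neg (by omega)]

lemma expect_pair_level (q c : ℤ →₀ α) {r t s : ℤ} (h1 : r ≤ t) (h2 : t ≤ s)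
    (φ : (ℤ →₀ α) → ℝ) :
    𝔼 q' ∈ Bx q r s, 𝔼 c' ∈ Bx c r s, φ (sp t c' q') = 𝔼 w ∈ Bx (sp r c q) r s, φ w := by
  rw [← expect_level _ h1 φ, ← expect_pair q c (h1.trans h2) fun x => φ (sp t x.2 x.1)]
  refine Finset.expect_congr rfl fun q' hq' => Finset.expect_congr rfl fun c' hc' => ?_
  congr 1
  ext i
  simp only [sp_apply]
  split_ifs <;> first | rfl | omega

/-- The mean square displacement over boxes of length `D` is at most `v * D ^ 2`. -/
def msq (f : (ℤ →₀ α) × ℤ → (ℤ →₀ β) × ℤ) (D : ℤ) (v : ℝ) : Prop :=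
  ∀ o k, 𝔼 x ∈ Bx2 o k (k + D), (pth f x (k + D) - pth f x k) ^ 2 ≤ v * D ^ 2

omit [Fintype β] in
lemma msq.sub {D : ℤ} {v : ℝ} (hm : msq f D v) (hD : 0 ≤ D) (o : ℤ →₀ α) {k r l : ℤ}
    (hr : k ≤ r) (hl : r + D ≤ l) :
    𝔼 x ∈ Bx2 o k l, (pth f x (r + D) - pth f x r) ^ 2 ≤ v * D ^ 2 := by
  have := expect_subbox_le o hr (by omega : r ≤ r + D) hl
    (fun x => (pth f x (r + D) - pth f x r) ^ 2) (fun o' => hm o' r)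
  refine le_trans (le_of_eq (Finset.expect_congr rfl fun x _ => ?_)) this
  rw [pth_sub x (by omega) le_rfl, pth_sub x le_rfl (by omega)]

omit [Fintype β] in
lemma msq.mul {D : ℤ} {v : ℝ} (hm : msq f D v) (hD : 0 ≤ D) {t : ℤ} (ht : 1 ≤ t) :
    msq f (t * D) v := by
  induction t, ht using Int.leInduction with
  | base => simpa using hm
  | succ t ht ih =>
    intro o k
    have ht' : (1 : ℝ) ≤ t := by exact_mod_cast ht
    have htD : 0 ≤ t * D := by positivity
    have e1 := ih.sub htD o le_rfl (by nlinarith : k + t * D ≤ k + (t + 1) * D)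
    have e2 := hm.sub hD o (by linarith : k ≤ k + t * D)
        (by linarith : k + t * D + D ≤ k + (t + 1) * D)
    rw [show k + t * D + D = k + (t + 1) * D by ring] at e2
    have key : ∀ x : (ℤ →₀ α) × (ℤ →₀ α), (pth f x (k + (t + 1) * D) - pth f x k) ^ 2 ≤
        ((t + 1) / t : ℝ) * (pth f x (k + t * D) - pth f x k) ^ 2 +
        (t + 1 : ℝ) * (pth f x (k + (t + 1) * D) - pth f x (k + t * D)) ^ 2 := by
      intro x
      have ht0 : (t : ℝ) ≠ 0 := by positivity
      have : ((t + 1) / t : ℝ) * (pth f x (k + t * D) - pth f x k) ^ 2 +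
        (t + 1 : ℝ) * (pth f x (k + (t + 1) * D) - pth f x (k + t * D)) ^ 2
        - (pth f x (k + (t + 1) * D) - pth f x k) ^ 2 =
        ((pth f x (k + t * D) - pth f x k) -
          t * (pth f x (k + (t + 1) * D) - pth f x (k + t * D))) ^ 2 / t := by
        field_simp; ring
      have h2 : 0 ≤ ((pth f x (k + t * D) - pth f x k) -
          t * (pth f x (k + (t + 1) * D) - pth f x (k + t * D))) ^ 2 / t := by positivity
      linarith
    refine (Finset.expect_le_expect fun x _ => key x).trans ?_
    rw [Finset.expect_add_distrib, ← Finset.mul_expect, ← Finset.mul_expect]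
    calc _ ≤ ((t + 1) / t : ℝ) * (v * (t * D : ℤ) ^ 2) + (t + 1 : ℝ) * (v * D ^ 2) := by gcongr
      _ = v * (((t + 1) * D : ℤ) : ℝ) ^ 2 := by push_cast; field_simp

omit [Fintype β] in
lemma CQ.msq_bound (h : CQ f g K) {D : ℤ} (hD : 1 ≤ D) : msq f D (K ^ 2) := by
  intro o k
  refine Finset.expect_le (Bx2_nonempty _ _ _) fun x _ => ?_
  have := h.pth_lip x (by omega : k ≤ k + D)
  rw [← mul_pow, ← sq_abs]
  refine pow_le_pow_left₀ (abs_nonneg _) (this.trans (le_of_eq ?_)) 2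
  push_cast; ring

/-- The deviation from affine interpolation. -/
def dev (f : (ℤ →₀ α) × ℤ → (ℤ →₀ β) × ℤ) (k D N i : ℤ) (x : (ℤ →₀ α) × (ℤ →₀ α)) : ℝ :=
  N * pth f x (k + i * D) - (N - i) * pth f x k - i * pth f x (k + N * D)

omit [Fintype β] in
lemma dev_sq_le {D N i : ℤ} {v ε : ℝ} (hD : 1 ≤ D) (hi : 0 < i) (hiN : i < N)
    (hm : msq f D (v + ε)) (hε : 0 ≤ ε) (o : ℤ →₀ α) (k : ℤ)
    (hlow : (v - ε) * (N * D) ^ 2 ≤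
      𝔼 x ∈ Bx2 o k (k + N * D), (pth f x (k + N * D) - pth f x k) ^ 2) :
    𝔼 x ∈ Bx2 o k (k + N * D), dev f k D N i x ^ 2 ≤ ε * N ^ 4 * D ^ 2 := by
  have hi' : (0 : ℝ) < i := by exact_mod_cast hi
  have hiN' : (0 : ℝ) < (N : ℝ) - i := by
    have : (i : ℝ) < N := by exact_mod_cast hiN
    linarith
  have e1 := (hm.mul (by omega) (by omega : 1 ≤ i)).sub (by positivity) o le_rfl
    (by nlinarith : k + i * D ≤ k + N * D)
  have e2 := (hm.mul (by omega) (by omega : 1 ≤ N - i)).sub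
    (by have : 0 < N - i := by omega
        positivity) o (by nlinarith : k ≤ k + i * D)
    (by linarith : k + i * D + (N - i) * D ≤ k + N * D)
  rw [show k + i * D + (N - i) * D = k + N * D by ring] at e2
  set X := 𝔼 x ∈ Bx2 o k (k + N * D), (pth f x (k + i * D) - pth f x k) ^ 2
  set Y := 𝔼 x ∈ Bx2 o k (k + N * D), (pth f x (k + N * D) - pth f x (k + i * D)) ^ 2
  set Z := 𝔼 x ∈ Bx2 o k (k + N * D), (pth f x (k + N * D) - pth f x k) ^ 2
  have key : 𝔼 x ∈ Bx2 o k (k + N * D), dev f k D N i x ^ 2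
      = (N * (N - i)) * X + (N * i) * Y - (i * (N - i)) * Z := by
    simp only [X, Y, Z]
    rw [Finset.mul_expect, Finset.mul_expect, Finset.mul_expect, ← Finset.expect_add_distrib,
      ← Finset.expect_sub_distrib]
    refine Finset.expect_congr rfl fun x _ => ?_
    simp only [dev]; ring
  rw [key]
  have hN' : (0 : ℝ) < N := by linarith
  have f1 : (N * (N - i) : ℝ) * X ≤ (N * (N - i)) * ((v + ε) * (i * D : ℤ) ^ 2) :=
    mul_le_mul_of_nonneg_left e1 (by positivity)
  have f2 : (N * i : ℝ) * Y ≤ (N * i) * ((v + ε) * ((N - i) * D : ℤ) ^ 2) :=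
    mul_le_mul_of_nonneg_left e2 (by positivity)
  have f3 : (i * (N - i) : ℝ) * ((v - ε) * (N * D) ^ 2) ≤ (i * (N - i)) * Z :=
    mul_le_mul_of_nonneg_left hlow (by positivity)
  push_cast at f1 f2
  have f4 : (N * (N - i) : ℝ) * ((v + ε) * (i * D) ^ 2) + (N * i) * ((v + ε) * ((N - i) * D) ^ 2)
      - (i * (N - i)) * ((v - ε) * (N * D) ^ 2) = 2 * ε * (i * (N - i)) * (N ^ 2 * D ^ 2) := by
    ring
  have f5 : 2 * ε * (i * (N - i)) * (N ^ 2 * D ^ 2 : ℝ) ≤ ε * N ^ 2 * (N ^ 2 * D ^ 2) := by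
    have : 2 * ε * ((i : ℝ) * (N - i)) ≤ ε * N ^ 2 := by
      have : 2 * ((i : ℝ) * (N - i)) ≤ N ^ 2 := by nlinarith [sq_nonneg ((i : ℝ) - (N - i))]
      nlinarith
    exact mul_le_mul_of_nonneg_right this (by positivity)
  linarith [show ε * N ^ 2 * (N ^ 2 * D ^ 2 : ℝ) = ε * N ^ 4 * D ^ 2 by ring]

omit [Fintype β] in
lemma dev_fix {k D N i : ℤ} (hD : 1 ≤ D) (hi : 0 < i) (hiN : i < N) {q c q' c' : ℤ →₀ α}
    (hq : q' ∈ Bx q (k + D) (k + (N - 1) * D)) (hc : c' ∈ Bx c (k + D) (k + (N - 1) * D)) :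
    (N * pth f (q', c') (k + i * D) - (N - i) * pth f (q, c) k
        - i * pth f (q, c) (k + N * D)) ^ 2 ≤
      3 * dev f k D N i (q', c') ^ 2
      + 6 * N ^ 2 * (dev f k D N (N - 1) (q', c) ^ 2 + dev f k D N (N - 1) (q, c) ^ 2)
      + 6 * N ^ 2 * (dev f k D N 1 (q, c') ^ 2 + dev f k D N 1 (q, c) ^ 2) := by
  have a1 : k + D ≤ k + N * D := by nlinarith
  have hN1 : k + (N - 1) * D ≤ k + N * D := by nlinarith
  have hkN : k ≤ k + (N - 1) * D := by nlinarith
  have b1 : pth f (q', c') (k + N * D) = pth f (q, c') (k + N * D) := by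
    refine pth_congr ?_; ext j; simp only [sp_apply]; split_ifs with hj
    · rfl
    · exact mem_Bx.1 hq j (by omega)
  have b2 : pth f (q, c') k = pth f (q, c) k := by
    refine pth_congr ?_; ext j; simp only [sp_apply]; split_ifs with hj
    · exact mem_Bx.1 hc j (by omega)
    · rfl
  have b3 : pth f (q, c') (k + 1 * D) = pth f (q, c) (k + 1 * D) := by
    refine pth_congr ?_; ext j; simp only [sp_apply]; split_ifs with hj
    · exact mem_Bx.1 hc j (by omega)
    · rfl
  have b4 : pth f (q', c') k = pth f (q', c) k := by
    refine pth_congr ?_; ext j; simp only [sp_apply]; split_ifs with hj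
    · exact mem_Bx.1 hc j (by omega)
    · rfl
  have b5 : pth f (q', c) (k + N * D) = pth f (q, c) (k + N * D) := by
    refine pth_congr ?_; ext j; simp only [sp_apply]; split_ifs with hj
    · rfl
    · exact mem_Bx.1 hq j (by omega)
  have b6 : pth f (q', c) (k + (N - 1) * D) = pth f (q, c) (k + (N - 1) * D) := by
    refine pth_congr ?_; ext j; simp only [sp_apply]; split_ifs with hj
    · rfl
    · exact mem_Bx.1 hq j (by omega)
  have d1 : dev f k D N 1 (q, c') - dev f k D N 1 (q, c)
      = -(pth f (q', c') (k + N * D) - pth f (q, c) (k + N * D)) := by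
    simp only [dev]; rw [b1, b2, b3]; push_cast; ring
  have d2 : dev f k D N (N - 1) (q', c) - dev f k D N (N - 1) (q, c)
      = -(pth f (q', c') k - pth f (q, c) k) := by
    simp only [dev]; rw [b4, b5, b6]; push_cast; ring
  have d3 : N * pth f (q', c') (k + i * D) - (N - i) * pth f (q, c) k
        - i * pth f (q, c) (k + N * D) = dev f k D N i (q', c')
      - (N - i) * (dev f k D N (N - 1) (q', c) - dev f k D N (N - 1) (q, c))
      - i * (dev f k D N 1 (q, c') - dev f k D N 1 (q, c)) := by
    rw [d1, d2]; simp only [dev]; ring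
  rw [d3]
  set A := dev f k D N i (q', c')
  set P := dev f k D N (N - 1) (q', c)
  set P' := dev f k D N (N - 1) (q, c)
  set Q := dev f k D N 1 (q, c')
  set Q' := dev f k D N 1 (q, c)
  have hi' : (0 : ℝ) < i := by exact_mod_cast hi
  have hiN' : (i : ℝ) < N := by exact_mod_cast hiN
  have g1 : ((N - i) * (P - P')) ^ 2 ≤ (N : ℝ) ^ 2 * (2 * (P ^ 2 + P' ^ 2)) := by
    rw [mul_pow]
    gcongr
    · linarith
    · nlinarith [sq_nonneg (P + P')]
  have g2 : (i * (Q - Q')) ^ 2 ≤ (N : ℝ) ^ 2 * (2 * (Q ^ 2 + Q' ^ 2)) := by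
    rw [mul_pow]
    gcongr
    · nlinarith [sq_nonneg (Q + Q')]
  have g3 : ∀ a b c : ℝ, (a - b - c) ^ 2 ≤ 3 * a ^ 2 + 3 * b ^ 2 + 3 * c ^ 2 := fun a b c => by
    nlinarith [sq_nonneg (a + b), sq_nonneg (a + c), sq_nonneg (b - c)]
  linarith [g3 A ((N - i) * (P - P')) (i * (Q - Q'))]

end Paths

section Affine

variable {α β : Type*} [Zero α] [Zero β] [Fintype α] [Fintype β]
variable {f : (ℤ →₀ α) × ℤ → (ℤ →₀ β) × ℤ} {g : (ℤ →₀ β) × ℤ → (ℤ →₀ α) × ℤ} {K : ℤ}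

lemma expect_resample_fst (o : ℤ →₀ α) {k l r s : ℤ} (hk : k ≤ r) (hl : s ≤ l)
    (Φ : (ℤ →₀ α) × (ℤ →₀ α) → ℝ) :
    𝔼 x ∈ Bx2 o k l, 𝔼 q' ∈ Bx x.1 r s, Φ (q', x.2) = 𝔼 x ∈ Bx2 o k l, Φ x := by
  unfold Bx2
  rw [Finset.expect_product, Finset.expect_product, Finset.expect_comm,
    Finset.expect_comm (f := fun x y => Φ (x, y))]
  exact Finset.expect_congr rfl fun c _ => expect_resample o hk hl fun q => Φ (q, c)

lemma expect_resample_snd (o : ℤ →₀ α) {k l r s : ℤ} (hk : k ≤ r) (hl : s ≤ l)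
    (Φ : (ℤ →₀ α) × (ℤ →₀ α) → ℝ) :
    𝔼 x ∈ Bx2 o k l, 𝔼 c' ∈ Bx x.2 r s, Φ (x.1, c') = 𝔼 x ∈ Bx2 o k l, Φ x := by
  unfold Bx2
  rw [Finset.expect_product, Finset.expect_product]
  exact Finset.expect_congr rfl fun q _ => expect_resample o hk hl fun c => Φ (q, c)

lemma expect_resample_pair (o : ℤ →₀ α) {k l r s : ℤ} (hk : k ≤ r) (hl : s ≤ l)
    (Φ : (ℤ →₀ α) × (ℤ →₀ α) → ℝ) :
    𝔼 x ∈ Bx2 o k l, 𝔼 q' ∈ Bx x.1 r s, 𝔼 c' ∈ Bx x.2 r s, Φ (q', c') =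
      𝔼 x ∈ Bx2 o k l, Φ x := by
  rw [expect_resample_fst o hk hl fun x => 𝔼 c' ∈ Bx x.2 r s, Φ (x.1, c'),
    expect_resample_snd o hk hl]

/-- The mean square deviation from affine interpolation when the middle of the path is
resampled. -/
def midErr (f : (ℤ →₀ α) × ℤ → (ℤ →₀ β) × ℤ) (k D N i : ℤ) (x : (ℤ →₀ α) × (ℤ →₀ α)) : ℝ :=
  𝔼 q' ∈ Bx x.1 (k + D) (k + (N - 1) * D), 𝔼 c' ∈ Bx x.2 (k + D) (k + (N - 1) * D),
    (N * pth f (q', c') (k + i * D) - (N - i) * pth f x k - i * pth f x (k + N * D)) ^ 2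

omit [Fintype β] in
lemma midErr_nonneg (k D N i : ℤ) (x : (ℤ →₀ α) × (ℤ →₀ α)) : 0 ≤ midErr f k D N i x :=
  Finset.expect_nonneg fun _ _ => Finset.expect_nonneg fun _ _ => sq_nonneg _

omit [Fintype β] in
lemma expect_midErr_le {D N i : ℤ} {v ε : ℝ} (hD : 1 ≤ D) (hi : 0 < i) (hiN : i < N)
    (hm : msq f D (v + ε)) (hε : 0 ≤ ε) (o : ℤ →₀ α) (k : ℤ)
    (hlow : (v - ε) * (N * D) ^ 2 ≤
      𝔼 x ∈ Bx2 o k (k + N * D), (pth f x (k + N * D) - pth f x k) ^ 2) :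
    𝔼 x ∈ Bx2 o k (k + N * D), midErr f k D N i x ≤ 27 * ε * N ^ 4 * (N * D) ^ 2 := by
  have hN : 2 ≤ N := by omega
  have hN' : (2 : ℝ) ≤ N := by exact_mod_cast hN
  have hk : k ≤ k + D := by omega
  have hl : k + (N - 1) * D ≤ k + N * D := by nlinarith
  have ne1 : ∀ a : ℤ →₀ α, (Bx a (k + D) (k + (N - 1) * D)).Nonempty := fun a => Bx_nonempty _ _ _
  have b0 := dev_sq_le hD hi hiN hm hε o k hlow
  have b1 := dev_sq_le hD (by omega : 0 < N - 1) (by omega : N - 1 < N) hm hε o k hlow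
  have b2 := dev_sq_le hD one_pos (by omega : 1 < N) hm hε o k hlow
  set e : ℝ := ε * N ^ 4 * D ^ 2
  have he : 0 ≤ e := by positivity
  have step : ∀ x ∈ Bx2 o k (k + N * D), midErr f k D N i x ≤
      3 * (𝔼 q' ∈ Bx x.1 (k + D) (k + (N - 1) * D), 𝔼 c' ∈ Bx x.2 (k + D) (k + (N - 1) * D),
        dev f k D N i (q', c') ^ 2)
      + 6 * N ^ 2 * ((𝔼 q' ∈ Bx x.1 (k + D) (k + (N - 1) * D), dev f k D N (N - 1) (q', x.2) ^ 2)
          + dev f k D N (N - 1) x ^ 2)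
      + 6 * N ^ 2 * ((𝔼 c' ∈ Bx x.2 (k + D) (k + (N - 1) * D), dev f k D N 1 (x.1, c') ^ 2)
          + dev f k D N 1 x ^ 2) := by
    rintro ⟨q, c⟩ _
    unfold midErr
    refine (Finset.expect_le_expect fun q' hq' => Finset.expect_le_expect fun c' hc' =>
      dev_fix hD hi hiN hq' hc').trans (le_of_eq ?_)
    simp only [Finset.expect_add_distrib, ← Finset.mul_expect, Finset.expect_const (ne1 _)]
  refine (Finset.expect_le_expect step).trans ?_
  simp only [Finset.expect_add_distrib, ← Finset.mul_expect]
  rw [expect_resample_pair o hk hl fun x => dev f k D N i x ^ 2,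
    expect_resample_fst o hk hl fun x => dev f k D N (N - 1) x ^ 2,
    expect_resample_snd o hk hl fun x => dev f k D N 1 x ^ 2]
  calc _ ≤ 3 * e + 6 * N ^ 2 * (e + e) + 6 * N ^ 2 * (e + e) := by gcongr
    _ ≤ 27 * (N ^ 2 * e) := by
      have := le_mul_of_one_le_left he (by nlinarith : (1 : ℝ) ≤ N ^ 2)
      linarith
    _ = 27 * ε * N ^ 4 * (N * D) ^ 2 := by simp only [e]; ring

omit [Fintype β] in
/-- If `v` is the optimal mean square speed, there are boxes in which the height is almost affine
with slope at least about `√v`. -/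
lemma CQ.affine_box (h : CQ f g K) {v : ℝ} (hv : 0 ≤ v)
    (hinf : ∀ ε : ℝ, 0 < ε → ∃ D : ℤ, 1 ≤ D ∧ msq f D (v + ε))
    (hsup : ∀ D : ℤ, 1 ≤ D → ∀ ε : ℝ, 0 < ε → ¬ msq f D (v - ε))
    {N : ℤ} (hN : 3 ≤ N) {η : ℝ} (hη : 0 < η) (D0 : ℤ) :
    ∃ D : ℤ, 1 ≤ D ∧ D0 ≤ D ∧ ∃ (o : ℤ →₀ α) (k : ℤ) (b a : ℝ),
      (v - η) * (N * D) ^ 2 ≤ (a - b) ^ 2 ∧ |a - b| ≤ K * (N * D) ∧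
      ∀ i : ℤ, 0 < i → i < N → 𝔼 w ∈ Bx o (k + D) (k + (N - 1) * D),
        (N * ((f (w, k + i * D)).2 : ℝ) - (N - i) * b - i * a) ^ 2 ≤ η * (N * D) ^ 2 := by
  have hN' : (3 : ℝ) ≤ N := by exact_mod_cast hN
  set κ : ℝ := (K ^ 2 + η) / η with hκ
  have hκ0 : 0 < κ := by positivity
  set ε : ℝ := η / (1 + 27 * κ * N ^ 5) with hεdef
  have hden : 0 < 1 + 27 * κ * (N : ℝ) ^ 5 := by positivity
  have hε : 0 < ε := by positivity
  have hεη : ε * (1 + 27 * κ * N ^ 5) = η := div_mul_cancel₀ _ hden.ne'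
  obtain ⟨D1, hD1, hm1⟩ := hinf ε hε
  set D : ℤ := max 1 D0 * D1 with hDdef
  have hD : 1 ≤ D := by
    have : 1 ≤ max 1 D0 := le_max_left _ _
    nlinarith
  have hD0 : D0 ≤ D := by
    have h1 : 1 ≤ max 1 D0 := le_max_left _ _
    have h2 : D0 ≤ max 1 D0 := le_max_right _ _
    nlinarith
  have hm : msq f D (v + ε) := hm1.mul (by omega) (le_max_left _ _)
  have hno := hsup (N * D) (by nlinarith) ε hε
  unfold msq at hno
  push Not at hno
  obtain ⟨o, k, hok⟩ := hno
  push_cast at hok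
  have hDr : (1 : ℝ) ≤ D := by exact_mod_cast hD
  have hL : (0 : ℝ) < (N * D) ^ 2 := by positivity
  obtain ⟨x, hx, hxB⟩ := Finset.exists_le_of_le_expect (Bx2_nonempty o k (k + N * D))
    (f := fun x => (pth f x (k + N * D) - pth f x k) ^ 2
      - κ * ∑ i ∈ Finset.Ioo 0 N, midErr f k D N i x) (a := (v - η) * (N * D) ^ 2) (by
    rw [Finset.expect_sub_distrib, ← Finset.mul_expect, Finset.expect_sum_comm]
    have e1 : ∑ i ∈ Finset.Ioo 0 N, 𝔼 x ∈ Bx2 o k (k + N * D), midErr f k D N i x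
        ≤ N * (27 * ε * N ^ 4 * (N * D) ^ 2) := by
      refine (Finset.sum_le_card_nsmul _ _ _ fun i hi => expect_midErr_le hD
        (Finset.mem_Ioo.1 hi).1 (Finset.mem_Ioo.1 hi).2 hm hε.le o k hok.le).trans ?_
      rw [nsmul_eq_mul]
      refine mul_le_mul_of_nonneg_right ?_ (by positivity)
      rw [Int.card_Ioo]
      have : ((N - 0 - 1).toNat : ℤ) ≤ N := by omega
      exact_mod_cast this
    have e2 := mul_le_mul_of_nonneg_left e1 hκ0.le
    have e3 : (v - η) * (N * D : ℝ) ^ 2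
        = (v - ε) * (N * D) ^ 2 - κ * (N * (27 * ε * N ^ 4 * (N * D) ^ 2)) := by
      rw [← hεη]; ring
    linarith)
  obtain ⟨q, c⟩ := x
  have hS : 0 ≤ ∑ i ∈ Finset.Ioo 0 N, midErr f k D N i (q, c) :=
    Finset.sum_nonneg fun i _ => midErr_nonneg _ _ _ _ _
  have hlip : |pth f (q, c) (k + N * D) - pth f (q, c) k| ≤ K * (N * D) := by
    have := h.pth_lip (q, c) (by nlinarith : k ≤ k + N * D)
    push_cast at this
    rwa [add_sub_cancel_left] at this
  refine ⟨D, hD, hD0, sp (k + D) c q, k, pth f (q, c) k, pth f (q, c) (k + N * D), ?_, hlip, ?_⟩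
  · have := mul_nonneg hκ0.le hS
    linarith
  · intro i hi hiN
    have e0 : (pth f (q, c) (k + N * D) - pth f (q, c) k) ^ 2 ≤ K ^ 2 * (N * D) ^ 2 := by
      rw [← sq_abs, ← mul_pow]; exact pow_le_pow_left₀ (abs_nonneg _) hlip 2
    have e1 : κ * ∑ i ∈ Finset.Ioo 0 N, midErr f k D N i (q, c) ≤ (K ^ 2 + η) * (N * D) ^ 2 := by
      nlinarith
    have e2 : midErr f k D N i (q, c) ≤ ∑ i ∈ Finset.Ioo 0 N, midErr f k D N i (q, c) :=
      Finset.single_le_sum (f := fun i => midErr f k D N i (q, c))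
        (fun i _ => midErr_nonneg _ _ _ _ _) (Finset.mem_Ioo.2 ⟨hi, hiN⟩)
    have e3 : midErr f k D N i (q, c) ≤ η * (N * D) ^ 2 := by
      refine e2.trans ?_
      have : κ * ∑ i ∈ Finset.Ioo 0 N, midErr f k D N i (q, c) ≤ κ * (η * (N * D) ^ 2) := by
        refine e1.trans (le_of_eq ?_)
        rw [hκ]; field_simp
      exact le_of_mul_le_mul_left this hκ0
    refine le_trans (le_of_eq ?_) e3
    exact (expect_pair_level q c (by nlinarith : k + D ≤ k + i * D)
      (by nlinarith : k + i * D ≤ k + (N - 1) * D) fun w => (N * ((f (w, k + i * D)).2 : ℝ) -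
        (N - i) * pth f (q, c) k - i * pth f (q, c) (k + N * D)) ^ 2).symm

end Affine

section Affine

variable {α β : Type*} [Zero α] [Zero β] [Fintype α]
variable {f : (ℤ →₀ α) × ℤ → (ℤ →₀ β) × ℤ} {g : (ℤ →₀ β) × ℤ → (ℤ →₀ α) × ℤ} {K : ℤ}

omit [Fintype α] in
lemma CQ.vert_lip (h : CQ f g K) (a : ℤ →₀ α) {r s : ℤ} (hrs : r ≤ s) :
    |((f (a, s)).2 : ℝ) - (f (a, r)).2| ≤ K * (s - r) := by
  exact_mod_cast walk_lip (γ := fun r => f (a, r)) (h.vert a) hrs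

/-- If `v` is the optimal mean square speed, there are boxes in which the height is almost affine
at almost every point, with slope at least about `√v`. -/
lemma CQ.affine_box_pr (h : CQ f g K) {v : ℝ} (hv : 0 ≤ v)
    (hinf : ∀ ε : ℝ, 0 < ε → ∃ D : ℤ, 1 ≤ D ∧ msq f D (v + ε))
    (hsup : ∀ D : ℤ, 1 ≤ D → ∀ ε : ℝ, 0 < ε → ¬ msq f D (v - ε))
    {ε θ : ℝ} (hε : 0 < ε) (hθ : 0 < θ) (D0 : ℤ) :
    ∃ L : ℤ, 1 ≤ L ∧ D0 ≤ L ∧ ∃ (o : ℤ →₀ α) (k : ℤ) (A s : ℝ), v - ε ≤ s ^ 2 ∧ |s| ≤ K ∧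
      ∀ r : ℤ, k ≤ r → r ≤ k + L →
        pr (Bx o k (k + L)) (fun w => ε * L ≤ |((f (w, r)).2 : ℝ) - (A + s * (r - k))|) ≤ θ := by
  have hK : (1 : ℝ) ≤ K := by exact_mod_cast h.one_le
  obtain ⟨N0, hN0⟩ := exists_nat_gt ((2 * K + 1) / ε)
  set N : ℤ := N0 + 3 with hNdef
  have hN : 3 ≤ N := by omega
  have hN' : (3 : ℝ) ≤ N := by exact_mod_cast hN
  have hNε : (2 * K + 1 : ℝ) ≤ ε * (N - 2) := by
    rw [div_lt_iff₀ hε] at hN0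
    have : (N : ℝ) = N0 + 3 := by rw [hNdef]; push_cast; ring
    rw [this]; nlinarith
  obtain ⟨D, hD, hDD, o, k, b, a, h1, h2, h3⟩ := h.affine_box hv hinf hsup hN
    (lt_min hε hθ) D0
  have hD' : (1 : ℝ) ≤ D := by exact_mod_cast hD
  have hND : (0 : ℝ) < N * D := by positivity
  set s : ℝ := (a - b) / (N * D) with hs
  have hsab : s * (N * D) = a - b := div_mul_cancel₀ _ hND.ne'
  have hsK : |s| ≤ K := by
    rw [hs, abs_div, abs_of_pos hND, div_le_iff₀ hND]; exact h2
  refine ⟨(N - 2) * D, by nlinarith, by nlinarith, o, k + D, b + s * D, s, ?_, hsK, ?_⟩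
  · have : (v - min ε θ) * (N * D) ^ 2 ≤ s ^ 2 * (N * D) ^ 2 := by
      rw [← mul_pow, hsab]; exact h1
    have := le_of_mul_le_mul_right this (by positivity)
    have := min_le_left ε θ
    linarith
  · intro r hr1 hr2
    rw [show k + D + (N - 2) * D = k + (N - 1) * D by ring] at hr2 ⊢
    set i : ℤ := (r - k) / D with hi
    have hi1 : 0 < i := by
      have : 1 ≤ i := (Int.le_ediv_iff_mul_le (by omega)).2 (by linarith)
      omega
    have hiN : i < N := by
      have : i < N := Int.ediv_lt_of_lt_mul (by omega) (by nlinarith)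
      exact this
    have hr3 : i * D ≤ r - k := Int.ediv_mul_le _ (by omega)
    have hr4 : r - k < i * D + D := by
      have := Int.lt_ediv_add_one_mul_self (r - k) (by omega : 0 < D)
      rw [← hi] at this; linarith
    have hr3' : (i * D : ℝ) ≤ r - k := by exact_mod_cast hr3
    have hr4' : (r - k : ℝ) ≤ i * D + D := by exact_mod_cast hr4.le
    have hE := h3 i hi1 hiN
    have hmk := pr_markov (s := Bx o (k + D) (k + (N - 1) * D)) (fun x _ => sq_nonneg _)
      (by positivity : (0 : ℝ) < (N * D) ^ 2) hE
    rw [mul_div_cancel_right₀ _ (by positivity)] at hmk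
    refine ((pr_mono fun w _ hw => ?_).trans hmk).trans (min_le_right _ _)
    by_contra hcon
    have e1 := abs_lt_of_sq_lt_sq (not_le.1 hcon) hND.le
    rw [show (N * ((f (w, k + i * D)).2 : ℝ) - (N - i) * b - i * a)
      = N * ((f (w, k + i * D)).2 - (b + s * (i * D))) by
        have : a = b + s * (N * D) := by linarith
        rw [this]; ring, abs_mul, abs_of_pos (by linarith : (0 : ℝ) < N)] at e1
    have e2 := lt_of_mul_lt_mul_left e1 (by linarith)
    have e3 := h.vert_lip w (by linarith : k + i * D ≤ r)
    push_cast at e3 hw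
    have e4 : |s * (r - (k + i * D))| ≤ K * D := by
      rw [abs_mul]
      exact mul_le_mul hsK (by rw [abs_le]; constructor <;> linarith) (abs_nonneg _) (by linarith)
    have e5 : (K : ℝ) * (r - (k + i * D)) ≤ K * D :=
      mul_le_mul_of_nonneg_left (by linarith) (by linarith)
    have e6 : |((f (w, r)).2 : ℝ) - (b + s * D + s * (r - (k + D)))| < D + 2 * (K * D) := by
      rw [show ((f (w, r)).2 : ℝ) - (b + s * D + s * (r - (k + D))) =
        ((f (w, k + i * D)).2 - (b + s * (i * D))) + ((f (w, r)).2 - (f (w, k + i * D)).2)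
          - s * (r - (k + i * D)) by ring]
      refine (abs_sub _ _).trans_lt ?_
      have := abs_add_le (((f (w, k + i * D)).2 : ℝ) - (b + s * (i * D)))
        ((f (w, r)).2 - (f (w, k + i * D)).2)
      linarith
    have e7 : (2 * K + 1 : ℝ) * D ≤ ε * ((N - 2) * D) := by nlinarith
    linarith

end Affine

section WalkCount

variable {α β : Type*} [Zero α] [Zero β] [Fintype α] [Fintype β]
variable {f : (ℤ →₀ α) × ℤ → (ℤ →₀ β) × ℤ} {g : (ℤ →₀ β) × ℤ → (ℤ →₀ α) × ℤ} {K : ℤ}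

omit [Fintype β] in
/-- The fibres of `f` are small. -/
lemma CQ.card_le_of_fibre (h : CQ f g K) {y : (ℤ →₀ β) × ℤ} {S : Finset ((ℤ →₀ α) × ℤ)}
    (hS : ∀ p ∈ S, f p = y) :
    S.card ≤ Fintype.card α ^ (4 * K).toNat * (4 * K + 1).toNat := by
  rcases S.eq_empty_or_nonempty with rfl | ⟨p0, hp0⟩
  · simp
  · have h1 : S ⊆ Bx p0.1 (p0.2 - 2 * K) (p0.2 + 2 * K) ×ˢ
        Finset.Icc (p0.2 - 2 * K) (p0.2 + 2 * K) := by
      intro p hp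
      have := h.cl_of_f_eq ((hS p0 hp0).trans (hS p hp).symm)
      have e1 := this.snd_le
      have e2 := this.symm.snd_le
      refine Finset.mem_product.2 ⟨mem_Bx.2 fun j hj => ?_, Finset.mem_Icc.2 ⟨?_, ?_⟩⟩
      · rcases hj with hj | hj
        · exact (this.eq_below (by omega)).symm
        · exact (this.eq_above (by omega)).symm
      · omega
      · omega
    refine (Finset.card_le_card h1).trans (le_of_eq ?_)
    rw [Finset.card_product, card_Bx, Int.card_Icc]
    congr 2
    · congr 1; ring
    · ring

/-- The walk going up from `f p` along `d`, pulled back by `g`. -/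
def upw (f : (ℤ →₀ α) × ℤ → (ℤ →₀ β) × ℤ) (g : (ℤ →₀ β) × ℤ → (ℤ →₀ α) × ℤ)
    (p : (ℤ →₀ α) × ℤ) (d : ℤ →₀ β) (i : ℤ) : (ℤ →₀ α) × ℤ :=
  g (sp ((f p).2 + i) d (f p).1, (f p).2 + i)

/-- The bounded multiplicity of pulled-back walks. -/
def walkC (α β : Type*) [Fintype α] [Fintype β] (K : ℤ) : ℕ :=
  (Fintype.card α ^ (4 * K).toNat * (4 * K + 1).toNat) *
    (Fintype.card β ^ (4 * K).toNat * (4 * K + 1).toNat)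

lemma CQ.walk_fibre (h : CQ f g K) {i ℓ : ℤ} (hi : 0 ≤ i)
    (hil : i ≤ ℓ) (y : (ℤ →₀ β) × ℤ)
    (W : Finset (((ℤ →₀ α) × ℤ) × (ℤ →₀ β)))
    (hW : ∀ x ∈ W, x.2 ∈ Bx (f x.1).1 (f x.1).2 ((f x.1).2 + ℓ) ∧
      (sp ((f x.1).2 + i) x.2 (f x.1).1, (f x.1).2 + i) = y) :
    W.card ≤ (Fintype.card α ^ (4 * K).toNat * (4 * K + 1).toNat) * Fintype.card β ^ ℓ.toNat := by
  refine (Finset.card_le_mul_card_image (f := fun x => (f x.1, x.2)) W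
    (Fintype.card α ^ (4 * K).toNat * (4 * K + 1).toNat) ?_).trans (Nat.mul_le_mul_left _ ?_)
  · rintro ⟨z, d⟩ -
    have e : (W.filter fun x => (f x.1, x.2) = (z, d)).card =
        ((W.filter fun x => (f x.1, x.2) = (z, d)).image Prod.fst).card := by
      refine (Finset.card_image_of_injOn ?_).symm
      intro x hx x' hx' hxx
      have h1 := (Finset.mem_filter.1 hx).2
      have h2 := (Finset.mem_filter.1 hx').2
      exact Prod.ext hxx (by rw [(Prod.ext_iff.1 h1).2, (Prod.ext_iff.1 h2).2])
    rw [e]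
    refine h.card_le_of_fibre (y := z) fun p hp => ?_
    obtain ⟨x, hx, rfl⟩ := Finset.mem_image.1 hp
    exact (Prod.ext_iff.1 (Finset.mem_filter.1 hx).2).1
  · have h1 : W.image (fun x => (f x.1, x.2)) ⊆
        (Bx y.1 (y.2 - i) y.2 ×ˢ {y.2 - i}) ×ˢ Bx y.1 y.2 (y.2 - i + ℓ) := by
      intro z hz
      obtain ⟨x, hx, rfl⟩ := Finset.mem_image.1 hz
      obtain ⟨hd, rfl⟩ := hW x hx
      rw [mem_Bx] at hd
      refine Finset.mem_product.2 ⟨Finset.mem_product.2 ⟨mem_Bx.2 fun j hj => ?_, ?_⟩,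
        mem_Bx.2 fun j hj => ?_⟩
      · simp only [sp_apply, add_sub_cancel_right] at hj ⊢
        split_ifs with hh
        · exact (hd j (by omega)).symm
        · rfl
      · simp
      · simp only [sp_apply, add_sub_cancel_right] at hj ⊢
        split_ifs with hh
        · rfl
        · exact hd j (by omega)
    refine (Finset.card_le_card h1).trans (le_of_eq ?_)
    rw [Finset.card_product, Finset.card_product, card_Bx, card_Bx, Finset.card_singleton, mul_one,
      ← pow_add]
    congr 1
    omega

/-- On average, pulled-back walks visit a given set at a given time with multiplicity at most the
size of the set times a constant. -/
lemma CQ.walk_count (h : CQ f g K) (P Z : Finset ((ℤ →₀ α) × ℤ)) {i ℓ : ℤ} (hi : 0 ≤ i)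
    (hil : i ≤ ℓ) :
    ∑ p ∈ P, pr (Bx (f p).1 (f p).2 ((f p).2 + ℓ)) (fun d => upw f g p d i ∈ Z) ≤
      walkC α β K * Z.card := by
  set W : Finset (((ℤ →₀ α) × ℤ) × (ℤ →₀ β)) :=
    P.biUnion fun p => ((Bx (f p).1 (f p).2 ((f p).2 + ℓ)).filter
      fun d => upw f g p d i ∈ Z).image fun d => (p, d) with hWdef
  have hcard : W.card = ∑ p ∈ P, ((Bx (f p).1 (f p).2 ((f p).2 + ℓ)).filter
      fun d => upw f g p d i ∈ Z).card := by
    rw [hWdef, Finset.card_biUnion]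
    · exact Finset.sum_congr rfl fun p _ =>
        Finset.card_image_of_injective _ (Prod.mk_right_injective p)
    · intro p _ p' _ hpp
      refine Finset.disjoint_left.2 fun x hx hx' => hpp ?_
      obtain ⟨d, _, rfl⟩ := Finset.mem_image.1 hx
      obtain ⟨d', _, e⟩ := Finset.mem_image.1 hx'
      exact (Prod.ext_iff.1 e).1.symm
  have hmem : ∀ x ∈ W, x.2 ∈ Bx (f x.1).1 (f x.1).2 ((f x.1).2 + ℓ) ∧ upw f g x.1 x.2 i ∈ Z := by
    intro x hx
    obtain ⟨p, _, hp⟩ := Finset.mem_biUnion.1 hx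
    obtain ⟨d, hd, rfl⟩ := Finset.mem_image.1 hp
    exact Finset.mem_filter.1 hd
  have hW : W.card ≤ walkC α β K * Z.card * Fintype.card β ^ ℓ.toNat := by
    have key : ∀ z ∈ Z, (W.filter fun x => upw f g x.1 x.2 i = z).card ≤
        walkC α β K * Fintype.card β ^ ℓ.toNat := fun z _ => ?_
    · have := Finset.card_le_mul_card_image_of_maps_to (fun x hx => (hmem x hx).2) _ key
      rwa [mul_right_comm] at this
    refine (Finset.card_le_mul_card_image
      (f := fun x => (sp ((f x.1).2 + i) x.2 (f x.1).1, (f x.1).2 + i)) _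
      ((Fintype.card α ^ (4 * K).toNat * (4 * K + 1).toNat) * Fintype.card β ^ ℓ.toNat)
      fun y _ => ?_).trans ?_
    · refine h.walk_fibre hi hil y _ fun x hx => ?_
      obtain ⟨h1, h2⟩ := Finset.mem_filter.1 hx
      exact ⟨(hmem x (Finset.mem_filter.1 h1).1).1, h2⟩
    · refine (Nat.mul_le_mul_left _ (h.symm.card_le_of_fibre (y := z) fun y hy => ?_)).trans
        (le_of_eq ?_)
      · obtain ⟨x, hx, rfl⟩ := Finset.mem_image.1 hy
        exact (Finset.mem_filter.1 hx).2
      · unfold walkC; ring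
  have hne : (Fintype.card β : ℝ) ^ ℓ.toNat ≠ 0 := by
    have : 0 < Fintype.card β := Fintype.card_pos
    positivity
  calc _ = ∑ p ∈ P, (((Bx (f p).1 (f p).2 ((f p).2 + ℓ)).filter
          fun d => upw f g p d i ∈ Z).card : ℝ) / (Fintype.card β : ℝ) ^ ℓ.toNat := by
        refine Finset.sum_congr rfl fun p _ => ?_
        rw [pr_eq_card_div, card_Bx, add_sub_cancel_left]; push_cast; congr!
    _ = (W.card : ℝ) / (Fintype.card β : ℝ) ^ ℓ.toNat := by
        rw [hcard, ← Finset.sum_div]; push_cast; rfl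
    _ ≤ _ := by
        rw [div_le_iff₀ (by positivity)]
        exact_mod_cast hW

end WalkCount

section Slope

variable {α β : Type*} [Zero α] [Zero β] [Fintype α]
variable {f : (ℤ →₀ α) × ℤ → (ℤ →₀ β) × ℤ} {g : (ℤ →₀ β) × ℤ → (ℤ →₀ α) × ℤ} {K : ℤ}

lemma exists_near {S : Finset ℤ} {ℓ i : ℤ} {κ : ℝ} (hκ : 0 ≤ κ) (hκ2 : κ ≤ 1 / 2)
    (hS : (S.card : ℝ) < κ * ℓ) (h0 : 0 ≤ i) (hi : i ≤ ℓ) :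
    ∃ j, 0 ≤ j ∧ j ≤ ℓ ∧ j ∉ S ∧ |(j : ℝ) - i| ≤ κ * ℓ := by
  have hℓ : (0 : ℝ) ≤ ℓ := by exact_mod_cast h0.trans hi
  set t : ℤ := ⌊κ * ℓ⌋ with ht
  have ht0 : 0 ≤ t := Int.floor_nonneg.2 (by positivity)
  have ht1 : (t : ℝ) ≤ κ * ℓ := Int.floor_le _
  have ht2 : κ * ℓ < t + 1 := Int.lt_floor_add_one _
  have ht3 : 2 * t ≤ ℓ := by
    have : (2 * t : ℝ) ≤ ℓ := by nlinarith
    exact_mod_cast this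
  have main : ∀ a, 0 ≤ a → a + t ≤ ℓ → a ≤ i → i ≤ a + t →
      ∃ j, 0 ≤ j ∧ j ≤ ℓ ∧ j ∉ S ∧ |(j : ℝ) - i| ≤ κ * ℓ := by
    intro a ha0 ha1 ha2 ha3
    have : S.card < (Finset.Icc a (a + t)).card := by
      rw [Int.card_Icc]
      have h1 : (S.card : ℝ) < (t + 1 : ℤ) := by push_cast; linarith
      have h2 : (S.card : ℤ) < t + 1 := by exact_mod_cast h1
      omega
    obtain ⟨j, hj, hjS⟩ := Finset.exists_mem_notMem_of_card_lt_card this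
    rw [Finset.mem_Icc] at hj
    refine ⟨j, by omega, by omega, hjS, le_trans ?_ ht1⟩
    have : |j - i| ≤ t := abs_le.2 ⟨by omega, by omega⟩
    exact_mod_cast this
  by_cases hc : i + t ≤ ℓ
  · exact main i h0 hc le_rfl (by omega)
  · exact main (i - t) (by omega) (by omega) (by omega) (by omega)

/-- The points of a box close to its top or bottom. -/
def bdry (o : ℤ →₀ α) (k l K : ℤ) : Finset ((ℤ →₀ α) × ℤ) :=
  Bx o k l ×ˢ (Finset.Icc k (k + K) ∪ Finset.Icc (l - K) l)

lemma card_bdry_le (o : ℤ →₀ α) {k l : ℤ} (hK : 0 ≤ K) :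
    (bdry o k l K).card ≤ Fintype.card α ^ (l - k).toNat * (2 * (K + 1)).toNat := by
  rw [bdry, Finset.card_product, card_Bx]
  refine Nat.mul_le_mul_left _ ((Finset.card_union_le _ _).trans ?_)
  rw [Int.card_Icc, Int.card_Icc]
  omega

omit [Fintype α] in
lemma CQ.upw_zero (h : CQ f g K) [Fintype β] {p : (ℤ →₀ α) × ℤ} {d : ℤ →₀ β} {ℓ : ℤ}
    (hd : d ∈ Bx (f p).1 (f p).2 ((f p).2 + ℓ)) : cl K p (upw f g p d 0) := by
  have : sp ((f p).2 + 0) d (f p).1 = (f p).1 := by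
    ext j; simp only [sp_apply]; split_ifs with hj
    · exact mem_Bx.1 hd j (Or.inl (by omega))
    · rfl
  unfold upw
  rw [this, add_zero]
  exact (h.gf p).symm

omit [Fintype α] in
lemma CQ.upw_step (h : CQ f g K) (p : (ℤ →₀ α) × ℤ) (d : ℤ →₀ β) (i : ℤ) :
    cl K (upw f g p d i) (upw f g p d (i + 1)) := by
  have := h.symm.path d (f p).1 ((f p).2 + i)
  rwa [add_assoc] at this

omit [Fintype α] in
lemma CQ.f_upw (h : CQ f g K) (p : (ℤ →₀ α) × ℤ) (d : ℤ →₀ β) (i : ℤ) :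
    |((f (upw f g p d i)).2 : ℝ) - ((f p).2 + i)| ≤ K := by
  have h1 := h.fg (sp ((f p).2 + i) d (f p).1, (f p).2 + i)
  have h2 := h1.snd_le
  have h3 := h1.symm.snd_le
  have : |(f (upw f g p d i)).2 - ((f p).2 + i)| ≤ K :=
    abs_le.2 ⟨by simp only [upw] at *; linarith, by simp only [upw] at *; linarith⟩
  exact_mod_cast this

/-- A pulled-back walk which avoids the boundary of a box stays in the box. -/
lemma CQ.walk_stay (h : CQ f g K) [Fintype β] {o : ℤ →₀ α} {k l ℓ : ℤ} {p : (ℤ →₀ α) × ℤ}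
    (hp : p.1 ∈ Bx o k l) (hp1 : k + 2 * K ≤ p.2) (hp2 : p.2 ≤ l - 2 * K) {d : ℤ →₀ β}
    (hd : d ∈ Bx (f p).1 (f p).2 ((f p).2 + ℓ)) {i : ℤ} (hi : 0 ≤ i)
    (hno : ∀ j, 0 ≤ j → j ≤ i → upw f g p d j ∉ bdry o k l K) :
    (upw f g p d i).1 ∈ Bx o k l ∧ k + K < (upw f g p d i).2 ∧ (upw f g p d i).2 < l - K := by
  have hK := h.one_le
  have aux : ∀ y z : (ℤ →₀ α) × ℤ, y.1 ∈ Bx o k l → k + K ≤ y.2 → y.2 ≤ l - K → cl K y z →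
      z ∉ bdry o k l K → z.1 ∈ Bx o k l ∧ k + K < z.2 ∧ z.2 < l - K := by
    intro y z hy hy1 hy2 hc hz
    have hz1 : z.1 ∈ Bx o k l := by
      rw [mem_Bx] at hy ⊢
      intro j hj
      rw [← hy j hj]
      rcases hj with hj | hj
      · exact (hc.eq_below (by omega)).symm
      · exact (hc.eq_above (by omega)).symm
    refine ⟨hz1, ?_⟩
    have e1 := hc.snd_le
    have e2 := hc.symm.snd_le
    simp only [bdry, Finset.mem_product, Finset.mem_union, Finset.mem_Icc, hz1, true_and] at hz
    omega
  induction i, hi using Int.leInduction with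
  | base => exact aux p _ hp (by omega) (by omega) (h.upw_zero hd) (hno 0 le_rfl le_rfl)
  | succ i hi ih =>
    obtain ⟨h1, h2, h3⟩ := ih fun j h1 h2 => hno j h1 (by omega)
    exact aux _ _ h1 h2.le h3.le (h.upw_step p d i) (hno _ (by omega) le_rfl)

end Slope

section Slope

variable {α β : Type*} [Zero α] [Zero β] [Fintype α] [Fintype β]
variable {f : (ℤ →₀ α) × ℤ → (ℤ →₀ β) × ℤ} {g : (ℤ →₀ β) × ℤ → (ℤ →₀ α) × ℤ} {K : ℤ}

lemma CQ.sum_visits_le (h : CQ f g K) (P Z : Finset ((ℤ →₀ α) × ℤ)) {ℓ : ℤ} (hℓ : 0 ≤ ℓ) :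
    ∑ p ∈ P, ∑ i ∈ Finset.Icc 0 ℓ, pr (Bx (f p).1 (f p).2 ((f p).2 + ℓ))
      (fun d => upw f g p d i ∈ Z) ≤ (ℓ + 1) * (walkC α β K * Z.card) := by
  rw [Finset.sum_comm]
  refine (Finset.sum_le_card_nsmul _ _ _ fun i hi => h.walk_count P Z (Finset.mem_Icc.1 hi).1
    (Finset.mem_Icc.1 hi).2).trans (le_of_eq ?_)
  rw [Int.card_Icc, nsmul_eq_mul]
  congr 1
  have : ((ℓ + 1 - 0).toNat : ℤ) = ℓ + 1 := by omega
  exact_mod_cast this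

lemma CQ.sum_pr_hit (h : CQ f g K) (P Z : Finset ((ℤ →₀ α) × ℤ)) {ℓ : ℤ} (hℓ : 0 ≤ ℓ) :
    ∑ p ∈ P, pr (Bx (f p).1 (f p).2 ((f p).2 + ℓ))
      (fun d => ∃ i ∈ Finset.Icc 0 ℓ, upw f g p d i ∈ Z) ≤ (ℓ + 1) * (walkC α β K * Z.card) :=
  (Finset.sum_le_sum fun _ _ => pr_exists_le _ _ _).trans (h.sum_visits_le P Z hℓ)

lemma CQ.sum_pr_many (h : CQ f g K) (P Z : Finset ((ℤ →₀ α) × ℤ)) {ℓ : ℤ} (hℓ : 0 ≤ ℓ) {t : ℝ}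
    (ht : 0 < t) :
    ∑ p ∈ P, pr (Bx (f p).1 (f p).2 ((f p).2 + ℓ))
      (fun d => t ≤ (((Finset.Icc 0 ℓ).filter fun i => upw f g p d i ∈ Z).card : ℝ)) ≤
      (ℓ + 1) * (walkC α β K * Z.card) / t := by
  refine le_trans ?_ (div_le_div_of_nonneg_right (h.sum_visits_le P Z hℓ) ht.le)
  rw [Finset.sum_div]
  refine Finset.sum_le_sum fun p _ => pr_markov (fun _ _ => Nat.cast_nonneg _) ht (le_of_eq ?_)
  unfold pr
  rw [← Finset.expect_sum_comm]
  refine Finset.expect_congr rfl fun d _ => ?_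
  rw [Finset.card_filter]
  push_cast
  exact Finset.sum_congr rfl fun i _ => by congr!

omit [Fintype β] in
/-- The deterministic core of the slope bound: a pulled-back walk staying in a box where the height
is affine at most times cannot oscillate much. -/
lemma CQ.no_fast_walk (h : CQ f g K) {o : ℤ →₀ α} {k l ℓ : ℤ} {A s E κ X : ℝ}
    {Z : Finset ((ℤ →₀ α) × ℤ)}
    (hZ : ∀ z : (ℤ →₀ α) × ℤ, z.1 ∈ Bx o k l → k ≤ z.2 → z.2 ≤ l → z ∉ Z →
      |((f z).2 : ℝ) - (A + s * (z.2 - k))| ≤ E)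
    (hκ : 0 ≤ κ) (hκ2 : κ ≤ 1 / 2) {p : (ℤ →₀ α) × ℤ} {d : ℤ →₀ β}
    (hstay : ∀ i, 0 ≤ i → i ≤ ℓ → (upw f g p d i).1 ∈ Bx o k l ∧
      k ≤ (upw f g p d i).2 ∧ (upw f g p d i).2 ≤ l)
    (hfew : (((Finset.Icc 0 ℓ).filter fun i => upw f g p d i ∈ Z).card : ℝ) < κ * ℓ)
    {i1 i2 : ℤ} (h1 : 0 ≤ i1) (h1' : i1 ≤ ℓ) (h2 : 0 ≤ i2) (h2' : i2 ≤ ℓ)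
    (hX : X < ((upw f g p d i2).2 : ℝ) - (upw f g p d i1).2) :
    |s| * (X - 2 * K * (κ * ℓ)) ≤ ℓ + 2 * K + 2 * E := by
  have hK : (1 : ℝ) ≤ K := by exact_mod_cast h.one_le
  obtain ⟨j1, a1, a2, a3, a4⟩ := exists_near hκ hκ2 hfew h1 h1'
  obtain ⟨j2, b1, b2, b3, b4⟩ := exists_near hκ hκ2 hfew h2 h2'
  have lip : ∀ i j : ℤ, |((upw f g p d j).2 : ℝ) - (upw f g p d i).2| ≤ K * |(j : ℝ) - i| := by
    intro i j
    rcases le_total i j with hij | hij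
    · have := walk_lip (γ := upw f g p d) (h.upw_step p d) hij
      rw [abs_of_nonneg (sub_nonneg.2 (by exact_mod_cast hij) : (0 : ℝ) ≤ j - i)]
      exact_mod_cast this
    · have := walk_lip (γ := upw f g p d) (h.upw_step p d) hij
      rw [abs_sub_comm, abs_sub_comm (j : ℝ),
        abs_of_nonneg (sub_nonneg.2 (by exact_mod_cast hij) : (0 : ℝ) ≤ i - j)]
      exact_mod_cast this
  have lin : ∀ j : ℤ, 0 ≤ j → j ≤ ℓ → j ∉ (Finset.Icc 0 ℓ).filter (fun i => upw f g p d i ∈ Z) →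
      |(((f p).2 : ℝ) + j) - (A + s * ((upw f g p d j).2 - k))| ≤ K + E := by
    intro j hj0 hj1 hj
    have hj' : upw f g p d j ∉ Z := fun hh =>
      hj (Finset.mem_filter.2 ⟨Finset.mem_Icc.2 ⟨hj0, hj1⟩, hh⟩)
    obtain ⟨c1, c2, c3⟩ := hstay j hj0 hj1
    have e1 := hZ _ c1 c2 c3 hj'
    have e2 := h.f_upw p d j
    rw [abs_le] at *
    constructor <;> linarith
  have e1 := lin j1 a1 a2 a3
  have e2 := lin j2 b1 b2 b3
  have l1 := (lip i1 j1).trans (mul_le_mul_of_nonneg_left a4 (by linarith))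
  have l2 := (lip i2 j2).trans (mul_le_mul_of_nonneg_left b4 (by linarith))
  set x1 : ℝ := ((upw f g p d j1).2 : ℝ)
  set x2 : ℝ := ((upw f g p d j2).2 : ℝ)
  have e3 : X - 2 * K * (κ * ℓ) ≤ |x2 - x1| := by
    refine le_trans ?_ (le_abs_self _)
    have := (abs_le.1 l1).2
    have := (abs_le.1 l2).1
    linarith
  refine (mul_le_mul_of_nonneg_left e3 (abs_nonneg s)).trans ?_
  rw [← abs_mul]
  have hj12 : |(j2 : ℝ) - j1| ≤ ℓ := by
    have : |j2 - j1| ≤ ℓ := abs_le.2 ⟨by omega, by omega⟩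
    exact_mod_cast this
  rw [abs_le] at e1 e2 hj12 ⊢
  constructor <;> linarith

end Slope

section Slope

variable {α β : Type*} [Zero α] [Zero β] [Fintype α] [Fintype β]
variable {f : (ℤ →₀ α) × ℤ → (ℤ →₀ β) × ℤ} {g : (ℤ →₀ β) × ℤ → (ℤ →₀ α) × ℤ} {K : ℤ}

lemma walkC_pos (K : ℤ) (hK : 0 ≤ K) : 1 ≤ walkC α β K := by
  have h1 : 0 < Fintype.card α := Fintype.card_pos
  have h2 : 0 < Fintype.card β := Fintype.card_pos
  have h3 : 0 < (4 * K + 1).toNat := by omega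
  unfold walkC
  exact Nat.one_le_iff_ne_zero.2 (by positivity)

omit [Zero β] [Fintype β] in
lemma card_filter_box_le {o : ℤ →₀ α} {k L : ℤ} (hL : 0 ≤ L) {θ : ℝ}
    {q : (ℤ →₀ α) × ℤ → Prop}
    (hq : ∀ r, k ≤ r → r ≤ k + L → pr (Bx o k (k + L)) (fun w => q (w, r)) ≤ θ) :
    (((Bx o k (k + L) ×ˢ Finset.Icc k (k + L)).filter q).card : ℝ) ≤
      θ * ((Bx o k (k + L)).card * (L + 1)) := by
  have hne : (Finset.Icc k (k + L)).Nonempty := ⟨k, by simp [hL]⟩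
  have h1 : pr (Bx o k (k + L) ×ˢ Finset.Icc k (k + L)) q ≤ θ := by
    rw [pr_prod']
    exact Finset.expect_le hne fun r hr =>
      hq r (Finset.mem_Icc.1 hr).1 (Finset.mem_Icc.1 hr).2
  have h2 : (0 : ℝ) < (Bx o k (k + L)).card := by exact_mod_cast card_Bx_pos _ _ _
  have hL' : (0 : ℝ) ≤ L := by exact_mod_cast hL
  have h3 : (((Bx o k (k + L)) ×ˢ Finset.Icc k (k + L)).card : ℝ) =
      (Bx o k (k + L)).card * (L + 1) := by
    rw [Finset.card_product, Int.card_Icc]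
    have : ((k + L + 1 - k).toNat : ℤ) = L + 1 := by omega
    push_cast
    congr 1
    exact_mod_cast this
  rw [pr_eq_card_div, h3, div_le_iff₀ (by positivity)] at h1
  exact h1

set_option maxHeartbeats 1000000 in
/-- There are no boxes in which the height is almost affine with too large a slope. -/
lemma CQ.no_steep_box (h : CQ f g K) (hα : 2 ≤ Fintype.card α) (hβ : 2 ≤ Fintype.card β) {δ : ℝ}
    (hδ : 0 < δ)
    (H : ∀ ε θ : ℝ, 0 < ε → 0 < θ → ∀ D0 : ℤ, ∃ L : ℤ, 1 ≤ L ∧ D0 ≤ L ∧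
      ∃ (o : ℤ →₀ α) (k : ℤ) (A s : ℝ), lam α β + δ ≤ |s| ∧ ∀ r : ℤ, k ≤ r → r ≤ k + L →
        pr (Bx o k (k + L)) (fun w => ε * L ≤ |((f (w, r)).2 : ℝ) - (A + s * (r - k))|) ≤ θ) :
    False := by
  have hKz := h.one_le
  have hK : (1 : ℝ) ≤ K := by exact_mod_cast hKz
  have hlam := lam_pos hα hβ
  set μ : ℝ := lam α β + δ with hμdef
  have hμ : 0 < μ := by positivity
  set G : ℝ := (lam α β)⁻¹ - μ⁻¹ with hG
  have hG0 : 0 < G := sub_pos.2 (inv_strictAnti₀ hlam (by linarith))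
  set b : ℝ := (walkC α β K : ℝ) with hb
  have hb1 : 1 ≤ b := by rw [hb]; exact_mod_cast walkC_pos K (by omega)
  set η : ℝ := 1 / (128 * K * b) with hη
  have hη0 : 0 < η := by positivity
  have hηe : η * (128 * K * b) = 1 := div_mul_cancel₀ _ (by positivity)
  set κ : ℝ := min (1 / 2) (G / (16 * K)) with hκ
  have hκ0 : 0 < κ := by positivity
  have hκK : κ * (16 * K) ≤ G := by
    have := min_le_right (1 / 2) (G / (16 * K))
    rwa [← hκ, le_div_iff₀ (by positivity)] at this
  set θ : ℝ := κ / (64 * b) with hθ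
  have hθ0 : 0 < θ := by positivity
  have hθe : θ * (64 * b) = κ := div_mul_cancel₀ _ (by positivity)
  set ε : ℝ := G * μ * η / 16 with hε
  have hε0 : 0 < ε := by positivity
  obtain ⟨ℓ0, hℓ0, hosc⟩ := h.symm.osc_lower hβ hα (δ := G / 4) (θ := 1 / 4) (by positivity)
    (by norm_num)
  set T : ℝ := ℓ0 + 2 + 16 * K / (G * μ) with hT
  have hℓ0' : (1 : ℝ) ≤ ℓ0 := by exact_mod_cast hℓ0
  have hT0 : ℓ0 + 2 ≤ T := by have : 0 ≤ 16 * K / (G * μ) := by positivity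
                              linarith
  obtain ⟨L, hL1, hLD, o, k, A, s, hs, hpr⟩ := H ε θ hε0 hθ0 (⌈T / η⌉ + 8 * K)
  have hLK : 8 * K ≤ L := by
    have : 0 ≤ ⌈T / η⌉ := Int.ceil_nonneg (by positivity)
    omega
  have hLKr : (8 * K : ℝ) ≤ L := by exact_mod_cast hLK
  have hLT : T ≤ η * L := by
    have h1 : T / η ≤ ⌈T / η⌉ := Int.le_ceil _
    have h2 : ((⌈T / η⌉ : ℤ) : ℝ) ≤ L := by exact_mod_cast (by omega : ⌈T / η⌉ ≤ L)
    have := (div_le_iff₀ hη0).1 (h1.trans h2)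
    linarith
  have hL0 : (0 : ℝ) < L := by linarith
  set ℓ : ℤ := ⌊η * L⌋ with hℓ
  have hℓ1 : (ℓ : ℝ) ≤ η * L := Int.floor_le _
  have hℓ2 : η * L < ℓ + 1 := Int.lt_floor_add_one _
  have hℓ3 : (ℓ0 : ℝ) ≤ ℓ := by linarith
  have hℓ3' : ℓ0 ≤ ℓ := by exact_mod_cast hℓ3
  have hℓ4 : η * L ≤ 2 * ℓ := by linarith
  have hℓ0z : 0 ≤ ℓ := by omega
  set P : Finset ((ℤ →₀ α) × ℤ) :=
    Bx o k (k + L) ×ˢ Finset.Icc (k + 2 * K) (k + L - 2 * K) with hP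
  set Z : Finset ((ℤ →₀ α) × ℤ) := (Bx o k (k + L) ×ˢ Finset.Icc k (k + L)).filter fun z =>
    ε * L ≤ |((f z).2 : ℝ) - (A + s * (z.2 - k))| with hZ
  set c : ℝ := ((Bx o k (k + L)).card : ℝ) with hc
  have hc0 : 0 < c := by rw [hc]; exact_mod_cast card_Bx_pos _ _ _
  have hPc : c * (L / 2) ≤ P.card := by
    rw [hP, Finset.card_product, Int.card_Icc]
    push_cast
    refine mul_le_mul_of_nonneg_left ?_ hc0.le
    have : ((k + L - 2 * K + 1 - (k + 2 * K)).toNat : ℤ) = L - 4 * K + 1 := by omega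
    have : ((k + L - 2 * K + 1 - (k + 2 * K)).toNat : ℝ) = L - 4 * K + 1 := by exact_mod_cast this
    rw [this]; linarith
  have hZc : (Z.card : ℝ) ≤ θ * (c * (L + 1)) := card_filter_box_le (by omega) hpr
  have hBc : ((bdry o k (k + L) K).card : ℝ) ≤ c * (4 * K) := by
    have := card_bdry_le o (k := k) (l := k + L) (K := K) (by omega)
    rw [← card_Bx o] at this
    have h1 : ((2 * (K + 1)).toNat : ℤ) = 2 * (K + 1) := by omega
    have h2 : ((2 * (K + 1)).toNat : ℝ) = 2 * (K + 1) := by exact_mod_cast h1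
    calc ((bdry o k (k + L) K).card : ℝ) ≤ c * ((2 * (K + 1)).toNat : ℝ) := by
          rw [hc]; exact_mod_cast this
      _ ≤ _ := by rw [h2]; exact mul_le_mul_of_nonneg_left (by linarith) hc0.le
  have hκℓ : 0 < κ * ℓ := by nlinarith
  have s1 := h.sum_pr_hit P (bdry o k (k + L) K) hℓ0z
  have s2 := h.sum_pr_many P Z hℓ0z hκℓ
  have hl2 : (ℓ : ℝ) + 1 ≤ 2 * ℓ := by linarith
  have b1 : ((ℓ : ℝ) + 1) * (b * (bdry o k (k + L) K).card) ≤ 1 / 8 * (c * (L / 2)) := by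
    calc ((ℓ : ℝ) + 1) * (b * (bdry o k (k + L) K).card) ≤ (2 * (η * L)) * (b * (c * (4 * K))) := by
          gcongr; linarith
      _ = (η * (128 * K * b)) * (1 / 8 * (c * (L / 2))) := by ring
      _ = _ := by rw [hηe, one_mul]
  have b2 : ((ℓ : ℝ) + 1) * (b * Z.card) / (κ * ℓ) ≤ 1 / 8 * (c * (L / 2)) := by
    rw [div_le_iff₀ hκℓ]
    calc ((ℓ : ℝ) + 1) * (b * Z.card) ≤ (2 * ℓ) * (b * (θ * (c * (2 * L)))) := by
          gcongr
          refine hZc.trans ?_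
          gcongr
          linarith
      _ = 1 / 8 * (c * (L / 2)) * ((θ * (64 * b)) * ℓ) := by ring
      _ = _ := by rw [hθe]
  have hPpos : (0 : ℝ) < P.card := lt_of_lt_of_le (by positivity) hPc
  have hPne : P.Nonempty := by
    rw [← Finset.card_pos]; exact_mod_cast hPpos
  obtain ⟨p, hp, hpφ⟩ := Finset.exists_le_of_sum_le hPne
    (f := fun p => pr (Bx (f p).1 (f p).2 ((f p).2 + ℓ))
        (fun d => ∃ i ∈ Finset.Icc 0 ℓ, upw f g p d i ∈ bdry o k (k + L) K)
      + pr (Bx (f p).1 (f p).2 ((f p).2 + ℓ))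
        (fun d => κ * ℓ ≤ (((Finset.Icc 0 ℓ).filter fun i => upw f g p d i ∈ Z).card : ℝ)))
    (g := fun _ => 1 / 4) (by
      rw [Finset.sum_add_distrib, Finset.sum_const, nsmul_eq_mul]
      linarith)
  have hall : pr (Bx (f p).1 (f p).2 ((f p).2 + ℓ)) (fun d =>
      ((∃ i ∈ Finset.Icc 0 ℓ, upw f g p d i ∈ bdry o k (k + L) K) ∨
        κ * ℓ ≤ (((Finset.Icc 0 ℓ).filter fun i => upw f g p d i ∈ Z).card : ℝ)) ∨
      (∀ r s, (f p).2 ≤ r → r ≤ (f p).2 + ℓ → (f p).2 ≤ s → s ≤ (f p).2 + ℓ →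
        ((g (sp s d (f p).1, s)).2 : ℝ) - (g (sp r d (f p).1, r)).2 ≤
          (lam β α - G / 4) * ℓ)) < 1 := by
    refine ((pr_or_le _ _ _).trans (add_le_add (pr_or_le _ _ _) (hosc ℓ hℓ3' _ _))).trans_lt ?_
    linarith
  obtain ⟨d, hd, hdn⟩ := exists_not_of_pr_lt (Bx_nonempty _ _ _) hall
  push Not at hdn
  obtain ⟨⟨hd1, hd2⟩, r1, r2, hr1, hr1', hr2, hr2', hX⟩ := hdn
  obtain ⟨hp1, hp2⟩ := Finset.mem_product.1 hp
  rw [Finset.mem_Icc] at hp2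
  have hstay : ∀ i, 0 ≤ i → i ≤ ℓ → (upw f g p d i).1 ∈ Bx o k (k + L) ∧
      k ≤ (upw f g p d i).2 ∧ (upw f g p d i).2 ≤ k + L := by
    intro i hi hi2
    obtain ⟨c1, c2, c3⟩ := h.walk_stay hp1 hp2.1 hp2.2 hd hi fun j hj hj2 =>
      hd1 j (Finset.mem_Icc.2 ⟨hj, hj2.trans hi2⟩)
    exact ⟨c1, by omega, by omega⟩
  have fin := h.no_fast_walk (A := A) (s := s) (E := ε * L) (κ := κ) (Z := Z)
    (X := (lam β α - G / 4) * ℓ) (i1 := r1 - (f p).2) (i2 := r2 - (f p).2) (fun z hz1 hz2 hz3 hz => by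
      by_contra hcon
      exact hz (Finset.mem_filter.2 ⟨Finset.mem_product.2 ⟨hz1, Finset.mem_Icc.2 ⟨hz2, hz3⟩⟩,
        (not_le.1 hcon).le⟩)) hκ0.le (min_le_left _ _) hstay hd2 (by omega) (by omega) (by omega)
      (by omega) (by simpa only [upw, add_sub_cancel] using hX)
  rw [lam_inv (α := α)] at fin
  have f1 : 2 * K * (κ * ℓ) ≤ G / 8 * ℓ := by nlinarith
  have f2 : (μ⁻¹ + 5 / 8 * G) * ℓ ≤ ((lam α β)⁻¹ - G / 4) * ℓ - 2 * K * (κ * ℓ) := by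
    rw [show (lam α β)⁻¹ = μ⁻¹ + G by rw [hG]; ring]; linarith
  have f3 : 0 ≤ (μ⁻¹ + 5 / 8 * G) * ℓ := by
    have : (0 : ℝ) ≤ ℓ := by linarith
    positivity
  have f4 : μ * ((μ⁻¹ + 5 / 8 * G) * ℓ) ≤ ℓ + 2 * K + 2 * (ε * L) :=
    (mul_le_mul hs f2 f3 (abs_nonneg _)).trans fin
  have f5 : μ * ((μ⁻¹ + 5 / 8 * G) * ℓ) = ℓ + 5 / 8 * (G * μ * ℓ) := by
    field_simp
  have f6 : 2 * (ε * L) ≤ G * μ * ℓ / 4 := by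
    have := mul_le_mul_of_nonneg_left hℓ4 (by positivity : 0 ≤ G * μ)
    rw [hε]; linarith
  have f7 : 16 * K / (G * μ) ≤ ℓ := by linarith
  rw [div_le_iff₀ (by positivity)] at f7
  linarith

/-- **Upper bound on the mean square speed.** -/
lemma CQ.exists_msq (h : CQ f g K) (hα : 2 ≤ Fintype.card α) (hβ : 2 ≤ Fintype.card β) {ε : ℝ}
    (hε : 0 < ε) : ∃ D : ℤ, 1 ≤ D ∧ msq f D (lam α β ^ 2 + ε) := by
  by_contra hcon
  push Not at hcon
  have hlam := lam_pos hα hβ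
  set S : Set ℝ := {v | ∃ D : ℤ, 1 ≤ D ∧ msq f D v} with hS
  have hbd : ∀ v ∈ S, lam α β ^ 2 + ε ≤ v := by
    rintro v ⟨D, hD, hv⟩
    by_contra hlt
    refine hcon D hD fun o k => (hv o k).trans ?_
    exact mul_le_mul_of_nonneg_right (not_le.1 hlt).le (sq_nonneg _)
  have hne : S.Nonempty := ⟨_, 1, le_rfl, h.msq_bound le_rfl⟩
  have hbb : BddBelow S := ⟨_, hbd⟩
  set v := sInf S with hv
  have hv1 : lam α β ^ 2 + ε ≤ v := le_csInf hne hbd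
  set δ : ℝ := min 1 (ε / (4 * lam α β + 2)) with hδ
  have hδ0 : 0 < δ := by positivity
  have hδ1 : δ ≤ 1 := min_le_left _ _
  have hδ2 : δ * (4 * lam α β + 2) ≤ ε := by
    have := min_le_right 1 (ε / (4 * lam α β + 2))
    rwa [← hδ, le_div_iff₀ (by positivity)] at this
  refine h.no_steep_box hα hβ hδ0 fun ε' θ hε' hθ D0 => ?_
  obtain ⟨L, hL, hLD, o, k, A, s, hs, -, hpr⟩ := h.affine_box_pr (v := v)
      (by nlinarith [sq_nonneg (lam α β)])
    (fun e he => by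
      obtain ⟨w, ⟨D, hD, hw⟩, hwv⟩ := exists_lt_of_csInf_lt hne (by linarith : sInf S < v + e)
      exact ⟨D, hD, fun o k => (hw o k).trans
        (mul_le_mul_of_nonneg_right hwv.le (sq_nonneg _))⟩)
    (fun D hD e he hm => by
      have := csInf_le hbb (⟨D, hD, hm⟩ : v - e ∈ S)
      linarith) (lt_min hε' (half_pos hε)) hθ D0
  refine ⟨L, hL, hLD, o, k, A, s, ?_, fun r h1 h2 => (pr_mono fun w _ hw => ?_).trans (hpr r h1 h2)⟩
  · refine abs_le_of_sq_le_sq' ?_ (abs_nonneg _) |>.2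
    rw [sq_abs]
    have := min_le_right ε' (ε / 2)
    nlinarith
  · have hL' : (0 : ℝ) ≤ L := by exact_mod_cast (by omega : 0 ≤ L)
    exact (mul_le_mul_of_nonneg_right (min_le_left _ _) hL').trans hw

end Slope

section Speed

lemma sq_sub_le_sum (u : ℕ → ℝ) {i j : ℕ} (hij : i ≤ j) :
    (u j - u i) ^ 2 ≤ (j - i : ℝ) * ∑ r ∈ Finset.Ico i j, (u (r + 1) - u r) ^ 2 := by
  have h1 : u j - u i = ∑ r ∈ Finset.Ico i j, (u (r + 1) - u r) :=
    (Finset.sum_Ico_sub u hij).symm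
  have h2 := sq_sum_le_card_mul_sum_sq (s := Finset.Ico i j) (f := fun r => u (r + 1) - u r)
  rw [← h1, Nat.card_Ico, Nat.cast_sub hij] at h2
  exact h2

/-- If a discrete path has nearly minimal quadratic variation, but nearly maximal oscillation, then
its total displacement is nearly maximal. -/
lemma speed_of_energy {u : ℕ → ℝ} {N : ℕ} {l L κ e d : ℝ} (hN : 0 < N) (hl : 0 < l) (hL : 0 < L)
    (hκ : 0 ≤ κ) (he : 0 ≤ e) (hd : 0 ≤ d) (hdl : d ≤ l)
    (hlip : ∀ i j, i ≤ j → N * |u j - u i| ≤ κ * (j - i) * L)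
    (hQ : N * ∑ r ∈ Finset.range N, (u (r + 1) - u r) ^ 2 ≤ (l ^ 2 + e) * L ^ 2)
    {i j : ℕ} (hij : i ≤ j) (hj : j ≤ N) (hosc : (l - d) * L ≤ |u j - u i|) :
    |u N - u 0| ≤ (l + e / l) * L ∧ (l - d - κ * ((e + 2 * l * d) / l ^ 2)) * L ≤ |u N - u 0| := by
  have hN' : (0 : ℝ) < N := by exact_mod_cast hN
  have hij' : (i : ℝ) ≤ j := by exact_mod_cast hij
  have hj' : (j : ℝ) ≤ N := by exact_mod_cast hj
  constructor
  · refine abs_le_of_sq_le_sq ?_ (by positivity)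
    have := sq_sub_le_sum u (Nat.zero_le N)
    rw [Nat.Ico_zero_eq_range, Nat.cast_zero, sub_zero] at this
    refine (this.trans hQ).trans ?_
    rw [mul_pow]
    refine mul_le_mul_of_nonneg_right ?_ (by positivity)
    have : (l + e / l) ^ 2 = l ^ 2 + 2 * e + (e / l) ^ 2 := by field_simp; ring
    rw [this]; nlinarith [sq_nonneg (e / l)]
  · set x : ℝ := (j - i) / N with hx
    have hxN : x * N = j - i := div_mul_cancel₀ _ hN'.ne'
    have hx0 : 0 ≤ x := by rw [hx]; exact div_nonneg (by linarith) hN'.le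
    have hx1 : x ≤ 1 := by rw [hx, div_le_one hN']; have : (0 : ℝ) ≤ i := Nat.cast_nonneg _
                           linarith
    have e1 : (u j - u i) ^ 2 ≤ x * ((l ^ 2 + e) * L ^ 2) := by
      refine (sq_sub_le_sum u hij).trans ?_
      rw [← hxN, mul_assoc]
      refine mul_le_mul_of_nonneg_left (le_trans ?_ hQ) hx0
      refine mul_le_mul_of_nonneg_left ?_ hN'.le
      refine Finset.sum_le_sum_of_subset_of_nonneg (fun r hr => ?_) fun _ _ _ => sq_nonneg _
      rw [Finset.mem_Ico] at hr; rw [Finset.mem_range]; omega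
    have e2 : ((l - d) * L) ^ 2 ≤ (u j - u i) ^ 2 := by
      rw [← sq_abs (u j - u i)]
      exact pow_le_pow_left₀ (mul_nonneg (by linarith) hL.le) hosc 2
    have e3 : (l - d) ^ 2 ≤ x * (l ^ 2 + e) := by
      have : (l - d) ^ 2 * L ^ 2 ≤ x * (l ^ 2 + e) * L ^ 2 := by nlinarith
      exact le_of_mul_le_mul_right this (by positivity)
    have e4 : (1 - x) ≤ (e + 2 * l * d) / l ^ 2 := by
      rw [le_div_iff₀ (by positivity)]; nlinarith
    have a1 : |u i - u 0| ≤ κ * (i / N) * L := by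
      have := hlip 0 i (Nat.zero_le _)
      rw [Nat.cast_zero, sub_zero] at this
      rw [show κ * (i / N) * L = (κ * i * L) / N by ring, le_div_iff₀ hN']; linarith
    have a2 : |u N - u j| ≤ κ * ((N - j) / N) * L := by
      have := hlip j N hj
      rw [show κ * ((N - j) / N) * L = (κ * (N - j) * L) / N by ring, le_div_iff₀ hN']; linarith
    have a3 : (i : ℝ) / N + (N - j) / N = 1 - x := by rw [hx]; field_simp; ring
    have a4 : |u j - u i| ≤ |u N - u 0| + |u i - u 0| + |u N - u j| := by
      rw [show u j - u i = (u N - u 0) - (u i - u 0) - (u N - u j) by ring]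
      exact (abs_sub _ _).trans (add_le_add_left (abs_sub _ _) _)
    have a5 : κ * (1 - x) * L ≤ κ * ((e + 2 * l * d) / l ^ 2) * L := by gcongr
    rw [← a3] at a5
    nlinarith

variable {α β : Type*} [Zero α] [Zero β] [Fintype α] [Fintype β]
variable {f : (ℤ →₀ α) × ℤ → (ℤ →₀ β) × ℤ} {g : (ℤ →₀ β) × ℤ → (ℤ →₀ α) × ℤ} {K : ℤ}

/-- The normalised quadratic variation of the height along a vertical path. -/
def energy (f : (ℤ →₀ α) × ℤ → (ℤ →₀ β) × ℤ) (k D : ℤ) (N : ℕ) (x : (ℤ →₀ α) × (ℤ →₀ α)) : ℝ :=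
  N * ∑ r ∈ Finset.range N, (pth f x (k + ((r + 1 : ℕ) : ℤ) * D) - pth f x (k + (r : ℤ) * D)) ^ 2

omit [Fintype β] in
lemma expect_energy_le {D : ℤ} {v : ℝ} (hm : msq f D v) (hD : 0 ≤ D) (N : ℕ) (o : ℤ →₀ α) (k : ℤ) :
    𝔼 x ∈ Bx2 o k (k + N * D), energy f k D N x ≤ v * (N * D) ^ 2 := by
  unfold energy
  rw [← Finset.mul_expect, Finset.expect_sum_comm]
  calc _ ≤ N * ∑ r ∈ Finset.range N, v * (D : ℝ) ^ 2 := by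
        refine mul_le_mul_of_nonneg_left (Finset.sum_le_sum fun r hr => ?_) (Nat.cast_nonneg _)
        have hr' : (r : ℤ) + 1 ≤ N := by exact_mod_cast Finset.mem_range.1 hr
        have := hm.sub hD o (k := k) (r := k + r * D) (l := k + N * D) (by nlinarith) (by nlinarith)
        rw [show k + r * D + D = k + ((r + 1 : ℕ) : ℤ) * D by push_cast; ring] at this
        exact this
    _ = _ := by rw [Finset.sum_const, Finset.card_range, nsmul_eq_mul]; ring

omit [Fintype β] in
lemma pr_energy_le {D : ℤ} {v a t θ : ℝ} (hm : msq f D v) (hD : 1 ≤ D) {N : ℕ} (hN : 0 < N)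
    (ht : 0 < t) (ha : 0 ≤ a) (o : ℤ →₀ α) (k : ℤ)
    (hlow : pr (Bx2 o k (k + N * D)) (fun x => energy f k D N x < a * (N * D) ^ 2) ≤ θ) :
    pr (Bx2 o k (k + N * D)) (fun x => (a + t) * (N * D) ^ 2 ≤ energy f k D N x) ≤
      (v - a + θ * a) / t := by
  have hN' : (0 : ℝ) < N := by exact_mod_cast hN
  have hD' : (0 : ℝ) < D := by exact_mod_cast hD
  have hL : (0 : ℝ) < (N * D) ^ 2 := by positivity
  set Q := energy f k D N
  have h1 : 𝔼 x ∈ Bx2 o k (k + N * D), max 0 (Q x - a * (N * D) ^ 2) ≤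
      (v - a + θ * a) * (N * D) ^ 2 := by
    have h2 : ∀ x ∈ Bx2 o k (k + N * D), max 0 (Q x - a * (N * D) ^ 2) ≤
        Q x - a * (N * D) ^ 2 + (a * (N * D) ^ 2) * (if Q x < a * (N * D) ^ 2 then 1 else 0) := by
      intro x _
      have hQ0 : 0 ≤ Q x :=
          mul_nonneg (Nat.cast_nonneg _) (Finset.sum_nonneg fun _ _ => sq_nonneg _)
      split_ifs with hx
      · exact max_le (by linarith) (by nlinarith)
      · exact max_le (by linarith) (by linarith)
    refine (Finset.expect_le_expect h2).trans ?_
    have h5 : 𝔼 x ∈ Bx2 o k (k + N * D), (a * (N * D) ^ 2) *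
        (if Q x < a * (N * D) ^ 2 then (1 : ℝ) else 0) =
        (a * (N * D) ^ 2) * pr (Bx2 o k (k + N * D)) (fun x => Q x < a * (N * D) ^ 2) :=
      (Finset.mul_expect _ _ _).symm
    rw [Finset.expect_add_distrib, Finset.expect_sub_distrib, h5,
      Finset.expect_const (Bx2_nonempty _ _ _)]
    have h3 := expect_energy_le hm (by omega) N o k
    have h4 : (a * (N * D) ^ 2) * pr (Bx2 o k (k + N * D)) (fun x => Q x < a * (N * D) ^ 2) ≤
      (a * (N * D) ^ 2) * θ := mul_le_mul_of_nonneg_left hlow (by positivity)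
    linarith
  have h5 := pr_markov (fun x _ => le_max_left 0 (Q x - a * (N * D) ^ 2))
    (mul_pos ht hL) h1
  rw [mul_div_mul_right _ _ hL.ne'] at h5
  refine (pr_mono fun x _ hx => ?_).trans h5
  exact le_max_of_le_right (by linarith)

end Speed

section Speed

variable {α β : Type*} [Zero α] [Zero β] [Fintype α] [Fintype β]
variable {f : (ℤ →₀ α) × ℤ → (ℤ →₀ β) × ℤ} {g : (ℤ →₀ β) × ℤ → (ℤ →₀ α) × ℤ} {K : ℤ}

lemma CQ.osc_lower_pair (h : CQ f g K) (hα : 2 ≤ Fintype.card α) (hβ : 2 ≤ Fintype.card β)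
    {δ θ : ℝ} (hδ : 0 < δ) (hθ : 0 < θ) : ∃ L0 : ℤ, 1 ≤ L0 ∧ ∀ L : ℤ, L0 ≤ L →
    ∀ (o : ℤ →₀ α) (k : ℤ), pr (Bx2 o k (k + L)) (fun x => ∀ r s, k ≤ r → r ≤ k + L → k ≤ s →
      s ≤ k + L → pth f x s - pth f x r ≤ (lam α β - δ) * L) ≤ θ := by
  obtain ⟨L0, h0, h1⟩ := h.osc_lower hα hβ hδ hθ
  refine ⟨L0, h0, fun L hL o k => ?_⟩
  unfold Bx2
  rw [pr_prod]
  refine expect_le_of_forall hθ.le fun q hq => ?_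
  rw [← Bx_eq_of_mem hq]
  exact h1 L hL q k

omit [Fintype α] [Fintype β] in
lemma CQ.exists_grid (h : CQ f g K) (x : (ℤ →₀ α) × (ℤ →₀ α)) {k D : ℤ} {N : ℕ} (hD : 1 ≤ D)
    {r : ℤ} (hr : k ≤ r) (hr' : r ≤ k + N * D) : ∃ i : ℕ, i ≤ N ∧
      |pth f x r - pth f x (k + (i : ℤ) * D)| ≤ K * D := by
  have e := Int.mul_ediv_add_emod (r - k) D
  have e1 := Int.emod_nonneg (r - k) (show D ≠ 0 by omega)
  have e2 := Int.emod_lt_of_pos (r - k) (show 0 < D by omega)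
  have e3 : 0 ≤ (r - k) / D := Int.ediv_nonneg (by omega) (by omega)
  have e4 : (r - k) / D ≤ N := by
    have : (r - k) / D < N + 1 := Int.ediv_lt_of_lt_mul (by omega) (by nlinarith)
    omega
  obtain ⟨i, hi⟩ := Int.eq_ofNat_of_zero_le e3
  rw [hi] at e e4
  refine ⟨i, by exact_mod_cast e4, ?_⟩
  have e5 : k + (i : ℤ) * D ≤ r := by linarith
  refine (h.pth_lip x e5).trans ?_
  have : ((r : ℝ) - ((k + (i : ℤ) * D : ℤ) : ℝ)) ≤ D := by
    have : r - (k + (i : ℤ) * D) ≤ D := by linarith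
    exact_mod_cast this
  exact mul_le_mul_of_nonneg_left this (by exact_mod_cast (by linarith [h.one_le] : 0 ≤ K))

omit [Fintype α] [Fintype β] in
lemma CQ.grid_osc (h : CQ f g K) {x : (ℤ →₀ α) × (ℤ →₀ α)} {k D : ℤ} {N : ℕ} {δ l : ℝ}
    (hD : 1 ≤ D) (hN : 2 * K ≤ δ * N) {r s : ℤ} (hr : k ≤ r) (hr' : r ≤ k + N * D) (hs : k ≤ s)
    (hs' : s ≤ k + N * D) (hrs : (l - δ) * (N * D) ≤ pth f x s - pth f x r) :
    ∃ i j : ℕ, i ≤ j ∧ j ≤ N ∧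
      (l - 2 * δ) * (N * D) ≤ |pth f x (k + (j : ℤ) * D) - pth f x (k + (i : ℤ) * D)| := by
  have hD' : (1 : ℝ) ≤ D := by exact_mod_cast hD
  obtain ⟨i, hi, hi'⟩ := h.exists_grid x hD hr hr'
  obtain ⟨j, hj, hj'⟩ := h.exists_grid x hD hs hs'
  rw [abs_le] at hi' hj'
  have h2 : (2 * K : ℝ) * D ≤ δ * N * D := mul_le_mul_of_nonneg_right hN (by linarith)
  have h3 : (l - 2 * δ) * (N * D) ≤ pth f x (k + (j : ℤ) * D) - pth f x (k + (i : ℤ) * D) := by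
    linarith [hi'.1, hj'.2]
  rcases le_total i j with hij | hij
  · exact ⟨i, j, hij, hj, h3.trans (le_abs_self _)⟩
  · refine ⟨j, i, hij, hi, ?_⟩
    rw [abs_sub_comm]; exact h3.trans (le_abs_self _)

set_option maxHeartbeats 800000 in
/-- The absolute displacement of most vertical paths is about `lam * length`. -/
lemma CQ.speed (h : CQ f g K) (hα : 2 ≤ Fintype.card α) (hβ : 2 ≤ Fintype.card β) {ε θ : ℝ}
    (hε : 0 < ε) (hθ : 0 < θ) : ∃ D : ℤ, 1 ≤ D ∧ ∀ t : ℤ, 1 ≤ t → ∀ o k,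
    pr (Bx2 o k (k + t * D)) (fun x => ε * (t * D) <
      |(|pth f x (k + t * D) - pth f x k| - lam α β * (t * D))|) ≤ θ := by
  have hl := lam_pos hα hβ
  set l := lam α β
  have hK : (1 : ℝ) ≤ K := by exact_mod_cast h.one_le
  set e : ℝ := min (ε * l) (ε * l ^ 2 / (4 * K)) with he
  have he0 : 0 < e := by rw [he]; positivity
  have he1 : e ≤ ε * l := min_le_left _ _
  have he2 : e ≤ ε * l ^ 2 / (4 * K) := min_le_right _ _
  set d : ℝ := min (min l (ε / 2)) (min (ε * l / (8 * K)) (e * θ / (16 * l))) with hd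
  have hd0 : 0 < d := by rw [hd]; positivity
  have hd1 : d ≤ l := (min_le_left _ _).trans (min_le_left _ _)
  have hd2 : d ≤ ε / 2 := (min_le_left _ _).trans (min_le_right _ _)
  have hd3 : d ≤ ε * l / (8 * K) := (min_le_right _ _).trans (min_le_left _ _)
  have hd4 : d ≤ e * θ / (16 * l) := (min_le_right _ _).trans (min_le_right _ _)
  rw [le_div_iff₀ (by positivity)] at he2 hd3 hd4
  set θ' : ℝ := min (θ / 4) (e * θ / (8 * l ^ 2)) with hθ'
  have ht0 : 0 < θ' := by rw [hθ']; positivity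
  have ht1 : θ' ≤ θ / 4 := min_le_left _ _
  have ht2 : θ' ≤ e * θ / (8 * l ^ 2) := min_le_right _ _
  rw [le_div_iff₀ (by positivity)] at ht2
  obtain ⟨L0, hL0, hosc⟩ := h.osc_lower_pair hα hβ (show 0 < d / 2 by positivity) ht0
  obtain ⟨D0, hD0, hm⟩ := h.exists_msq hα hβ (show 0 < e * θ / 8 by positivity)
  obtain ⟨N, hN⟩ := exists_nat_ge (4 * K / d + 1)
  have hN1 : 1 ≤ N := by
    have : (1 : ℝ) ≤ N := le_trans (by have : 0 ≤ 4 * K / d := by positivity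
                                       linarith) hN
    exact_mod_cast this
  have hN2 : 2 * K ≤ d / 2 * N := by
    have : 4 * K / d ≤ N := by linarith
    rw [div_le_iff₀ hd0] at this; linarith
  refine ⟨N * (L0 * D0), by nlinarith [mul_le_mul hL0 hD0 zero_le_one (by omega)], ?_⟩
  intro t ht o k
  set D : ℤ := (t * L0) * D0 with hD
  have htL : 1 ≤ t * L0 := by nlinarith
  have hD1 : 1 ≤ D := by rw [hD]; nlinarith
  have hmD : msq f D (l ^ 2 + e * θ / 8) := hm.mul (by omega) htL
  have hNL : L0 ≤ N * D := by
    have : (1 : ℤ) ≤ N := by exact_mod_cast hN1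
    have h1 : L0 ≤ D := by rw [hD]; nlinarith [mul_le_mul ht hD0 zero_le_one (by omega)]
    nlinarith
  rw [show t * (N * (L0 * D0)) = N * D by rw [hD]; ring]
  have hcast : ((t : ℝ) * ((N * (L0 * D0) : ℤ) : ℝ)) = N * D := by rw [hD]; push_cast; ring
  rw [hcast]
  have hosc' := hosc (N * D) hNL o k
  have hND : (0 : ℝ) < N * D := by
    have : (1 : ℝ) ≤ D := by exact_mod_cast hD1
    have : (1 : ℝ) ≤ N := by exact_mod_cast hN1
    positivity
  have hN' : (0 : ℝ) < N := by exact_mod_cast hN1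
  set slow : (ℤ →₀ α) × (ℤ →₀ α) → Prop := fun x => ∀ r s, k ≤ r → r ≤ k + N * D → k ≤ s →
      s ≤ k + N * D → pth f x s - pth f x r ≤ (l - d / 2) * ((N * D : ℤ) : ℝ) with hslow
  have hfast : ∀ x, ¬ slow x → ∃ i j : ℕ, i ≤ j ∧ j ≤ N ∧
      (l - d) * (N * D) ≤ |pth f x (k + (j : ℤ) * D) - pth f x (k + (i : ℤ) * D)| := by
    intro x hx
    simp only [hslow] at hx
    push Not at hx
    obtain ⟨r, s, h1, h2, h3, h4, h5⟩ := hx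
    have := h.grid_osc hD1 hN2 h1 h2 h3 h4 (by push_cast at h5; exact h5.le)
    rwa [show 2 * (d / 2) = d by ring] at this
  have hlow : pr (Bx2 o k (k + N * D)) (fun x => energy f k D N x < (l - d) ^ 2 * (N * D) ^ 2) ≤
      θ' := by
    refine (pr_mono fun x _ hx => ?_).trans hosc'
    by_contra hcon
    obtain ⟨i, j, hij, hj, hij'⟩ := hfast x hcon
    have h1 := sq_sub_le_sum (fun r => pth f x (k + (r : ℤ) * D)) hij
    have h2 : ((l - d) * (N * D)) ^ 2 ≤
        |pth f x (k + (j : ℤ) * D) - pth f x (k + (i : ℤ) * D)| ^ 2 :=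
      pow_le_pow_left₀ (mul_nonneg (by linarith) hND.le) hij' 2
    rw [sq_abs, mul_pow] at h2
    refine absurd (h2.trans (h1.trans ?_)) (not_le.2 hx)
    refine mul_le_mul ?_ ?_ (Finset.sum_nonneg fun _ _ => sq_nonneg _) hN'.le
    · have : (j : ℝ) ≤ N := by exact_mod_cast hj
      have : (0 : ℝ) ≤ i := Nat.cast_nonneg _
      linarith
    · refine Finset.sum_le_sum_of_subset_of_nonneg (fun r hr => ?_) fun _ _ _ => sq_nonneg _
      rw [Finset.mem_Ico] at hr; rw [Finset.mem_range]; omega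
  have hen := pr_energy_le hmD hD1 (by omega : 0 < N)
    (show 0 < l ^ 2 + e - (l - d) ^ 2 by nlinarith) (sq_nonneg (l - d)) o k hlow
  have hen' : (l ^ 2 + e * θ / 8 - (l - d) ^ 2 + θ' * (l - d) ^ 2) / (l ^ 2 + e - (l - d) ^ 2) ≤
      θ / 2 := by
    have h1 : (l - d) ^ 2 ≤ l ^ 2 := by nlinarith
    rw [div_le_iff₀ (by nlinarith)]
    have h2 : θ' * (l - d) ^ 2 ≤ θ' * l ^ 2 := mul_le_mul_of_nonneg_left h1 ht0.le
    nlinarith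
  refine (pr_mono fun x _ hx => ?_).trans ((pr_or_le _ _ _).trans
    ((add_le_add hosc' (hen.trans hen')).trans (by linarith)))
  by_contra hcon
  push Not at hcon
  obtain ⟨hc1, hc2⟩ := hcon
  obtain ⟨i, j, hij, hj, hij'⟩ := hfast x hc1
  rw [add_sub_cancel] at hc2
  have := speed_of_energy (u := fun r : ℕ => pth f x (k + (r : ℤ) * D)) (κ := K) (by omega) hl hND
    (by linarith) he0.le hd0.le hd1 (fun i j hij => by
      have h1 := h.pth_lip x (r := k + (i : ℤ) * D) (s := k + (j : ℤ) * D) (by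
        have : (i : ℤ) ≤ j := by exact_mod_cast hij
        nlinarith)
      push_cast at h1
      calc (N : ℝ) * _ ≤ N * (K * (k + j * D - (k + i * D))) :=
            mul_le_mul_of_nonneg_left h1 hN'.le
        _ = _ := by ring) hc2.le hij hj hij'
  simp only [Nat.cast_zero, zero_mul, add_zero] at this
  obtain ⟨t1, t2⟩ := this
  refine absurd hx (not_lt.2 ?_)
  rw [abs_le]
  have q1 : e / l ≤ ε := by rw [div_le_iff₀ hl]; exact he1
  have q2 : d + K * ((e + 2 * l * d) / l ^ 2) ≤ ε := by
    have : K * ((e + 2 * l * d) / l ^ 2) ≤ ε / 2 := by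
      rw [← mul_div_assoc, div_le_iff₀ (by positivity)]
      linarith [mul_le_mul_of_nonneg_right hd3 hl.le]
    linarith
  have q3 := mul_le_mul_of_nonneg_right q1 hND.le
  have q4 := mul_le_mul_of_nonneg_right q2 hND.le
  constructor
  · linarith
  · linarith

end Speed

section Sign

/-- A sequence with almost constant absolute speed at all scales is almost linear. -/
lemma linear_of_abs {v : ℕ → ℝ} {N : ℕ} {l e : ℝ} (he : 2 * e < l)
    (hv : ∀ i j : ℕ, i < j → j ≤ N → |(|v j - v i| - l * (j - i))| ≤ e * (j - i))
    (h0 : 0 ≤ v 1 - v 0) :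
    ∀ i j : ℕ, i < j → j ≤ N → |v j - v i - l * (j - i)| ≤ e * (j - i) := by
  have hstep : ∀ i : ℕ, i + 1 ≤ N → 0 ≤ v (i + 1) - v i := by
    intro i
    induction i with
    | zero => intro _; simpa using h0
    | succ i ih =>
      intro hi
      have h1 := ih (by omega)
      by_contra hneg
      push Not at hneg
      have a1 := hv i (i + 1) (by omega) (by omega)
      have a2 := hv (i + 1) (i + 1 + 1) (by omega) (by omega)
      have a3 := hv i (i + 1 + 1) (by omega) (by omega)
      rw [abs_of_nonneg h1] at a1
      rw [abs_of_neg hneg] at a2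
      push_cast at a1 a2 a3
      rw [abs_le] at a1 a2 a3
      have a4 : |v (i + 1 + 1) - v i| ≤ 2 * e := by
        rw [abs_le]; constructor <;> linarith [a1.1, a1.2, a2.1, a2.2]
      linarith [a3.1]
  have hmono : ∀ i j : ℕ, i ≤ j → j ≤ N → v i ≤ v j := by
    intro i j hij
    induction j, hij using Nat.le_induction with
    | base => intro _; exact le_rfl
    | succ j hij ih => intro hj; linarith [ih (by omega), hstep j hj]
  intro i j hij hj
  have := hv i j hij hj
  rwa [abs_of_nonneg (sub_nonneg.2 (hmono i j hij.le hj))] at this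

variable {α β : Type*} [Zero α] [Zero β]
variable {f : (ℤ →₀ α) × ℤ → (ℤ →₀ β) × ℤ} {g : (ℤ →₀ β) × ℤ → (ℤ →₀ α) × ℤ} {K : ℤ}

/-- The height along the path `x` has speed about `s * l` between any two grid points. -/
def runs (f : (ℤ →₀ α) × ℤ → (ℤ →₀ β) × ℤ) (k D : ℤ) (N : ℕ) (ε l s : ℝ)
    (x : (ℤ →₀ α) × (ℤ →₀ α)) : Prop :=
  ∀ i j : ℕ, i ≤ j → j ≤ N →
    |s * (pth f x (k + (j : ℤ) * D) - pth f x (k + (i : ℤ) * D)) - l * ((j - i) * D)| ≤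
      ε * ((j - i) * D)

lemma runs_or {k D : ℤ} {N : ℕ} {ε l : ℝ} (hD : 1 ≤ D) (hε : 2 * ε < l)
    {x : (ℤ →₀ α) × (ℤ →₀ α)}
    (hx : ∀ i j : ℕ, i < j → j ≤ N →
      |(|pth f x (k + (j : ℤ) * D) - pth f x (k + (i : ℤ) * D)| - l * ((j - i) * D))| ≤
      ε * ((j - i) * D)) :
    runs f k D N ε l 1 x ∨ runs f k D N ε l (-1) x := by
  have hD' : (1 : ℝ) ≤ D := by exact_mod_cast hD
  have key : ∀ s : ℝ, |s| = 1 → 0 ≤ s * pth f x (k + ((1 : ℕ) : ℤ) * D) -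
      s * pth f x (k + ((0 : ℕ) : ℤ) * D) → runs f k D N ε l s x := by
    intro s hs h0 i j hij hj
    have := linear_of_abs (v := fun i : ℕ => s * pth f x (k + (i : ℤ) * D)) (N := N)
      (l := l * D) (e := ε * D) (by nlinarith) (fun i j hij hj => by
        rw [← mul_sub, abs_mul, hs, one_mul, mul_assoc, mul_assoc, mul_comm (D : ℝ)]
        exact hx i j hij hj) h0
    rcases hij.lt_or_eq with h1 | rfl
    · have h2 := this i j h1 hj
      rwa [← mul_sub, mul_assoc, mul_assoc, mul_comm (D : ℝ)] at h2
    · simp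
  rcases le_total (pth f x (k + ((0 : ℕ) : ℤ) * D)) (pth f x (k + ((1 : ℕ) : ℤ) * D)) with h1 | h1
  · left; apply key 1 (by simp); linarith
  · right; apply key (-1) (by simp); linarith

lemma runs.bounds (h : CQ f g K) {k D : ℤ} {N : ℕ} {ε l s : ℝ} (hD : 1 ≤ D) (hε : ε ≤ l)
    (hs : |s| = 1) {x : (ℤ →₀ α) × (ℤ →₀ α)} (hx : runs f k D N ε l s x) {r : ℤ} (hr : k ≤ r)
    (hr' : r ≤ k + N * D) :
    s * pth f x k - K * D ≤ s * pth f x r ∧ s * pth f x r ≤ s * pth f x (k + N * D) + K * D := by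
  obtain ⟨i, hi, hi'⟩ := h.exists_grid x hD hr hr'
  have hD' : (1 : ℝ) ≤ D := by exact_mod_cast hD
  have a1 := hx 0 i (by omega) hi
  have a2 := hx i N hi le_rfl
  have a3 : |s * (pth f x r - pth f x (k + (i : ℤ) * D))| ≤ K * D := by
    rw [abs_mul, hs, one_mul]; exact hi'
  have a4 : (i : ℝ) ≤ N := by exact_mod_cast hi
  have a5 : (0 : ℝ) ≤ i := Nat.cast_nonneg _
  have a6 : ε * (i * D) ≤ l * (i * D) := mul_le_mul_of_nonneg_right hε (by positivity)
  have a7 : ε * ((N - i) * D) ≤ l * ((N - i) * D) :=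
    mul_le_mul_of_nonneg_right hε (mul_nonneg (by linarith) (by linarith))
  simp only [Nat.cast_zero, zero_mul, add_zero, sub_zero] at a1
  rw [abs_le] at a1 a2 a3
  constructor <;> linarith [a1.1, a1.2, a2.1, a2.2, a3.1, a3.2]

variable [Fintype α] [Fintype β]

lemma CQ.count_window (h : CQ f g K) {S : Finset (ℤ →₀ α)} {i u0 W B : ℤ} {A1 A2 : ℤ →₀ β}
    (hS : ∀ a ∈ S, |(f (a, i)).2 - u0| ≤ W ∧ (∀ j, j < (f (a, i)).2 - B → (f (a, i)).1 j = A1 j) ∧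
      ∀ j, (f (a, i)).2 + B ≤ j → (f (a, i)).1 j = A2 j) :
    S.card ≤ (2 * W + 1).toNat *
      (Fintype.card α ^ (4 * K).toNat * Fintype.card β ^ (2 * B).toNat) := by
  have hsub : S ⊆ (Finset.Icc (u0 - W) (u0 + W)).biUnion fun u =>
      S.filter fun a => (f (a, i)).2 = u := by
    intro a ha
    have := abs_le.1 (hS a ha).1
    exact Finset.mem_biUnion.2 ⟨(f (a, i)).2, Finset.mem_Icc.2 ⟨by omega, by omega⟩,
      Finset.mem_filter.2 ⟨ha, rfl⟩⟩
  refine (Finset.card_le_card hsub).trans ((Finset.card_biUnion_le_card_mul _ _ _ ?_).trans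
    (Nat.mul_le_mul_right _ (by simp; omega)))
  intro u _
  have := h.count (S := S.filter fun a => (f (a, i)).2 = u) (i := i) (h1 := u) (h2 := u)
    (lo := u - B) (hi := u + B) (A0 := sp u A1 A2) (fun a ha => by
      obtain ⟨ha, hu⟩ := Finset.mem_filter.1 ha
      obtain ⟨-, h1, h2⟩ := hS a ha
      refine ⟨hu.ge, hu.le, fun j hj => ?_⟩
      rw [hu] at h1 h2
      by_cases hB : 0 ≤ B
      · rcases hj with hj | hj
        · rw [h1 j hj, sp_apply, if_pos (by omega)]
        · rw [h2 j hj, sp_apply, if_neg (by omega)]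
      · by_cases hju : j < u
        · rw [sp_apply, if_pos hju, h1 j (by omega)]
        · rw [sp_apply, if_neg hju, h2 j (by omega)])
  rw [show (u + 1 - u).toNat = 1 by omega, one_mul, show u + B - (u - B) = 2 * B by ring] at this
  exact this

end Sign

section Sign

/-- If two events rarely share a fibre in either direction and almost cover, one of them is
rare. -/
lemma pr_mul_pr_le {ι κ : Type*} {S : Finset ι} {T : Finset κ} (hS : S.Nonempty)
    (hT : T.Nonempty) {p m : ι × κ → Prop} {θ : ℝ} (hθ : 0 ≤ θ)
    (h1 : ∀ c ∈ T, ∀ c' ∈ T, pr S (fun q => p (q, c) ∧ m (q, c')) ≤ θ)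
    (h2 : ∀ q ∈ S, ∀ q' ∈ S, pr T (fun c => p (q, c) ∧ m (q', c)) ≤ θ)
    (h3 : pr (S ×ˢ T) (fun x => ¬ p x ∧ ¬ m x) ≤ θ) :
    pr (S ×ˢ T) p * pr (S ×ˢ T) m ≤ 3 * θ := by
  have t1 : 𝔼 x ∈ S ×ˢ T, pr (S ×ˢ T) (fun y => p (x.1, x.2) ∧ m (x.1, y.2)) ≤ θ := by
    unfold pr
    rw [Finset.expect_comm]
    refine expect_le_of_forall hθ fun y hy => ?_
    rw [Finset.mem_product] at hy
    have := pr_prod' S T (fun x : ι × κ => p (x.1, x.2) ∧ m (x.1, y.2))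
    unfold pr at this; rw [this]
    exact expect_le_of_forall hθ fun c hc => h1 c hc y.2 hy.2
  have t2 : 𝔼 x ∈ S ×ˢ T, pr (S ×ˢ T) (fun y => p (x.1, y.2) ∧ m (y.1, y.2)) ≤ θ := by
    refine expect_le_of_forall hθ fun x hx => ?_
    rw [Finset.mem_product] at hx
    rw [pr_prod]
    exact expect_le_of_forall hθ fun q hq => h2 x.1 hx.1 q hq
  have t3 : 𝔼 x ∈ S ×ˢ T, pr (S ×ˢ T) (fun y => ¬ p (x.1, y.2) ∧ ¬ m (x.1, y.2)) ≤ θ := by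
    refine le_trans (le_of_eq ?_) h3
    rw [pr_prod, Finset.expect_product]
    refine Finset.expect_congr rfl fun q _ => ?_
    refine (Finset.expect_const hT
      (pr (S ×ˢ T) fun y => ¬ p (q, y.2) ∧ ¬ m (q, y.2))).trans ?_
    rw [pr_prod]
    exact Finset.expect_const hS (pr T fun y => ¬ p (q, y) ∧ ¬ m (q, y))
  calc _ = 𝔼 x ∈ S ×ˢ T, 𝔼 y ∈ S ×ˢ T, (if p x then (1 : ℝ) else 0) * (if m y then 1 else 0) := by
        unfold pr; rw [Finset.expect_mul_expect]
    _ ≤ 𝔼 x ∈ S ×ˢ T, (pr (S ×ˢ T) (fun y => p (x.1, x.2) ∧ m (x.1, y.2)) +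
          pr (S ×ˢ T) (fun y => p (x.1, y.2) ∧ m (y.1, y.2)) +
          pr (S ×ˢ T) (fun y => ¬ p (x.1, y.2) ∧ ¬ m (x.1, y.2))) := by
        refine Finset.expect_le_expect fun x _ => ?_
        unfold pr
        rw [← Finset.expect_add_distrib, ← Finset.expect_add_distrib]
        refine Finset.expect_le_expect fun y _ => ?_
        by_cases a1 : p x <;> by_cases a2 : m y <;> by_cases a3 : p (x.1, y.2) <;>
          by_cases a4 : m (x.1, y.2) <;> simp [a1, a2, a3, a4]
    _ ≤ 3 * θ := by
        rw [Finset.expect_add_distrib, Finset.expect_add_distrib]; linarith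

variable {α β : Type*} [Zero α] [Zero β] [Fintype α] [Fintype β]
variable {f : (ℤ →₀ α) × ℤ → (ℤ →₀ β) × ℤ} {g : (ℤ →₀ β) × ℤ → (ℤ →₀ α) × ℤ} {K : ℤ}

omit [Fintype α] [Fintype β] in
lemma runs.agree_pos (h : CQ f g K) {k D : ℤ} {N : ℕ} {ε l : ℝ} (hD : 1 ≤ D) (hε : ε ≤ l)
    {x : (ℤ →₀ α) × (ℤ →₀ α)} (hx : runs f k D N ε l 1 x) :
    (∀ j, j < (f (sp k x.2 x.1, k)).2 - (K * D + K) →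
      (f (sp (k + N * D) x.2 x.1, k + N * D)).1 j = (f (sp k x.2 x.1, k)).1 j) ∧
    (∀ j, (f (sp (k + N * D) x.2 x.1, k + N * D)).2 + (K * D + K) ≤ j →
      (f (sp (k + N * D) x.2 x.1, k + N * D)).1 j = (f (sp k x.2 x.1, k)).1 j) := by
  have hb := fun r hr hr' => hx.bounds h hD hε (by simp) (r := r) hr hr'
  simp only [one_mul, pth] at hb
  have hle : k ≤ k + N * D := by have : 0 ≤ (N : ℤ) * D := by positivity
                                 omega
  constructor
  · intro j hj
    refine walk_eq_below (γ := fun r => f (sp r x.2 x.1, r)) (h.path x.2 x.1) hle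
      (v := (f (sp k x.2 x.1, k)).2 - K * D) (fun r h1 h2 => ?_) (by linarith)
    exact_mod_cast (hb r h1 h2).1
  · intro j hj
    refine walk_eq_above (γ := fun r => f (sp r x.2 x.1, r)) (h.path x.2 x.1) hle
      (v := (f (sp (k + N * D) x.2 x.1, k + N * D)).2 + K * D) (fun r h1 h2 => ?_) (by linarith)
    exact_mod_cast (hb r h1 h2).2

omit [Fintype α] [Fintype β] in
lemma runs.agree_neg (h : CQ f g K) {k D : ℤ} {N : ℕ} {ε l : ℝ} (hD : 1 ≤ D) (hε : ε ≤ l)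
    {x : (ℤ →₀ α) × (ℤ →₀ α)} (hx : runs f k D N ε l (-1) x) :
    (∀ j, j < (f (sp (k + N * D) x.2 x.1, k + N * D)).2 - (K * D + K) →
      (f (sp (k + N * D) x.2 x.1, k + N * D)).1 j = (f (sp k x.2 x.1, k)).1 j) ∧
    (∀ j, (f (sp k x.2 x.1, k)).2 + (K * D + K) ≤ j →
      (f (sp (k + N * D) x.2 x.1, k + N * D)).1 j = (f (sp k x.2 x.1, k)).1 j) := by
  have hb := fun r hr hr' => hx.bounds h hD hε (by simp) (r := r) hr hr'
  simp only [neg_one_mul, pth] at hb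
  have hle : k ≤ k + N * D := by have : 0 ≤ (N : ℤ) * D := by positivity
                                 omega
  constructor
  · intro j hj
    refine walk_eq_below (γ := fun r => f (sp r x.2 x.1, r)) (h.path x.2 x.1) hle
      (v := (f (sp (k + N * D) x.2 x.1, k + N * D)).2 - K * D) (fun r h1 h2 => ?_) (by linarith)
    have := (hb r h1 h2).2
    have h3 : ((f (sp (k + N * D) x.2 x.1, k + N * D)).2 : ℝ) - K * D ≤ (f (sp r x.2 x.1, r)).2 := by
      linarith
    exact_mod_cast h3
  · intro j hj
    refine walk_eq_above (γ := fun r => f (sp r x.2 x.1, r)) (h.path x.2 x.1) hle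
      (v := (f (sp k x.2 x.1, k)).2 + K * D) (fun r h1 h2 => ?_) (by linarith)
    have := (hb r h1 h2).1
    have h3 : ((f (sp r x.2 x.1, r)).2 : ℝ) ≤ (f (sp k x.2 x.1, k)).2 + K * D := by linarith
    exact_mod_cast h3

/-- Bound for the number of end points shared by an increasing and a decreasing path. -/
def signC (α β : Type*) [Fintype α] [Fintype β] (K L D : ℤ) : ℕ :=
  (2 * (K * L) + 1).toNat *
    (Fintype.card α ^ (4 * K).toNat * Fintype.card β ^ (2 * (K * D + K)).toNat)

lemma CQ.card_bot_le (h : CQ f g K) {k D : ℤ} {N : ℕ} {ε l : ℝ} (hD : 1 ≤ D) (hε : ε ≤ l)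
    {o c c' : ℤ →₀ α} (hc : c ∈ Bx o k (k + N * D)) (hc' : c' ∈ Bx o k (k + N * D)) :
    ((Bx o k (k + N * D)).filter fun q => runs f k D N ε l 1 (q, c) ∧
      runs f k D N ε l (-1) (q, c')).card ≤ signC α β K (N * D) D := by
  have hle : k ≤ k + N * D := by have : 0 ≤ (N : ℤ) * D := by positivity
                                 omega
  refine h.count_window (i := k) (u0 := (f (c, k + N * D)).2) (A1 := (f (c, k + N * D)).1)
    (A2 := (f (c', k + N * D)).1) fun q hq => ?_
  obtain ⟨hq, h1, h2⟩ := Finset.mem_filter.1 hq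
  have e1 := (h1.agree_pos h hD hε).1
  have e2 := (h2.agree_neg h hD hε).2
  have e3 := h.path_lip c q hle
  simp only [sp_bot hq hc, sp_bot hq hc', sp_top hq hc, sp_top hq hc'] at e1 e2 e3
  refine ⟨?_, fun j hj => (e1 j hj).symm, fun j hj => (e2 j hj).symm⟩
  rw [abs_sub_comm]
  rwa [add_sub_cancel_left] at e3

lemma CQ.card_top_le (h : CQ f g K) {k D : ℤ} {N : ℕ} {ε l : ℝ} (hD : 1 ≤ D) (hε : ε ≤ l)
    {o q q' : ℤ →₀ α} (hq : q ∈ Bx o k (k + N * D)) (hq' : q' ∈ Bx o k (k + N * D)) :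
    ((Bx o k (k + N * D)).filter fun c => runs f k D N ε l 1 (q, c) ∧
      runs f k D N ε l (-1) (q', c)).card ≤ signC α β K (N * D) D := by
  have hle : k ≤ k + N * D := by have : 0 ≤ (N : ℤ) * D := by positivity
                                 omega
  refine h.count_window (i := k + N * D) (u0 := (f (q, k)).2) (A1 := (f (q', k)).1)
    (A2 := (f (q, k)).1) fun c hc => ?_
  obtain ⟨hc, h1, h2⟩ := Finset.mem_filter.1 hc
  have e1 := (h1.agree_pos h hD hε).2
  have e2 := (h2.agree_neg h hD hε).1
  have e3 := h.path_lip c q hle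
  simp only [sp_bot hq hc, sp_bot hq' hc, sp_top hq hc, sp_top hq' hc] at e1 e2 e3
  refine ⟨?_, fun j hj => e2 j hj, fun j hj => e1 j hj⟩
  rwa [add_sub_cancel_left] at e3

end Sign

section Sign

variable {α β : Type*} [Zero α] [Zero β] [Fintype α] [Fintype β]
variable {f : (ℤ →₀ α) × ℤ → (ℤ →₀ β) × ℤ} {g : (ℤ →₀ β) × ℤ → (ℤ →₀ α) × ℤ} {K : ℤ}

omit [Fintype β] in
lemma pr_not_runs_le {D : ℤ} {ε l θ : ℝ} (hD : 1 ≤ D) (hε : 2 * ε < l) (hθ : 0 ≤ θ)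
    (hf : ∀ t : ℤ, 1 ≤ t → ∀ o k, pr (Bx2 o k (k + t * D)) (fun x => ε * (t * D) <
      |(|pth f x (k + t * D) - pth f x k| - l * (t * D))|) ≤ θ) (N : ℕ) (o : ℤ →₀ α) (k : ℤ) :
    pr (Bx2 o k (k + N * D)) (fun x => ¬ runs f k D N ε l 1 x ∧ ¬ runs f k D N ε l (-1) x) ≤
      ((N : ℝ) + 1) ^ 2 * θ := by
  set T := Finset.range (N + 1) ×ˢ Finset.range (N + 1)
  have h1 : pr (Bx2 o k (k + N * D))
      (fun x => ¬ runs f k D N ε l 1 x ∧ ¬ runs f k D N ε l (-1) x) ≤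
      pr (Bx2 o k (k + N * D)) (fun x => ∃ t ∈ T, t.1 < t.2 ∧ ε * ((t.2 - t.1) * D) <
        |(|pth f x (k + (t.2 : ℤ) * D) - pth f x (k + (t.1 : ℤ) * D)| - l * ((t.2 - t.1) * D))|) := by
    refine pr_mono fun x _ hx => ?_
    by_contra hcon
    push Not at hcon
    rcases runs_or (N := N) hD hε (fun i j hij hj => hcon (i, j) (Finset.mem_product.2
      ⟨Finset.mem_range.2 (by dsimp only; omega), Finset.mem_range.2 (by dsimp only; omega)⟩)
      hij) with h2 | h2
    · exact hx.1 h2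
    · exact hx.2 h2
  refine h1.trans ((pr_exists_le _ T _).trans ?_)
  have h2 : ∀ t ∈ T, pr (Bx2 o k (k + N * D)) (fun x => t.1 < t.2 ∧ ε * ((t.2 - t.1) * D) <
      |(|pth f x (k + (t.2 : ℤ) * D) - pth f x (k + (t.1 : ℤ) * D)| - l * ((t.2 - t.1) * D))|) ≤
      θ := by
    rintro ⟨i, j⟩ hij
    simp only [T, Finset.mem_product, Finset.mem_range] at hij
    by_cases hlt : i < j
    · have hj : (j : ℤ) ≤ N := by omega
      have hi : (i : ℤ) + 1 ≤ j := by omega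
      have := pr_subbox_le o (k := k) (l := k + N * D) (r := k + i * D) (s := k + j * D)
        (by have : 0 ≤ (i : ℤ) * D := by positivity
            omega) (by nlinarith) (by nlinarith)
        (fun x => ε * ((j - i) * D) < |(|pth f x (k + j * D) - pth f x (k + i * D)| -
          l * ((j - i) * D))|) (B := θ) (fun o' => by
          have := hf (j - i) (by omega) o' (k + i * D)
          rw [show k + i * D + (j - i) * D = k + j * D by ring] at this
          push_cast at this
          exact this)
      refine le_trans (pr_mono fun x _ hx => ?_) this
      have e1 : k + (i : ℤ) * D ≤ k + j * D := by nlinarith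
      rw [pth_sub x e1 le_rfl, pth_sub x le_rfl e1]
      exact hx.2
    · simp only [hlt, false_and]
      simpa [pr] using hθ
  refine (Finset.sum_le_sum h2).trans (le_of_eq ?_)
  simp only [T, Finset.sum_const, Finset.card_product, Finset.card_range, nsmul_eq_mul]
  push_cast; ring

/-- At a suitable scale, almost all vertical paths of any box are almost linear with a common
direction. -/
lemma CQ.sign_box (h : CQ f g K) (hα : 2 ≤ Fintype.card α) (hβ : 2 ≤ Fintype.card β) {ε θ : ℝ}
    (hε : 0 < ε) (hεl : 2 * ε < lam α β) (hθ : 0 < θ) (R : ℤ) : ∃ (D : ℤ) (N : ℕ), R ≤ D ∧ 1 ≤ D ∧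
    1 ≤ N ∧ ∀ o k, ∃ s : ℝ, (s = 1 ∨ s = -1) ∧
      pr (Bx2 o k (k + N * D)) (fun x => ¬ runs f k D N ε (lam α β) s x) ≤ θ := by
  have hK := h.one_le
  set n : ℝ := (Fintype.card α : ℝ) with hn
  set m : ℝ := (Fintype.card β : ℝ) with hm
  have hn2 : 2 ≤ n := by rw [hn]; exact_mod_cast hα
  have hm2 : 2 ≤ m := by rw [hm]; exact_mod_cast hβ
  set k4 : ℕ := (4 * K).toNat with hk4
  set θ1 : ℝ := min (θ / 13) (1 / 2) with hθ1
  have hθ0 : 0 < θ1 := by rw [hθ1]; positivity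
  have hθ13 : θ1 ≤ θ / 13 := min_le_left _ _
  have hθ12 : θ1 ≤ 1 / 2 := min_le_right _ _
  obtain ⟨N, hN⟩ := pow_unbounded_of_one_lt (4 * (n ^ k4 * m ^ k4)) (show 1 < n by linarith)
  have hN1 : 1 ≤ N := by
    by_contra hcon
    have : N = 0 := by omega
    rw [this, pow_zero] at hN
    have : (1 : ℝ) ≤ n ^ k4 := one_le_pow₀ (by linarith)
    have : (1 : ℝ) ≤ m ^ k4 := one_le_pow₀ (by linarith)
    nlinarith
  obtain ⟨D0, hD0, hf⟩ := h.speed hα hβ hε (show 0 < θ1 / ((N : ℝ) + 1) ^ 2 by positivity)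
  obtain ⟨M, hM⟩ := exists_sq_mul_pow_le (x := 1 / 4) (by norm_num) (by norm_num) (2 * (K * N) + 1)
    hθ0
  set t : ℤ := max 1 (max M R) with ht
  have ht1 : 1 ≤ t := le_max_left _ _
  have htM : (M : ℤ) ≤ t := (le_max_left _ _).trans (le_max_right _ _)
  have htR : R ≤ t := (le_max_right _ _).trans (le_max_right _ _)
  set D : ℤ := t * D0 with hD
  have hDt : t ≤ D := by rw [hD]; nlinarith
  have hD1 : 1 ≤ D := ht1.trans hDt
  refine ⟨D, N, htR.trans hDt, hD1, hN1, fun o k => ?_⟩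
  have hND : 0 ≤ (N : ℤ) * D := by positivity
  have hcount : (signC α β K (N * D) D : ℝ) ≤ θ1 * n ^ (N * D.toNat) := by
    have hDM : M ≤ D.toNat := by omega
    have hDd : (D.toNat : ℤ) = D := by omega
    have h1 := hM D.toNat hDM
    have h2 : (4 * (n ^ k4 * m ^ k4)) ^ D.toNat ≤ n ^ (N * D.toNat) := by
      rw [pow_mul]; exact pow_le_pow_left₀ (by positivity) hN.le _
    have hcast : (signC α β K (N * D) D : ℝ) =
        (2 * (K * (N * D)) + 1 : ℝ) * (n ^ k4 * m ^ (2 * (K * D + K)).toNat) := by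
      unfold signC
      push_cast
      congr 1
      have : ((2 * (K * (N * D)) + 1).toNat : ℤ) = 2 * (K * (N * D)) + 1 :=
        Int.toNat_of_nonneg (by positivity)
      exact_mod_cast this
    rw [hcast]
    have hd1 : (1 : ℝ) ≤ (D.toNat : ℝ) := by exact_mod_cast (by omega : 1 ≤ D.toNat)
    have hDr : (D : ℝ) = (D.toNat : ℝ) := by exact_mod_cast hDd.symm
    have h3 : n ^ k4 ≤ (n ^ k4) ^ D.toNat :=
      le_self_pow₀ (one_le_pow₀ (by linarith)) (by omega)
    have h4 : m ^ (2 * (K * D + K)).toNat ≤ (m ^ k4) ^ D.toNat := by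
      rw [← pow_mul]
      refine pow_le_pow_right₀ (by linarith) ?_
      have : (((2 * (K * D + K)).toNat : ℕ) : ℤ) ≤ ((k4 * D.toNat : ℕ) : ℤ) := by
        push_cast
        rw [hk4, Int.toNat_of_nonneg (by nlinarith), hDd, Int.toNat_of_nonneg (by omega)]
        nlinarith
      exact_mod_cast this
    have h5 : (2 * (K * (N * D)) + 1 : ℝ) ≤ (2 * (K * N) + 1) * (D.toNat : ℝ) ^ 2 := by
      have hKN : (0 : ℝ) ≤ K * N :=
          mul_nonneg (by exact_mod_cast (by omega : 0 ≤ K)) (by positivity)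
      rw [hDr]; nlinarith [mul_le_mul_of_nonneg_left hd1 (by positivity : (0 : ℝ) ≤ D.toNat)]
    calc _ ≤ ((2 * (K * N) + 1) * (D.toNat : ℝ) ^ 2) *
          ((n ^ k4) ^ D.toNat * (m ^ k4) ^ D.toNat) := by
          refine mul_le_mul h5 (mul_le_mul h3 h4 (by positivity) (by positivity)) (by positivity) ?_
          have hKN : (0 : ℝ) ≤ K * N :=
            mul_nonneg (by exact_mod_cast (by omega : 0 ≤ K)) (by positivity)
          positivity
      _ = (2 * (K * N) + 1) * ((D.toNat : ℝ) ^ 2 * (1 / 4) ^ D.toNat) *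
          (4 * (n ^ k4 * m ^ k4)) ^ D.toNat := by
          rw [mul_pow, mul_pow, one_div, inv_pow]; field_simp
      _ ≤ _ := mul_le_mul h1 h2 (by positivity) hθ0.le
  have hcard : ((Bx o k (k + N * D)).card : ℝ) = n ^ (N * D.toNat) := by
    rw [card_Bx, add_sub_cancel_left, Int.toNat_mul (by positivity) (by omega), Int.toNat_natCast]
    push_cast; rfl
  have hneither : pr (Bx2 o k (k + N * D)) (fun x => ¬ runs f k D N ε (lam α β) 1 x ∧
      ¬ runs f k D N ε (lam α β) (-1) x) ≤ θ1 := by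
    refine (pr_not_runs_le (θ := θ1 / ((N : ℝ) + 1) ^ 2) hD1 hεl (by positivity)
        (fun s hs o k => ?_) N o k).trans
      (le_of_eq ?_)
    · have := hf (s * t) (by nlinarith) o k
      rw [show s * t * D0 = s * D by rw [hD]; ring] at this
      have e : (((s * t : ℤ) : ℝ) * (D0 : ℝ)) = s * D := by rw [hD]; push_cast; ring
      rw [e] at this
      exact this
    · field_simp
  have hprod := pr_mul_pr_le (Bx_nonempty o k (k + N * D)) (Bx_nonempty o k (k + N * D))
    (p := runs f k D N ε (lam α β) 1) (m := runs f k D N ε (lam α β) (-1)) hθ0.le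
    (fun c hc c' hc' => by
      rw [pr_eq_card_div, div_le_iff₀ (by rw [hcard]; positivity), hcard]
      exact le_trans (by exact_mod_cast h.card_bot_le hD1 (by linarith) hc hc') hcount)
    (fun q hq q' hq' => by
      rw [pr_eq_card_div, div_le_iff₀ (by rw [hcard]; positivity), hcard]
      exact le_trans (by exact_mod_cast h.card_top_le hD1 (by linarith) hq hq') hcount) hneither
  set P := pr (Bx2 o k (k + N * D)) (runs f k D N ε (lam α β) 1) with hP
  set Q := pr (Bx2 o k (k + N * D)) (runs f k D N ε (lam α β) (-1)) with hQ
  change P * Q ≤ _ at hprod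
  have hP0 : 0 ≤ P := pr_nonneg _ _
  have hQ0 : 0 ≤ Q := pr_nonneg _ _
  have hP' : pr (Bx2 o k (k + N * D)) (fun x => ¬ runs f k D N ε (lam α β) 1 x) ≤ Q + θ1 := by
    refine (pr_mono fun x _ hx => ?_).trans ((pr_or_le _ _ _).trans (add_le_add_right hneither Q))
    tauto
  have hQ' : pr (Bx2 o k (k + N * D)) (fun x => ¬ runs f k D N ε (lam α β) (-1) x) ≤ P + θ1 := by
    refine (pr_mono fun x _ hx => ?_).trans ((pr_or_le _ _ _).trans (add_le_add_right hneither P))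
    tauto
  have hsum : 1 - θ1 ≤ P + Q := by
    have := pr_add_not (Bx2_nonempty o k (k + N * D)) (runs f k D N ε (lam α β) 1)
    linarith
  rcases le_total Q P with hle | hle
  · exact ⟨1, Or.inl rfl, by nlinarith⟩
  · exact ⟨-1, Or.inr rfl, by nlinarith⟩

end Sign

section Sign

variable {α β : Type*} [Zero α] [Zero β] [Fintype α] [Fintype β]
variable {f : (ℤ →₀ α) × ℤ → (ℤ →₀ β) × ℤ} {g : (ℤ →₀ β) × ℤ → (ℤ →₀ α) × ℤ} {K : ℤ}

omit [Fintype β] in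
set_option maxHeartbeats 800000 in
/-- Consistent choices of directions on boxes overlapping in all but one level agree. -/
lemma CQ.sign_adj (h : CQ f g K) (hα : 2 ≤ Fintype.card α) {D : ℤ} {N : ℕ} {ε l θ : ℝ} (hD : 1 ≤ D)
    (hN : 1 ≤ N) (hl : 2 * ε < l) (hlD : 2 * K < l * D)
    (hθ0 : 0 ≤ θ) (hθ : 2 * θ * (Fintype.card α : ℝ) ^ 2 < 1) {o1 o2 : ℤ →₀ α} {k : ℤ} {s1 s2 : ℝ}
    (hs1 : s1 = 1 ∨ s1 = -1) (hs2 : s2 = 1 ∨ s2 = -1)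
    (h1 : pr (Bx2 o1 k (k + N * D)) (fun x => ¬ runs f k D N ε l s1 x) ≤ θ)
    (h2 : pr (Bx2 o2 (k + 1) (k + 1 + N * D)) (fun x => ¬ runs f (k + 1) D N ε l s2 x) ≤ θ)
    (ho : o2 ∈ Bx o1 k (k + N * D + 1)) : s1 = s2 := by
  set L : ℤ := N * D with hL
  have hL1 : 1 ≤ L := by
    have : (1 : ℤ) ≤ N := by exact_mod_cast hN
    rw [hL]; nlinarith
  have hLD : D ≤ L := by
    have : (1 : ℤ) ≤ N := by exact_mod_cast hN
    rw [hL]; nlinarith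
  set n : ℝ := (Fintype.card α : ℝ) with hn
  have hn0 : 0 < n := by rw [hn]; exact_mod_cast (by omega : 0 < Fintype.card α)
  set B := Bx2 o1 k (k + L + 1) with hB
  have b1 : pr B (fun x => x.1 ∈ Bx o1 k (k + L) ∧
      ¬ runs f k D N ε l s1 (sp k x.2 x.1, sp (k + L) x.2 x.1)) ≤ θ := by
    have := pr_subbox_le o1 (k := k) (l := k + L + 1) (r := k) (s := k + L) le_rfl (by omega)
      (by omega) (fun y => y.1 ∈ Bx o1 k (k + L) ∧ ¬ runs f k D N ε l s1 y) (B := θ) (fun o' => by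
        by_cases ho' : o' ∈ Bx o1 k (k + L)
        · unfold Bx2
          rw [Bx_eq_of_mem ho']
          exact (pr_mono fun x _ hx => hx.2).trans h1
        · refine le_trans (pr_mono (q := fun _ => False) fun x hx hx' => ho' ?_) (by simpa [pr])
          rw [mem_Bx]; intro i hi
          rw [← mem_Bx.1 hx'.1 i hi, mem_Bx.1 (mem_Bx2.1 hx).1 i hi])
    refine le_trans (pr_mono fun x hx hx' => ?_) this
    refine ⟨?_, hx'.2⟩
    dsimp only
    rw [sp_bot (mem_Bx2.1 hx).1 (mem_Bx2.1 hx).2]; exact hx'.1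
  have b2 : pr B (fun x => x.2 ∈ Bx o2 (k + 1) (k + 1 + L) ∧
      ¬ runs f (k + 1) D N ε l s2 (sp (k + 1) x.2 x.1, sp (k + 1 + L) x.2 x.1)) ≤ θ := by
    have := pr_subbox_le o1 (k := k) (l := k + L + 1) (r := k + 1) (s := k + 1 + L) (by omega)
      (by omega) (by omega) (fun y => y.2 ∈ Bx o2 (k + 1) (k + 1 + L) ∧
        ¬ runs f (k + 1) D N ε l s2 y) (B := θ) (fun o' => by
        by_cases ho' : o' ∈ Bx o2 (k + 1) (k + 1 + L)
        · unfold Bx2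
          rw [Bx_eq_of_mem ho']
          exact (pr_mono fun x _ hx => hx.2).trans h2
        · refine le_trans (pr_mono (q := fun _ => False) fun x hx hx' => ho' ?_) (by simpa [pr])
          rw [mem_Bx]; intro i hi
          rw [← mem_Bx.1 hx'.1 i hi, mem_Bx.1 (mem_Bx2.1 hx).2 i hi])
    refine le_trans (pr_mono fun x hx hx' => ?_) this
    refine ⟨?_, hx'.2⟩
    dsimp only
    rw [show k + 1 + L = k + L + 1 by ring, sp_top (mem_Bx2.1 hx).1 (mem_Bx2.1 hx).2,
      show k + L + 1 = k + 1 + L by ring]; exact hx'.1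
  have b3 : 1 / n ^ 2 ≤ pr B (fun x => x.1 ∈ Bx o1 k (k + L) ∧ x.2 ∈ Bx o2 (k + 1) (k + 1 + L)) := by
    have hsub : Bx o1 k (k + L) ×ˢ Bx o2 (k + 1) (k + 1 + L) ⊆ B.filter
        (fun x => x.1 ∈ Bx o1 k (k + L) ∧ x.2 ∈ Bx o2 (k + 1) (k + 1 + L)) := by
      intro x hx
      obtain ⟨hx1, hx2⟩ := Finset.mem_product.1 hx
      refine Finset.mem_filter.2 ⟨mem_Bx2.2 ⟨?_, ?_⟩, hx1, hx2⟩
      · rw [mem_Bx] at *; intro i hi; exact hx1 i (by omega)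
      · rw [mem_Bx] at *; intro i hi
        rw [hx2 i (by omega)]; exact ho i (by omega)
    have hc := Finset.card_le_card hsub
    rw [Finset.card_product, card_Bx, card_Bx] at hc
    have hBc : B.card = (Fintype.card α ^ (k + L + 1 - k).toNat) *
        Fintype.card α ^ (k + L + 1 - k).toNat := by
      rw [hB]; unfold Bx2; rw [Finset.card_product, card_Bx]
    have hBp : (0 : ℝ) < B.card := by
      rw [hBc]; push_cast; rw [← hn]; positivity
    rw [pr_eq_card_div, le_div_iff₀ hBp, hBc]
    refine le_trans (le_of_eq ?_) (Nat.cast_le.2 (hc.trans (le_of_eq (by congr!))))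
    have e1 : (k + L - k).toNat = L.toNat := by congr 1; ring
    have e2 : (k + 1 + L - (k + 1)).toNat = L.toNat := by congr 1; ring
    have e3 : (k + L + 1 - k).toNat = L.toNat + 1 := by omega
    rw [e1, e2, e3]; push_cast; rw [← hn]; field_simp; ring
  have b4 : ∃ x ∈ B, runs f k D N ε l s1 (sp k x.2 x.1, sp (k + L) x.2 x.1) ∧
      runs f (k + 1) D N ε l s2 (sp (k + 1) x.2 x.1, sp (k + 1 + L) x.2 x.1) := by
    by_contra! hcon
    have : pr B (fun x => x.1 ∈ Bx o1 k (k + L) ∧ x.2 ∈ Bx o2 (k + 1) (k + 1 + L)) ≤ θ + θ := by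
      refine le_trans (pr_mono fun x hx hx' => ?_) ((pr_or_le _ _ _).trans (add_le_add b1 b2))
      by_cases hr : runs f k D N ε l s1 (sp k x.2 x.1, sp (k + L) x.2 x.1)
      · exact Or.inr ⟨hx'.2, hcon x hx hr⟩
      · exact Or.inl ⟨hx'.1, hr⟩
    have := b3.trans this
    rw [div_le_iff₀ (by positivity)] at this
    linarith
  obtain ⟨x, -, r1, r2⟩ := b4
  have r1' := r1 0 N (Nat.zero_le _) le_rfl
  have r2' := r2 0 N (Nat.zero_le _) le_rfl
  rw [← hL, pth_sub x (by omega) le_rfl, Nat.cast_zero, zero_mul, add_zero,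
    pth_sub x le_rfl (by omega)] at r1'
  rw [← hL, pth_sub x (by omega) le_rfl, Nat.cast_zero, zero_mul, add_zero,
    pth_sub x le_rfl (by omega)] at r2'
  have l1 := h.pth_lip x (show k ≤ k + 1 by omega)
  have l2 := h.pth_lip x (show k + L ≤ k + 1 + L by omega)
  push_cast at r1' r2' l1 l2
  have hNr : (1 : ℝ) ≤ N := by exact_mod_cast hN
  have hDr : (1 : ℝ) ≤ D := by exact_mod_cast hD
  have hLr : (D : ℝ) ≤ N * D := by nlinarith
  have hl0 : 0 < l := by
    have : (1 : ℝ) ≤ K := by exact_mod_cast h.one_le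
    by_contra hcon; push Not at hcon; nlinarith
  rw [abs_le] at r1' r2' l1 l2
  have h3 : 2 * ε * (N * D) ≤ l * (N * D) := by gcongr
  have h4 : l * D ≤ l * (N * D) := by gcongr
  rcases hs1 with rfl | rfl <;> rcases hs2 with rfl | rfl
  · rfl
  · exfalso; linarith [r1'.1, r2'.1, l1.1, l1.2, l2.1, l2.2]
  · exfalso; linarith [r1'.1, r2'.1, l1.1, l1.2, l2.1, l2.2]
  · rfl

omit [Fintype β] in
/-- A function of boxes which is invariant under small moves is constant. -/
lemma const_of_adj {γ : Type*} {S : (ℤ →₀ α) → ℤ → γ} {L : ℤ} (hL : 0 ≤ L)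
    (hS : ∀ o1 o2 k, o2 ∈ Bx o1 k (k + L + 1) → S o1 k = S o2 (k + 1)) (o o' : ℤ →₀ α) (k k' : ℤ) :
    S o k = S o' k' := by
  have key : ∀ t : ℤ, 1 ≤ t → ∀ o1 o2 k, o2 ∈ Bx o1 k (k + L + t) → S o1 k = S o2 (k + t) := by
    intro t ht
    induction t, ht using Int.leInduction with
    | base => exact hS
    | succ t ht ih =>
      intro o1 o2 k h12
      rw [mem_Bx] at h12
      rw [ih o1 (sp (k + t) o2 o1) k, hS _ o2 (k + t), add_assoc]
      · rw [mem_Bx]; intro i hi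
        rw [sp_apply]; split_ifs with h
        · rfl
        · exact h12 i (by omega)
      · rw [mem_Bx]; intro i hi
        rw [sp_apply]; split_ifs with h
        · exact h12 i (by omega)
        · rfl
  obtain ⟨M, hM⟩ := ((o.support ∪ o'.support).image fun i => |i|).exists_le
  have hM' : ∀ i, M < |i| → o' i = o i := by
    intro i hi
    by_contra hne
    have : i ∈ o.support ∪ o'.support := by
      rw [Finset.mem_union, Finsupp.mem_support_iff, Finsupp.mem_support_iff]
      by_contra hcon; push Not at hcon; exact hne (hcon.2.trans hcon.1.symm)
    exact absurd (hM _ (Finset.mem_image_of_mem _ this)) (not_le.2 hi)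
  set T := |M| + |k| + |k'| + |L| + 1 with hT
  have a1 := neg_abs_le M
  have a2 := le_abs_self M
  have a3 := abs_le.1 (le_refl |k|)
  have a4 := abs_le.1 (le_refl |k'|)
  have a5 := abs_le.1 (le_refl |L|)
  have c1 := key (T - k) (by omega) o o k (self_mem_Bx _ _ _)
  have c2 := key (T - k') (by omega) o' o' k' (self_mem_Bx _ _ _)
  have c3 := key (T + T) (by omega) o o (-T) (self_mem_Bx _ _ _)
  have c4 := key (T + T) (by omega) o o' (-T) (by
    rw [mem_Bx]; intro i hi; apply hM'; rw [lt_abs]; omega)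
  rw [add_sub_cancel] at c1 c2
  rw [show -T + (T + T) = T by ring] at c3 c4
  rw [c1, c2, ← c4, c3]

/-- At a suitable scale, almost all vertical paths are almost linear with a common direction. -/
lemma CQ.sign_global (h : CQ f g K) (hα : 2 ≤ Fintype.card α) (hβ : 2 ≤ Fintype.card β) {ε θ : ℝ}
    (hε : 0 < ε) (hεl : 2 * ε < lam α β) (hθ : 0 < θ) (R : ℤ) : ∃ (D : ℤ) (N : ℕ), R ≤ D ∧ 1 ≤ D ∧
    1 ≤ N ∧ ∃ s : ℝ, (s = 1 ∨ s = -1) ∧ ∀ o k,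
      pr (Bx2 o k (k + N * D)) (fun x => ¬ runs f k D N ε (lam α β) s x) ≤ θ := by
  have hl := lam_pos hα hβ
  set n : ℝ := (Fintype.card α : ℝ) with hn
  have hn0 : 0 < n := by rw [hn]; exact_mod_cast (by omega : 0 < Fintype.card α)
  set θ' := min θ (1 / (4 * n ^ 2)) with hθ'
  have ht0 : 0 < θ' := by rw [hθ']; positivity
  have ht1 : θ' ≤ 1 / (4 * n ^ 2) := min_le_right _ _
  rw [le_div_iff₀ (by positivity)] at ht1
  obtain ⟨D, N, hR, hD, hN, hbox⟩ := h.sign_box hα hβ hε hεl ht0 (max R (⌈2 * K / lam α β⌉ + 1))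
  have hD' : 2 * K < lam α β * D := by
    have h1 : (⌈2 * K / lam α β⌉ : ℤ) + 1 ≤ D := (le_max_right _ _).trans hR
    have h2 : ((⌈2 * K / lam α β⌉ : ℤ) : ℝ) + 1 ≤ D := by exact_mod_cast h1
    have h3 := Int.le_ceil (2 * K / lam α β)
    have h4 : 2 * K / lam α β < D := by linarith
    rw [div_lt_iff₀ hl] at h4; linarith
  choose S hS1 hS2 using hbox
  refine ⟨D, N, (le_max_left _ _).trans hR, hD, hN, S 0 0, hS1 0 0, fun o k => ?_⟩
  rw [const_of_adj (S := S) (L := N * D) (by positivity) (fun o1 o2 k ho =>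
      h.sign_adj hα hD hN hεl hD' ht0.le
    (by rw [← hn]; linarith) (hS1 _ _) (hS1 _ _) (hS2 o1 k) (hS2 o2 (k + 1)) ho) 0 o 0 k]
  exact (hS2 o k).trans (min_le_left _ _)

end Sign

section Reflection

variable {α β : Type*} [Zero α] [Zero β]
variable {f : (ℤ →₀ α) × ℤ → (ℤ →₀ β) × ℤ} {g : (ℤ →₀ β) × ℤ → (ℤ →₀ α) × ℤ} {K : ℤ}

/-- Reversal of a configuration. -/
def rev (a : ℤ →₀ α) : ℤ →₀ α := Finsupp.equivMapDomain (Equiv.subLeft (-1)) a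

@[simp] lemma rev_apply (a : ℤ →₀ α) (i : ℤ) : rev a i = a (-1 - i) := by
  simp [rev, Finsupp.equivMapDomain_apply, Equiv.subLeft]
  congr 1; ring

@[simp] lemma rev_rev (a : ℤ →₀ α) : rev (rev a) = a := by
  ext i; simp

/-- Reversal of the line. -/
def rho (p : (ℤ →₀ α) × ℤ) : (ℤ →₀ α) × ℤ := (rev p.1, -p.2)

@[simp] lemma rho_rho (p : (ℤ →₀ α) × ℤ) : rho (rho p) = p := by simp [rho]

lemma cl.rho {r : ℤ} {p p' : (ℤ →₀ α) × ℤ} (h : cl r p p') : cl r (rho p) (rho p') := by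
  obtain ⟨lo, hi, h1, h2, h3, h4, h5, h6⟩ := h
  refine ⟨-hi, -lo, by omega, ?_, ?_, ?_, ?_, fun i hi => ?_⟩ <;> simp only [LampQI.rho] <;>
    try omega
  rw [rev_apply, rev_apply]; exact h6 _ (by omega)

lemma CQ.rho_left (h : CQ f g K) : CQ (fun p => rho (f p)) (fun y => g (rho y)) K where
  one_le := h.one_le
  f_cl p p' hp := (h.f_cl p p' hp).rho
  g_cl y y' hy := h.g_cl _ _ hy.rho
  gf p := by simpa using h.gf p
  fg y := by simpa using (h.fg (rho y)).rho

lemma CQ.rho_right (h : CQ f g K) : CQ (fun p => f (rho p)) (fun y => rho (g y)) K :=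
  h.symm.rho_left.symm

lemma pth_rho_left (x : (ℤ →₀ α) × (ℤ →₀ α)) (r : ℤ) :
    pth (fun p => rho (f p)) x r = - pth f x r := by simp [pth, rho]

lemma rev_sp (r : ℤ) (a b : ℤ →₀ α) : rev (sp r a b) = sp (-r) (rev b) (rev a) := by
  ext i
  simp only [rev_apply, sp_apply]
  split_ifs <;> first | rfl | omega

lemma pth_rho_right (x : (ℤ →₀ α) × (ℤ →₀ α)) (r : ℤ) :
    pth (fun p => f (rho p)) x r = pth f (rev x.2, rev x.1) (-r) := by
  simp only [pth, rho, rev_sp]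

variable [Fintype α] [Fintype β]

lemma rev_mem_Bx {a c : ℤ →₀ α} {k l : ℤ} : rev c ∈ Bx (rev a) (-l) (-k) ↔ c ∈ Bx a k l := by
  simp only [mem_Bx, rev_apply]
  constructor
  · intro h i hi
    have := h (-1 - i) (by omega)
    simpa using this
  · intro h i hi
    exact h _ (by omega)

lemma expect_Bx_rev (a : ℤ →₀ α) (k l : ℤ) (φ : (ℤ →₀ α) → ℝ) :
    𝔼 c ∈ Bx a k l, φ (rev c) = 𝔼 c ∈ Bx (rev a) (-l) (-k), φ c :=
  Finset.expect_nbij' rev rev (fun _ hc => rev_mem_Bx.2 hc)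
    (fun c hc => rev_mem_Bx.1 (by simpa using hc)) (by simp) (by simp) (by simp)

/-- Vertical paths of `f` have, with probability at least `1 - θ`, speed `l` up to `ε` at
scale `R`. -/
def MH (f : (ℤ →₀ α) × ℤ → (ℤ →₀ β) × ℤ) (R : ℤ) (l ε θ : ℝ) : Prop :=
  ∀ o k, pr (Bx2 o k (k + R)) (fun x => ε * R < |pth f x (k + R) - pth f x k - l * R|) ≤ θ

lemma CQ.exists_MH (h : CQ f g K) (hα : 2 ≤ Fintype.card α) (hβ : 2 ≤ Fintype.card β) {ε θ : ℝ}
    (hε : 0 < ε) (hεl : 2 * ε < lam α β) (hθ : 0 < θ) (R1 : ℤ) :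
    ∃ (f' : (ℤ →₀ α) × ℤ → (ℤ →₀ β) × ℤ) (g' : (ℤ →₀ β) × ℤ → (ℤ →₀ α) × ℤ) (R : ℤ),
      CQ f' g' K ∧ R1 ≤ R ∧ 1 ≤ R ∧ MH f' R (lam α β) ε θ := by
  obtain ⟨D, N, hR, hD, hN, s, hs, hf⟩ := h.sign_global hα hβ hε hεl hθ R1
  have hN' : (1 : ℤ) ≤ N := by exact_mod_cast hN
  have key : ∀ o k, pr (Bx2 o k (k + N * D)) (fun x => ε * (N * D : ℤ) <
      |s * pth f x (k + N * D) - s * pth f x k - lam α β * (N * D : ℤ)|) ≤ θ := by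
    intro o k
    refine (pr_mono fun x _ hx hr => ?_).trans (hf o k)
    have := hr 0 N (Nat.zero_le _) le_rfl
    simp only [Nat.cast_zero, zero_mul, add_zero, sub_zero] at this
    push_cast at hx
    rw [mul_sub] at this
    exact absurd hx (not_lt.2 this)
  rcases hs with rfl | rfl
  · refine ⟨f, g, N * D, h, by nlinarith, by nlinarith, fun o k => ?_⟩
    simpa only [one_mul] using key o k
  · refine ⟨_, _, N * D, h.rho_left, by nlinarith, by nlinarith, fun o k => ?_⟩
    simp only [pth_rho_left]
    simpa only [neg_one_mul] using key o k

omit [Fintype β] in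
/-- The mean height speed is preserved under reversing both lines. -/
lemma MH.rho {R : ℤ} {l ε θ : ℝ} (hf : MH f R l ε θ) : MH (fun p => rho (f (rho p))) R l ε θ := by
  intro o k
  refine le_trans (le_of_eq ?_) (hf (rev o) (-(k + R)))
  have h1 : ∀ x : (ℤ →₀ α) × (ℤ →₀ α), (ε * R < |pth (fun p => LampQI.rho (f (LampQI.rho p))) x (k + R) -
      pth (fun p => LampQI.rho (f (LampQI.rho p))) x k - l * R|) =
      (ε * R < |pth f (rev x.2, rev x.1) (-(k + R) + R) - pth f (rev x.2, rev x.1) (-(k + R)) -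
        l * R|) := by
    intro x
    rw [pth_rho_left, pth_rho_left, pth_rho_right, pth_rho_right,
      show -(k + R) + R = -k by ring]
    ring_nf
  simp only [h1]
  unfold Bx2
  rw [pr_prod, pr_prod']
  unfold pr
  rw [show -(k + R) + R = -k by ring]
  rw [← expect_Bx_rev o k (k + R)]
  refine Finset.expect_congr rfl fun q _ => ?_
  rw [← expect_Bx_rev o k (k + R)]

end Reflection

section Blocks

variable {α : Type*} [Zero α] [Fintype α]

/-- Block variables which depend only on the bottom from the block on and on the top up to the block,
and whose squares have conditional means at most two, have a product of mean at most `2 ^ N`. -/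
lemma expect_prod_blocks_le (o : ℤ →₀ α) {k l : ℤ} {N : ℕ} {b : ℕ → ℤ} (hb : Monotone b)
    (hbk : k ≤ b 0) (hbl : b N ≤ l) (s : ℕ → (ℤ →₀ α) × (ℤ →₀ α) → ℝ) (hs : ∀ i x, 1 ≤ s i x)
    (hdep : ∀ i q q' c c', (∀ j, b i ≤ j → q j = q' j) → (∀ j, j < b (i + 1) → c j = c' j) →
      s i (q, c) = s i (q', c'))
    (hB : ∀ i q c, 𝔼 q' ∈ Bx q (b i) (b (i + 1)), 𝔼 c' ∈ Bx c (b i) (b (i + 1)),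
      s i (q', c') ^ 2 ≤ 2) :
    𝔼 x ∈ Bx2 o k l, ∏ i ∈ Finset.range N, s i x ≤ 2 ^ N := by
  set p : ℕ → (ℤ →₀ α) × (ℤ →₀ α) → ℝ := fun i x =>
    𝔼 d ∈ Bx 0 (b i) (b (i + 1)), s i (sp (b (i + 1)) d x.1, x.2) ^ 2 with hp
  have hpa : ∀ i q c, 𝔼 q' ∈ Bx q (b i) (b (i + 1)), s i (q', c) ^ 2 = p i (q, c) := by
    intro i q c
    rw [← expect_Bx_map (a := 0) (b := q) (fun d => sp (b i) q (sp (b (i + 1)) d q))]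
    · refine Finset.expect_congr rfl fun d _ => ?_
      rw [hdep i _ (sp (b (i + 1)) d q) c c (fun j hj => ?_) fun _ _ => rfl]
      simp only [sp_apply]; rw [if_neg (by omega)]
    · intro w hw
      refine mem_Bx.2 fun j hj => ?_
      have := hb (Nat.le_succ i)
      simp only [sp_apply]; split_ifs <;> first | rfl | omega
    · intro w hw j h1 h2
      simp only [sp_apply]; split_ifs <;> first | rfl | omega
  have hpb : ∀ i q q' c c', (∀ j, b (i + 1) ≤ j → q j = q' j) →
      (∀ j, j < b (i + 1) → c j = c' j) → p i (q, c) = p i (q', c') := by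
    intro i q q' c c' h1 h2
    refine Finset.expect_congr rfl fun d _ => ?_
    congr 1
    refine hdep i _ _ _ _ (fun j hj => ?_) h2
    simp only [sp_apply]; split_ifs with h
    · rfl
    · exact h1 j (by omega)
  have hp1 : ∀ i x, 1 ≤ p i x := fun i x =>
    Finset.le_expect (Bx_nonempty _ _ _) fun d _ => one_le_pow₀ (hs _ _)
  have hpd : ∀ i q c, 𝔼 c' ∈ Bx c (b i) (b (i + 1)), p i (q, c') ≤ 2 := by
    intro i q c
    simp only [← hpa]
    rw [Finset.expect_comm]
    exact hB i q c
  have hR : ∀ m n, m + n = N →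
      𝔼 x ∈ Bx2 o k l, ∏ i ∈ Finset.range m, s (n + i) x ^ 2 / p (n + i) x = 1 := by
    intro m
    induction m with
    | zero => intro n _; simp [Finset.expect_const (Bx2_nonempty o k l)]
    | succ m ih =>
      intro n hn
      rw [← ih (n + 1) (by omega)]
      have h0 : k ≤ b n := hbk.trans (hb (Nat.zero_le _))
      have h1 : b (n + 1) ≤ l := (hb (by omega)).trans hbl
      unfold Bx2
      have comm : ∀ F : (ℤ →₀ α) × (ℤ →₀ α) → ℝ, 𝔼 x ∈ Bx o k l ×ˢ Bx o k l, F x =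
          𝔼 c ∈ Bx o k l, 𝔼 q ∈ Bx o k l, F (q, c) := fun F => by
        rw [Finset.expect_product, Finset.expect_comm]
      rw [comm, comm]
      refine Finset.expect_congr rfl fun c _ => ?_
      rw [← expect_resample o h0 h1]
      refine Finset.expect_congr rfl fun q _ => ?_
      have e1 : ∀ q' ∈ Bx q (b n) (b (n + 1)),
          ∏ i ∈ Finset.range (m + 1), s (n + i) (q', c) ^ 2 / p (n + i) (q', c) =
          s n (q', c) ^ 2 / p n (q, c) *
            ∏ i ∈ Finset.range m, s (n + 1 + i) (q, c) ^ 2 / p (n + 1 + i) (q, c) := by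
        intro q' hq'
        have hq : ∀ j, b (n + 1) ≤ j → q' j = q j := fun j hj => mem_Bx.1 hq' j (Or.inr hj)
        rw [Finset.prod_range_succ', mul_comm]
        congr 1
        · rw [add_zero, hpb n q' q c c hq fun _ _ => rfl]
        · refine Finset.prod_congr rfl fun i _ => ?_
          rw [show n + (i + 1) = n + 1 + i by ring]
          rw [hpb (n + 1 + i) q' q c c (fun j hj => hq j ((hb (by omega)).trans hj))
            fun _ _ => rfl, hdep (n + 1 + i) q' q c c
            (fun j hj => hq j ((hb (by omega)).trans hj)) fun _ _ => rfl]
      rw [Finset.expect_congr rfl e1, ← Finset.expect_mul, ← Finset.expect_div, hpa,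
          div_self, one_mul]
      exact (zero_lt_one.trans_le (hp1 _ _)).ne'
  have hP : ∀ m ≤ N, 𝔼 x ∈ Bx2 o k l, ∏ i ∈ Finset.range m, p i x ≤ 2 ^ m := by
    intro m
    induction m with
    | zero => intro _; simp [Finset.expect_const (Bx2_nonempty o k l)]
    | succ m ih =>
      intro hm
      refine le_trans ?_ (le_trans (mul_le_mul_of_nonneg_right (ih (by omega)) zero_le_two)
        (le_of_eq (pow_succ _ _).symm))
      have h0 : k ≤ b m := hbk.trans (hb (Nat.zero_le _))
      have h1 : b (m + 1) ≤ l := (hb (by omega)).trans hbl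
      unfold Bx2
      rw [Finset.expect_product, Finset.expect_product, Finset.expect_mul]
      refine Finset.expect_le_expect fun q _ => ?_
      rw [← expect_resample o h0 h1, Finset.expect_mul]
      refine Finset.expect_le_expect fun c _ => ?_
      have e1 : ∀ c' ∈ Bx c (b m) (b (m + 1)), ∏ i ∈ Finset.range (m + 1), p i (q, c') =
          (∏ i ∈ Finset.range m, p i (q, c)) * p m (q, c') := by
        intro c' hc'
        rw [Finset.prod_range_succ]
        congr 1
        refine Finset.prod_congr rfl fun i hi => ?_
        rw [Finset.mem_range] at hi
        refine hpb i _ _ _ _ (fun _ _ => rfl) fun j hj => mem_Bx.1 hc' j (Or.inl ?_)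
        exact hj.trans_le (hb (by omega))
      rw [Finset.expect_congr rfl e1, ← Finset.mul_expect]
      exact mul_le_mul_of_nonneg_left (hpd _ _ _)
        (Finset.prod_nonneg fun i _ => zero_le_one.trans (hp1 _ _))
  have hsum : 𝔼 x ∈ Bx2 o k l, ((∏ i ∈ Finset.range N, s (0 + i) x ^ 2 / p (0 + i) x) +
      ∏ i ∈ Finset.range N, p i x) ≤ 1 + 2 ^ N := by
    rw [Finset.expect_add_distrib, hR N 0 (by omega)]
    linarith [hP N le_rfl]
  have h2N : (1 : ℝ) ≤ 2 ^ N := one_le_pow₀ one_le_two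
  have hle : 𝔼 x ∈ Bx2 o k l, (2 * ∏ i ∈ Finset.range N, s i x) ≤ 1 + 2 ^ N := by
    refine (Finset.expect_le_expect fun x _ => ?_).trans hsum
    simp only [zero_add, Finset.prod_div_distrib, Finset.prod_pow]
    have hq : 1 ≤ ∏ i ∈ Finset.range N, p i x :=
      Finset.one_le_prod fun i _ => hp1 i x
    set u := ∏ i ∈ Finset.range N, s i x
    set v := ∏ i ∈ Finset.range N, p i x
    have hv : 0 < v := by linarith
    rw [div_add' _ _ _ hv.ne', le_div_iff₀ hv]
    nlinarith [sq_nonneg (u - v)]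
  rw [← Finset.mul_expect] at hle
  linarith

end Blocks

section Tail

variable {α β : Type*} [Zero α] [Zero β] [Fintype α] [Fintype β]
variable {f : (ℤ →₀ α) × ℤ → (ℤ →₀ β) × ℤ} {g : (ℤ →₀ β) × ℤ → (ℤ →₀ α) × ℤ} {K : ℤ}

/-- The deviation of the vertical path `x` from speed `l` between two levels. -/
def dvn (f : (ℤ →₀ α) × ℤ → (ℤ →₀ β) × ℤ) (l : ℝ) (x : (ℤ →₀ α) × (ℤ →₀ α)) (r s : ℤ) : ℝ :=
  |pth f x s - pth f x r - l * (s - r)|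

omit [Fintype β] in
/-- If each block is bad with small probability, many bad blocks are exponentially unlikely. -/
lemma pr_bad_blocks_le {R : ℤ} (hR : 0 ≤ R) {l ε θ : ℝ} (hf : MH f R l ε θ) {s : ℕ}
    (hθ : 64 ^ s * θ ≤ 1) (o : ℤ →₀ α) (k : ℤ) {N : ℕ} {t : ℤ} (ht : k + N * R ≤ t) :
    pr (Bx2 o k t) (fun x => N ≤ s * ((Finset.range N).filter fun i : ℕ =>
      ε * R < dvn f l x (k + i * R) (k + (i + 1 : ℕ) * R)).card) ≤ (1 / 4) ^ N := by
  set bad : ℕ → (ℤ →₀ α) × (ℤ →₀ α) → Prop := fun i x =>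
    ε * R < dvn f l x (k + i * R) (k + (i + 1 : ℕ) * R) with hbad
  set w : ℕ → (ℤ →₀ α) × (ℤ →₀ α) → ℝ := fun i x => if bad i x then 8 ^ s else 1 with hw
  have h8 : (1 : ℝ) ≤ 8 ^ s := one_le_pow₀ (by norm_num)
  have hmono : Monotone fun i : ℕ => k + (i : ℤ) * R := fun i j hij => by
    have : (i : ℤ) ≤ j := by exact_mod_cast hij
    simp only; nlinarith
  have hstep : ∀ i : ℕ, k + (i : ℤ) * R ≤ k + (i + 1 : ℕ) * R := fun i => hmono (Nat.le_succ i)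
  have hE : 𝔼 x ∈ Bx2 o k t, ∏ i ∈ Finset.range N, w i x ≤ 2 ^ N := by
    refine expect_prod_blocks_le o hmono (by simp) ht w (fun i x => ?_)
        (fun i q q' c c' h1 h2 => ?_)
      fun i q c => ?_
    · simp only [hw]; split_ifs <;> first | exact h8 | exact le_rfl
    · have e : ∀ r, k + (i : ℤ) * R ≤ r → r ≤ k + (i + 1 : ℕ) * R →
          pth f (q, c) r = pth f (q', c') r := fun r hr hr' => by
        refine pth_congr ?_
        ext j
        simp only [sp_apply]; split_ifs with hj
        · exact h2 j (by omega)
        · exact h1 j (by omega)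
      simp only [hw, hbad, dvn, e _ le_rfl (hstep i), e _ (hstep i) le_rfl]
    · set Ψ : (ℤ →₀ α) × (ℤ →₀ α) → ℝ := fun y => 1 + 64 ^ s *
        if ε * R < |pth f y (k + i * R + R) - pth f y (k + i * R) - l * R| then (1 : ℝ) else 0
        with hΨ
      have h1 : ∀ q' ∈ Bx q (k + i * R) (k + (i + 1 : ℕ) * R),
          ∀ c' ∈ Bx c (k + i * R) (k + (i + 1 : ℕ) * R), w i (q', c') ^ 2 ≤
          Ψ (sp (k + i * R) c q', sp (k + (i + 1 : ℕ) * R) c' q) := by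
        intro q' hq' c' hc'
        have e : ∀ r, k + (i : ℤ) * R ≤ r → r ≤ k + (i + 1 : ℕ) * R →
            pth f (sp (k + i * R) c q', sp (k + (i + 1 : ℕ) * R) c' q) r = pth f (q', c') r :=
            fun r hr hr' => by
          refine pth_congr ?_
          ext j
          simp only [sp_apply]
          split_ifs <;> first | rfl | omega
        have e1 : k + (i : ℤ) * R + R = k + (i + 1 : ℕ) * R := by push_cast; ring
        simp only [hw, hΨ, hbad, dvn, e1, e _ le_rfl (hstep i), e _ (hstep i) le_rfl]
        have e2 : l * (((k + (i + 1 : ℕ) * R : ℤ) : ℝ) - ((k + (i : ℤ) * R : ℤ) : ℝ)) = l * R := by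
          push_cast; ring
        rw [e2]
        split_ifs
        · rw [← pow_mul, mul_comm, pow_mul]; norm_num
        · norm_num
      refine (Finset.expect_le_expect fun q' hq' => Finset.expect_le_expect fun c' hc' =>
        h1 q' hq' c' hc').trans ?_
      rw [expect_pair q c (hstep i) Ψ, hΨ, Finset.expect_add_distrib, ← Finset.mul_expect,
        Finset.expect_const (Bx2_nonempty _ _ _)]
      have h2 := hf (sp (k + i * R) c q) (k + i * R)
      rw [show k + (i : ℤ) * R + R = k + (i + 1 : ℕ) * R by push_cast; ring] at h2 ⊢
      unfold pr at h2
      have : (0 : ℝ) ≤ 64 ^ s := by positivity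
      nlinarith [mul_le_mul_of_nonneg_left h2 this]
  have hmk := pr_markov (s := Bx2 o k t) (φ := fun x => ∏ i ∈ Finset.range N, w i x)
    (t := 8 ^ N) (fun x _ => Finset.prod_nonneg fun i _ => by
      simp only [hw]; split_ifs <;> positivity) (by positivity) hE
  rw [← div_pow] at hmk
  norm_num at hmk ⊢
  refine (pr_mono fun x _ hx => ?_).trans hmk
  simp only [hw]
  rw [Finset.prod_ite, Finset.prod_const, Finset.prod_const_one, mul_one, ← pow_mul]
  exact pow_le_pow_right₀ (by norm_num) (hx.trans (le_of_eq (by congr!)))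

/-- Deviations of vertical paths from the mean speed have exponential tails. -/
def Tail (f : (ℤ →₀ α) × ℤ → (ℤ →₀ β) × ℤ) (l ε C x : ℝ) : Prop :=
  ∀ r : ℕ, MH f r l ε (C * x ^ r)

omit [Fintype α] [Fintype β] in
lemma CQ.dvn_le (h : CQ f g K) {l : ℝ} (hl : 0 ≤ l) (x : (ℤ →₀ α) × (ℤ →₀ α)) {r s : ℤ}
    (hrs : r ≤ s) : dvn f l x r s ≤ (K + l) * (s - r) := by
  have h1 := abs_le.1 (h.pth_lip x hrs)
  have h2 : (0 : ℝ) ≤ s - r := by exact_mod_cast sub_nonneg.2 hrs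
  have h3 : 0 ≤ l * ((s : ℝ) - r) := mul_nonneg hl h2
  have hK : (1 : ℝ) ≤ K := by exact_mod_cast h.one_le
  have h4 : 0 ≤ (K : ℝ) * (s - r) := mul_nonneg (by linarith) h2
  exact abs_le.2 ⟨by linarith, by linarith⟩

omit [Fintype α] [Fintype β] in
lemma dvn_add (f : (ℤ →₀ α) × ℤ → (ℤ →₀ β) × ℤ) (l : ℝ) (x : (ℤ →₀ α) × (ℤ →₀ α)) (r s t : ℤ) :
    dvn f l x r t ≤ dvn f l x r s + dvn f l x s t := by
  unfold dvn
  refine (le_of_eq ?_).trans (abs_add_le _ _)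
  congr 1; ring

omit [Fintype α] [Fintype β] in
lemma dvn_le_sum (f : (ℤ →₀ α) × ℤ → (ℤ →₀ β) × ℤ) (l : ℝ) (x : (ℤ →₀ α) × (ℤ →₀ α)) (b : ℕ → ℤ)
    (N : ℕ) : dvn f l x (b 0) (b N) ≤ ∑ i ∈ Finset.range N, dvn f l x (b i) (b (i + 1)) := by
  induction N with
  | zero => simp [dvn]
  | succ N ih =>
    rw [Finset.sum_range_succ]
    exact (dvn_add f l x (b 0) (b N) _).trans (add_le_add_left ih _)

omit [Fintype β] in
lemma CQ.tail_of_MH (h : CQ f g K) {R : ℤ} (hR : 1 ≤ R) {l ε θ : ℝ} (hl : 0 ≤ l) (hε : 0 < ε)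
    (hf : MH f R l ε θ) {s : ℕ} (hs : 1 ≤ ε * s) (hθ : 64 ^ s * θ ≤ 1) :
    ∃ C x : ℝ, 0 < C ∧ 0 < x ∧ x < 1 ∧ Tail f l (2 * (1 + K + l) * ε) C x := by
  lift R to ℕ using by omega
  have hR' : 0 < R := by omega
  have hK : (1 : ℝ) ≤ K := by exact_mod_cast h.one_le
  set x : ℝ := (1 / 4 : ℝ) ^ (1 / (R : ℝ)) with hx
  have hx0 : 0 < x := Real.rpow_pos_of_pos (by norm_num) _
  have hx1 : x < 1 := Real.rpow_lt_one (by norm_num) (by norm_num) (by positivity)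
  have hxR : x ^ R = 1 / 4 := by
    rw [hx, ← Real.rpow_natCast, ← Real.rpow_mul (by norm_num)]
    rw [one_div_mul_cancel (by positivity), Real.rpow_one]
  obtain ⟨r0, hr0⟩ := exists_nat_ge (R / ε)
  refine ⟨4 + 1 / x ^ r0, x, by positivity, hx0, hx1, fun r o k => ?_⟩
  rcases lt_or_ge r r0 with hrr | hrr
  · refine (pr_le_one _ _).trans ?_
    have h1 : x ^ r0 ≤ x ^ r := pow_le_pow_of_le_one hx0.le hx1.le hrr.le
    have h2 : 0 < x ^ r0 := by positivity
    rw [add_mul, div_mul_eq_mul_div, one_mul]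
    have : 1 ≤ x ^ r / x ^ r0 := (one_le_div h2).2 h1
    linarith [pow_pos hx0 r]
  set N := r / R with hN
  have hNr : N * R ≤ r := Nat.div_mul_le_self r R
  have hNr' : r ≤ N * R + R := by
    have := Nat.lt_div_mul_add hR' (a := r)
    rw [hN]; omega
  have hb := pr_bad_blocks_le (by omega) hf hθ o k (N := N) (t := k + r) (by
    have : ((N * R : ℕ) : ℤ) ≤ r := by exact_mod_cast hNr
    push_cast at this; omega)
  have hfin : (1 / 4 : ℝ) ^ N ≤ (4 + 1 / x ^ r0) * x ^ r := by
    have h1 : x ^ (N * R + R) ≤ x ^ r := pow_le_pow_of_le_one hx0.le hx1.le hNr'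
    rw [pow_add, mul_comm N R, pow_mul, hxR] at h1
    have h3 : 0 < 1 / x ^ r0 * x ^ r := by positivity
    nlinarith
  refine le_trans (pr_mono fun y _ hy => ?_) (hb.trans hfin)
  by_contra hcon
  set Bd := (Finset.range N).filter fun i : ℕ =>
      ε * (R : ℤ) < dvn f l y (k + i * (R : ℤ)) (k + (i + 1 : ℕ) * (R : ℤ)) with hBd
  have hcard : (Bd.card : ℝ) ≤ ε * N := by
    have h1 : s * Bd.card ≤ N := by
      by_contra hc
      exact hcon (le_trans (by omega) (le_of_eq (by rw [hBd])))
    have h2 : (s : ℝ) * Bd.card ≤ N := by exact_mod_cast h1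
    have h3 : (0 : ℝ) ≤ Bd.card := by positivity
    nlinarith [mul_le_mul_of_nonneg_left h2 hε.le, mul_le_mul_of_nonneg_right hs h3]
  have hsum : dvn f l y k (k + N * R) ≤ ε * R * N + Bd.card * ((K + l) * R) := by
    have h1 := dvn_le_sum f l y (fun i => k + i * (R : ℤ)) N
    simp only [Nat.cast_zero, zero_mul, add_zero] at h1
    refine h1.trans ?_
    have h2 : ∀ i ∈ Finset.range N, dvn f l y (k + i * (R : ℤ)) (k + (i + 1 : ℕ) * (R : ℤ)) ≤
        ε * R + if ε * (R : ℤ) < dvn f l y (k + i * (R : ℤ)) (k + (i + 1 : ℕ) * (R : ℤ)) then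
          (K + l) * R else 0 := by
      intro i _
      split_ifs with hi
      · have h3 := h.dvn_le hl y (r := k + i * (R : ℤ)) (s := k + (i + 1 : ℕ) * (R : ℤ)) (by
          push_cast; nlinarith)
        have h4 : ((k + (i + 1 : ℕ) * (R : ℤ) : ℤ) : ℝ) - ((k + i * (R : ℤ) : ℤ) : ℝ) = R := by
          push_cast; ring
        rw [h4] at h3
        have : 0 ≤ ε * R := by positivity
        linarith
      · push_cast at hi ⊢; linarith
    refine (Finset.sum_le_sum h2).trans (le_of_eq ?_)
    rw [Finset.sum_add_distrib, ← Finset.sum_filter, Finset.sum_const, Finset.sum_const,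
      Finset.card_range]
    simp only [nsmul_eq_mul]
    rw [← hBd]; ring
  have hlast := h.dvn_le hl y (r := k + N * R) (s := k + r) (by
    have : ((N * R : ℕ) : ℤ) ≤ r := by exact_mod_cast hNr
    push_cast at this; omega)
  have htot := dvn_add f l y k (k + N * R) (k + r)
  have hdev : dvn f l y k (k + r) = |pth f y (k + r) - pth f y k - l * r| := by
    unfold dvn; congr 2; push_cast; ring
  have hy' : 2 * (1 + K + l) * ε * r < |pth f y (k + r) - pth f y k - l * r| := by
    simpa using hy
  rw [← hdev] at hy'
  have c1 : (r : ℝ) ≤ N * R + R := by exact_mod_cast hNr'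
  have c2 : (N : ℝ) * R ≤ r := by exact_mod_cast hNr
  have c3 : (R : ℝ) ≤ ε * r := by
    have h3 : (r0 : ℝ) ≤ r := by exact_mod_cast hrr
    have := hr0.trans h3
    rw [div_le_iff₀ hε] at this; linarith
  push_cast at hlast
  have hKl : 0 ≤ (K : ℝ) + l := by linarith
  have c4 : (K + l) * ((k : ℝ) + r - (k + N * R)) ≤ (K + l) * (ε * r) :=
    mul_le_mul_of_nonneg_left (by linarith) hKl
  have c5 : (Bd.card : ℝ) * ((K + l) * R) ≤ ε * N * ((K + l) * R) :=
    mul_le_mul_of_nonneg_right hcard (by positivity)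
  have c6 : ε * (1 + K + l) * (N * R) ≤ ε * (1 + K + l) * r :=
    mul_le_mul_of_nonneg_left c2 (by positivity)
  have c7 : 0 ≤ ε * r := by positivity
  linarith

lemma CQ.exists_tail (h : CQ f g K) (hα : 2 ≤ Fintype.card α) (hβ : 2 ≤ Fintype.card β) {ε : ℝ}
    (hε : 0 < ε) :
    ∃ (f' : (ℤ →₀ α) × ℤ → (ℤ →₀ β) × ℤ) (g' : (ℤ →₀ β) × ℤ → (ℤ →₀ α) × ℤ) (C x : ℝ),
      CQ f' g' K ∧ 0 < C ∧ 0 < x ∧ x < 1 ∧ Tail f' (lam α β) ε C x := by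
  have hl := lam_pos hα hβ
  have hK : (1 : ℝ) ≤ K := by exact_mod_cast h.one_le
  set ε1 := min (ε / (2 * (1 + K + lam α β))) (lam α β / 4) with hε1
  have hε1' : 0 < ε1 := lt_min (by positivity) (by positivity)
  obtain ⟨s, hs⟩ := exists_nat_ge (1 / ε1)
  obtain ⟨f', g', R, h1, -, h2, h3⟩ := h.exists_MH hα hβ hε1' (by
    have := min_le_right (ε / (2 * (1 + K + lam α β))) (lam α β / 4)
    linarith) (θ := 1 / 64 ^ s) (by positivity) 1
  obtain ⟨C, x, hC, hx0, hx1, hT⟩ := h1.tail_of_MH h2 hl.le hε1' h3 (s := s)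
    (by rw [div_le_iff₀ hε1'] at hs; linarith) (by rw [mul_one_div, div_self (by positivity)])
  refine ⟨f', g', C, x, h1, hC, hx0, hx1, fun r o k => (pr_mono fun y _ hy => ?_).trans (hT r o k)⟩
  refine lt_of_le_of_lt (mul_le_mul_of_nonneg_right ?_ (by positivity)) hy
  have := min_le_left (ε / (2 * (1 + K + lam α β))) (lam α β / 4)
  rw [← hε1, le_div_iff₀ (by positivity)] at this
  linarith

end Tail

section Good

variable {α β : Type*} [Zero α] [Zero β]
variable {f : (ℤ →₀ α) × ℤ → (ℤ →₀ β) × ℤ} {g : (ℤ →₀ β) × ℤ → (ℤ →₀ α) × ℤ} {K : ℤ}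

/-- The path from `q` at level `k` to `c` deviates from speed `l` after some time between `M` and
`D`. -/
def far (f : (ℤ →₀ α) × ℤ → (ℤ →₀ β) × ℤ) (l ε : ℝ) (M D : ℕ) (k : ℤ) (q c : ℤ →₀ α) : Prop :=
  ∃ r : ℕ, r ∈ Finset.Ico M (D + 1) ∧
    ε * r < |pth f (q, c) (k + r) - pth f (q, c) k - l * r|

variable [Fintype α]

/-- Most paths upwards from `q` at level `k` keep speed `l`. -/
def upG (f : (ℤ →₀ α) × ℤ → (ℤ →₀ β) × ℤ) (l ε : ℝ) (M D : ℕ) (k : ℤ) (q : ℤ →₀ α) : Prop :=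
  pr (Bx q k (k + D)) (far f l ε M D k q) ≤ 1 / 8

lemma pr_sp_left (q : ℤ →₀ α) {k r l : ℤ} (hl : r ≤ l) (p : (ℤ →₀ α) → Prop) :
    pr (Bx q k l) (fun c => p (sp r c q)) = pr (Bx q k r) p := by
  have h := expect_sp_left q q (k := k) hl fun c => if p c then (1 : ℝ) else 0
  have e : sp r q q = q := by ext i; simp
  rw [e] at h
  exact h

lemma expect_pr_dev_le {l ε B : ℝ} {r : ℕ} (hf : MH f r l ε B) (o : ℤ →₀ α) (k : ℤ) {E D : ℕ}
    (hE : r ≤ E) (hD : r ≤ D) :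
    𝔼 q ∈ Bx o k (k + E), pr (Bx q k (k + D)) (fun c =>
      ε * r < |pth f (q, c) (k + r) - pth f (q, c) k - l * r|) ≤ B := by
  have h1 : ∀ q ∈ Bx o k (k + E), pr (Bx q k (k + D)) (fun c =>
      ε * r < |pth f (q, c) (k + r) - pth f (q, c) k - l * r|) = pr (Bx q k (k + r)) (fun c =>
      ε * r < |pth f (q, c) (k + r) - pth f (q, c) k - l * r|) := by
    intro q _
    refine Eq.trans ?_ (pr_sp_left q (l := k + D) (by omega) _)
    unfold pr
    refine Finset.expect_congr rfl fun c hc => ?_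
    have e1 : pth f (q, sp (k + r) c q) (k + r) = pth f (q, c) (k + r) :=
      pth_congr (by ext j; simp only [sp_apply]; split_ifs <;> rfl)
    have e2 : pth f (q, sp (k + r) c q) k = pth f (q, c) k :=
      pth_congr (by ext j; simp only [sp_apply]; split_ifs <;> first | rfl | omega)
    simp only [e1, e2]
  rw [Finset.expect_congr rfl h1, ← expect_resample o le_rfl (by omega : k + (r : ℤ) ≤ k + E)]
  refine Finset.expect_le (Bx_nonempty _ _ _) fun q _ => le_trans (le_of_eq ?_) (hf q k)
  unfold Bx2
  rw [pr_prod]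
  refine Finset.expect_congr rfl fun q' hq' => ?_
  rw [Bx_eq_of_mem hq']
  simp

/-- All but a small proportion of the bottoms are good, also when only the lower part of the bottom
is random. -/
lemma pr_not_upG_le {l ε C x : ℝ} (hf : Tail f l ε C x) (hC : 0 ≤ C) (hx0 : 0 < x) (hx1 : x < 1)
    (hα : 1 ≤ Fintype.card α) (o : ℤ →₀ α) (k : ℤ) {M E D : ℕ} (hED : E ≤ D) :
    pr (Bx o k (k + E)) (fun q => ¬ upG f l ε M D k q) ≤
      8 * (C / (1 - x)) * (x ^ M + (Fintype.card α : ℝ) ^ (D - E) * x ^ E) := by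
  set n : ℝ := (Fintype.card α : ℝ) with hn
  have hn1 : 1 ≤ n := by rw [hn]; exact_mod_cast hα
  have hx1' : 0 < 1 - x := by linarith
  set φ : ℕ → (ℤ →₀ α) → ℝ := fun r q => pr (Bx q k (k + D)) (fun c =>
      ε * r < |pth f (q, c) (k + r) - pth f (q, c) k - l * r|) with hφ
  have hφ0 : ∀ r q, 0 ≤ φ r q := fun r q => pr_nonneg _ _
  have h1 : ∀ r ∈ Finset.Ico M (D + 1), 𝔼 q ∈ Bx o k (k + E), φ r q ≤
      C * x ^ r + if E + 1 ≤ r then n ^ (D - E) * (C * x ^ r) else 0 := by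
    intro r hr
    have hr' := Finset.mem_Ico.1 hr
    have h0 : 0 ≤ C * x ^ r := by positivity
    rcases Nat.lt_or_ge E r with hEr | hEr
    · rw [if_pos (show E + 1 ≤ r from hEr)]
      have h2 : 𝔼 q ∈ Bx o k (k + E), φ r q ≤ n ^ (D - E) * 𝔼 q ∈ Bx o k (k + D), φ r q := by
        rw [Finset.expect_eq_sum_div_card, Finset.expect_eq_sum_div_card, card_Bx, card_Bx]
        have e1 : (k + (E : ℤ) - k).toNat = E := by omega
        have e2 : (k + (D : ℤ) - k).toNat = E + (D - E) := by omega
        rw [e1, e2]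
        push_cast
        rw [← hn, pow_add]
        have h3 : ∑ q ∈ Bx o k (k + E), φ r q ≤ ∑ q ∈ Bx o k (k + D), φ r q :=
          Finset.sum_le_sum_of_subset_of_nonneg
            (Bx_subset le_rfl (by omega) (self_mem_Bx _ _ _)) fun q _ _ => hφ0 r q
        rw [div_le_iff₀ (by positivity)]
        refine h3.trans (le_of_eq ?_)
        field_simp
      have h4 := expect_pr_dev_le (hf r) o k (E := D) (D := D) (by omega) (by omega)
      have := mul_le_mul_of_nonneg_left h4 (by positivity : (0 : ℝ) ≤ n ^ (D - E))
      linarith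
    · rw [if_neg (by omega), add_zero]
      exact expect_pr_dev_le (hf r) o k hEr (by omega)
  have h2 : 𝔼 q ∈ Bx o k (k + E), pr (Bx q k (k + D)) (far f l ε M D k q) ≤
      C / (1 - x) * (x ^ M + n ^ (D - E) * x ^ E) := by
    have h3 : 𝔼 q ∈ Bx o k (k + E), pr (Bx q k (k + D)) (far f l ε M D k q) ≤
        𝔼 q ∈ Bx o k (k + E), ∑ r ∈ Finset.Ico M (D + 1), φ r q :=
      Finset.expect_le_expect fun q _ => pr_exists_le _ _ _
    rw [Finset.expect_sum_comm] at h3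
    refine h3.trans ((Finset.sum_le_sum h1).trans ?_)
    rw [Finset.sum_add_distrib, ← Finset.mul_sum, ← Finset.sum_filter, ← Finset.mul_sum,
      ← Finset.mul_sum]
    have g1 := geom_sum_Ico_le_of_lt_one (m := M) (n := D + 1) hx0.le hx1
    have g2 : ∑ r ∈ (Finset.Ico M (D + 1)).filter (fun r => E + 1 ≤ r), x ^ r ≤ x ^ E / (1 - x) := by
      refine le_trans ?_ (geom_sum_Ico_le_of_lt_one (m := E) (n := D + 1) hx0.le hx1)
      refine Finset.sum_le_sum_of_subset_of_nonneg (fun r hr => ?_) fun r _ _ => by positivity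
      simp only [Finset.mem_filter, Finset.mem_Ico] at hr ⊢
      omega
    have g3 := mul_le_mul_of_nonneg_left g1 hC
    have g4 := mul_le_mul_of_nonneg_left g2 (mul_nonneg (by positivity : (0 : ℝ) ≤ n ^ (D - E)) hC)
    have e : C / (1 - x) * (x ^ M + n ^ (D - E) * x ^ E) =
        C * (x ^ M / (1 - x)) + n ^ (D - E) * C * (x ^ E / (1 - x)) := by ring
    rw [e]
    linarith
  have h5 := pr_markov (s := Bx o k (k + E)) (t := 1 / 8)
    (φ := fun q => pr (Bx q k (k + D)) (far f l ε M D k q)) (fun q _ => pr_nonneg _ _) (by norm_num) h2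
  refine (pr_mono fun q _ hq => ?_).trans (h5.trans (le_of_eq (by ring)))
  unfold upG at hq
  exact (not_le.1 hq).le

omit [Fintype α] in
lemma far_not {l ε : ℝ} {M D : ℕ} {k : ℤ} {q c : ℤ →₀ α} (h : ¬ far f l ε M D k q c) {r : ℕ}
    (h1 : M ≤ r) (h2 : r ≤ D) : |pth f (q, c) (k + r) - pth f (q, c) k - l * r| ≤ ε * r := by
  by_contra! hcon
  exact h ⟨r, Finset.mem_Ico.2 ⟨h1, by omega⟩, hcon⟩

omit [Fintype α] in
lemma CQ.far_low (h : CQ f g K) {l ε : ℝ} (hεl : ε ≤ l) {M D : ℕ} {k : ℤ} {q c : ℤ →₀ α}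
    (hfar : ¬ far f l ε M D k q c) {s : ℤ} (h1 : k ≤ s) (h2 : s ≤ k + D) :
    (f (sp k c q, k)).2 - K * M ≤ (f (sp s c q, s)).2 := by
  obtain ⟨r, rfl⟩ : ∃ r : ℕ, s = k + r := ⟨(s - k).toNat, by omega⟩
  have hK := h.one_le
  rcases le_or_gt M r with hM | hM
  · have h3 := (abs_le.1 (far_not hfar hM (by omega))).1
    have h4 : ε * r ≤ l * r := mul_le_mul_of_nonneg_right hεl (by positivity)
    have h5 : ((f (sp k c q, k)).2 : ℝ) ≤ (f (sp (k + r) c q, k + r)).2 := by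
      simp only [pth] at h3; linarith
    have h6 : (f (sp k c q, k)).2 ≤ (f (sp (k + r) c q, k + r)).2 := by exact_mod_cast h5
    have : 0 ≤ K * M := by positivity
    omega
  · have h3 := (abs_le.1 (h.path_lip c q (show k ≤ k + (r : ℤ) by omega))).1
    have : K * r ≤ K * M := mul_le_mul_of_nonneg_left (by omega) (by omega)
    have e : K * (k + (r : ℤ) - k) = K * r := by ring
    omega

omit [Fintype α] in
lemma CQ.far_high (h : CQ f g K) {l ε : ℝ} (hε : 0 ≤ ε) (hl : 0 ≤ l) {M D : ℕ} {k : ℤ}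
    {q c : ℤ →₀ α}
    (hfar : ¬ far f l ε M D k q c) {r R : ℕ} (h1 : r ≤ R) (h2 : R ≤ D) :
    ((f (sp (k + r) c q, k + r)).2 : ℝ) ≤ (f (sp k c q, k)).2 + K * M + (l + ε) * R := by
  have hK : (1 : ℝ) ≤ K := by exact_mod_cast h.one_le
  have hKM : (0 : ℝ) ≤ K * M := by positivity
  have h0 : (l + ε) * r ≤ (l + ε) * R :=
    mul_le_mul_of_nonneg_left (by exact_mod_cast h1) (by linarith)
  have h0' : 0 ≤ (l + ε) * R := by positivity
  rcases le_or_gt M r with hM | hM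
  · have h3 := (abs_le.1 (far_not hfar hM (by omega))).2
    simp only [pth] at h3; linarith
  · have h3 := (abs_le.1 (h.path_lip_real c q (show k ≤ k + (r : ℤ) by omega))).2
    have : (K : ℝ) * r ≤ K * M := mul_le_mul_of_nonneg_left (by exact_mod_cast hM.le) (by linarith)
    push_cast at h3
    linarith

end Good

section Cluster

variable {α β : Type*} [Zero α] [Zero β] [Fintype α] [Fintype β]
variable {f : (ℤ →₀ α) × ℤ → (ℤ →₀ β) × ℤ} {g : (ℤ →₀ β) × ℤ → (ℤ →₀ α) × ℤ} {K : ℤ}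

omit [Fintype β] in
lemma pr_not_far_pair {l ε : ℝ} {M D : ℕ} {k : ℤ} {q q' : ℤ →₀ α} (hq' : q' ∈ Bx q k (k + D))
    (h1 : upG f l ε M D k q) (h2 : upG f l ε M D k q') :
    3 / 4 ≤ pr (Bx q k (k + D)) fun c => ¬ (far f l ε M D k q c ∨ far f l ε M D k q' c) := by
  have e := pr_add_not (Bx_nonempty q k (k + D))
    fun c => (far f l ε M D k q c ∨ far f l ε M D k q' c)
  have e2 := pr_or_le (Bx q k (k + D)) (far f l ε M D k q) (far f l ε M D k q')
  unfold upG at h1 h2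
  rw [Bx_eq_of_mem hq'] at h2
  linarith

omit [Fintype β] in
/-- Two good bottoms under a common top give equal configurations below their heights. -/
lemma CQ.agree_below (h : CQ f g K) {l ε : ℝ} (hεl : ε ≤ l) {M D : ℕ} {k : ℤ} {q q' c : ℤ →₀ α}
    (hq' : q' ∈ Bx q k (k + D)) (hc : c ∈ Bx q k (k + D)) (h1 : ¬ far f l ε M D k q c)
    (h2 : ¬ far f l ε M D k q' c) {i : ℤ} (hi : i < (f (q, k)).2 - K * M - K)
    (hi' : i < (f (q', k)).2 - K * M - K) : (f (q, k)).1 i = (f (q', k)).1 i := by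
  have hk : k ≤ k + (D : ℤ) := by omega
  have hc' : c ∈ Bx q' k (k + D) := by rwa [Bx_eq_of_mem hq']
  have e1 : sp k c q = q := sp_bot (self_mem_Bx _ _ _) hc
  have e2 : sp k c q' = q' := sp_bot (self_mem_Bx _ _ _) hc'
  have e3 : sp (k + D) c q = c := sp_top (self_mem_Bx _ _ _) hc
  have e4 : sp (k + D) c q' = c := sp_top (self_mem_Bx _ _ _) hc'
  have a1 := walk_eq_below (γ := fun r => f (sp r c q, r)) (h.path c q) hk
    (v := (f (q, k)).2 - K * M) (fun r b1 b2 => by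
      have := h.far_low hεl h1 b1 b2; rwa [e1] at this) hi
  have a2 := walk_eq_below (γ := fun r => f (sp r c q', r)) (h.path c q') hk
    (v := (f (q', k)).2 - K * M) (fun r b1 b2 => by
      have := h.far_low hεl h2 b1 b2; rwa [e2] at this) hi'
  simp only [e1, e2, e3, e4] at a1 a2
  rw [← a1, a2]

/-- The bound on the difference of heights of two good bottoms. -/
lemma CQ.height_diff_le (h : CQ f g K) (hα : 1 < Fintype.card α) (hβ : 1 < Fintype.card β)
    {ε : ℝ} (hε : 0 < ε) (hεl : ε ≤ lam α β / 8) {M D : ℕ} (hMD : M ≤ D) {k : ℤ} {q q' : ℤ →₀ α}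
    (hq' : q' ∈ Bx q k (k + D))
    (h1 : upG f (lam α β) ε M D k q) (h2 : upG f (lam α β) ε M D k q') :
    ((f (q', k)).2 : ℝ) - (f (q, k)).2 ≤ lam α β * M + 2 * lam α β * (4 * K +
      (lam α β / 2 + 1 + 2 * K * (M + 1)) / lam α β +
      Real.log (4 / 3 * (16 * ε / Real.log (Fintype.card α) + 1)) /
        Real.log (Fintype.card α)) := by
  have hl := lam_pos hα hβ
  have hlog := log_card_pos hα
  have hrpow := card_rpow_lam hα hβ
  set l := lam α β with hldef
  set n : ℝ := (Fintype.card α : ℝ) with hn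
  set m : ℝ := (Fintype.card β : ℝ) with hm
  have hn1 : 1 < n := by rw [hn]; exact_mod_cast hα
  have hm1 : 1 < m := by rw [hm]; exact_mod_cast hβ
  have hK : (1 : ℝ) ≤ K := by exact_mod_cast h.one_le
  set u := (f (q, k)).2 with hu
  set u' := (f (q', k)).2 with hu'
  set t : ℝ := (u' : ℝ) - u with ht
  set R1 : ℝ := 4 / 3 * (16 * ε / Real.log n + 1) with hR1
  have hR1' : 1 ≤ R1 := by
    have : 0 ≤ 16 * ε / Real.log n := by positivity
    rw [hR1]; linarith
  have hlogR : 0 ≤ Real.log R1 / Real.log n := div_nonneg (Real.log_nonneg hR1') hlog.le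
  have hb0 : 0 ≤ (l / 2 + 1 + 2 * K * (M + 1)) / l := by positivity
  have hbr : 0 ≤ 2 * l * (4 * K + (l / 2 + 1 + 2 * K * (M + 1)) / l +
      Real.log R1 / Real.log n) := by positivity
  rcases le_or_gt t 0 with ht0 | ht0
  · have : 0 ≤ l * M := by positivity
    linarith
  have hB := pr_not_far_pair hq' h1 h2
  have hcmem : ∀ c ∈ Bx q k (k + D), sp k c q = q ∧ sp (k + D) c q = c ∧ sp k c q' = q' ∧
      sp (k + D) c q' = c := fun c hc => by
    have hc' : c ∈ Bx q' k (k + D) := by rwa [Bx_eq_of_mem hq']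
    exact ⟨sp_bot (self_mem_Bx _ _ _) hc, sp_top (self_mem_Bx _ _ _) hc,
      sp_bot (self_mem_Bx _ _ _) hc', sp_top (self_mem_Bx _ _ _) hc'⟩
  obtain ⟨c0, hc0, hc0'⟩ := exists_of_pr_pos (lt_of_lt_of_le (by norm_num) hB)
  push Not at hc0'
  have htD : t ≤ 2 * ε * D := by
    obtain ⟨e1, e2, e3, e4⟩ := hcmem c0 hc0
    have a1 := (abs_le.1 (far_not hc0'.1 hMD le_rfl)).1
    have a2 := (abs_le.1 (far_not hc0'.2 hMD le_rfl)).2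
    have a3 := (abs_le.1 (far_not hc0'.1 hMD le_rfl)).2
    have a4 := (abs_le.1 (far_not hc0'.2 hMD le_rfl)).1
    simp only [pth, e1, e2, e3, e4] at a1 a2 a3 a4
    rw [ht]; linarith
  obtain ⟨r, hr⟩ : ∃ r : ℕ, r = ⌈2 * t / l⌉₊ := ⟨_, rfl⟩
  have hr1 : 2 * t / l ≤ r := by rw [hr]; exact Nat.le_ceil _
  have hr2 : (r : ℝ) < 2 * t / l + 1 := by rw [hr]; exact Nat.ceil_lt_add_one (by positivity)
  have hr1' : 2 * t ≤ l * r := by rw [div_le_iff₀ hl] at hr1; linarith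
  have hr2' : l * r ≤ 2 * t + l := by
    have := mul_le_mul_of_nonneg_left hr2.le hl.le
    have e : l * (2 * t / l + 1) = 2 * t + l := by field_simp
    linarith
  have hrD : r ≤ D := by
    rw [hr]; refine Nat.ceil_le.2 ?_
    rw [div_le_iff₀ hl]
    have : ε * D ≤ l / 8 * D := mul_le_mul_of_nonneg_right hεl (by positivity)
    have : 0 ≤ l * D := by positivity
    linarith
  rcases lt_or_ge r M with hrM | hrM
  · have : l * r ≤ l * M := mul_le_mul_of_nonneg_left (by exact_mod_cast hrM.le) hl.le
    linarith
  have hεr : ε * r ≤ l / 8 * r := mul_le_mul_of_nonneg_right hεl (by positivity)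
  have hlr : 0 ≤ l * r := by positivity
  set lo : ℤ := u' - K * M - K with hlo
  set hi : ℤ := ⌈u + (l + ε) * r⌉ + K * M + K with hhi
  set A0 := sp lo (f (q', k)).1 (f (q, k)).1 with hA0
  set p : (ℤ →₀ α) → Prop := fun a => ⌈u + (l - ε) * r⌉ ≤ (f (a, k + r)).2 ∧
    (f (a, k + r)).2 ≤ ⌊u + (l + ε) * r⌋ ∧
    ∀ j, j < lo ∨ hi ≤ j → (f (a, k + r)).1 j = A0 j with hp
  have hlohi : lo ≤ hi := by
    have h3 : (u' : ℝ) ≤ ⌈u + (l + ε) * r⌉ := by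
      refine le_trans ?_ (Int.le_ceil _)
      have : 0 ≤ ε * r := by positivity
      have : (l + ε) * r = l * r + ε * r := by ring
      linarith
    have h4 : u' ≤ ⌈u + (l + ε) * r⌉ := by exact_mod_cast h3
    have : 0 ≤ K * M := mul_nonneg (by linarith [h.one_le]) (by positivity)
    have := h.one_le
    omega
  have hprob : 3 / 4 ≤ pr (Bx q k (k + r)) p := by
    rw [← pr_sp_left q (l := k + D) (by omega) p]
    refine hB.trans (pr_mono fun c hc hfar => ?_)
    push Not at hfar
    obtain ⟨e1, e2, e3, e4⟩ := hcmem c hc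
    have a1 := abs_le.1 (far_not hfar.1 hrM hrD)
    simp only [pth, e1] at a1
    refine ⟨Int.ceil_le.2 ?_, Int.le_floor.2 ?_, fun j hj => ?_⟩
    · linarith [a1.1]
    · linarith [a1.2]
    · rcases hj with hj | hj
      · rw [hA0, sp_apply, if_pos hj]
        have b1 := walk_eq_below (γ := fun r => f (sp r c q, r)) (h.path c q)
          (show k + (r : ℤ) ≤ k + D by omega) (v := u') (fun s s1 s2 => by
            obtain ⟨s', rfl⟩ : ∃ s' : ℕ, s = k + s' := ⟨(s - k).toNat, by omega⟩
            have b2 := (abs_le.1 (far_not hfar.1 (r := s') (by omega) (by omega))).1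
            simp only [pth, e1] at b2
            have b3 : (l - ε) * r ≤ (l - ε) * s' :=
              mul_le_mul_of_nonneg_left (by exact_mod_cast (by omega : r ≤ s')) (by linarith)
            have b4 : (u' : ℝ) ≤ (f (sp (k + s') c q, k + s')).2 := by linarith
            exact_mod_cast b4) (i := j) (by
            have : 0 ≤ K * M := mul_nonneg (by linarith [h.one_le]) (by positivity)
            omega)
        have b2 := walk_eq_below (γ := fun r => f (sp r c q', r)) (h.path c q')
          (show k ≤ k + (D : ℤ) by omega) (v := u' - K * M) (fun s s1 s2 => by
            have := h.far_low (by linarith) hfar.2 s1 s2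
            rwa [e3] at this) hj
        simp only [e2, e3, e4] at b1 b2
        rw [← b1, b2]
      · rw [hA0, sp_apply, if_neg (by omega)]
        have b1 := walk_eq_above (γ := fun r => f (sp r c q, r)) (h.path c q)
          (show k ≤ k + (r : ℤ) by omega) (v := ⌈u + (l + ε) * r⌉ + K * M) (fun s s1 s2 => by
            obtain ⟨s', rfl⟩ : ∃ s' : ℕ, s = k + s' := ⟨(s - k).toNat, by omega⟩
            have b2 := h.far_high hε.le hl.le hfar.1 (r := s') (R := r) (by omega) hrD
            rw [e1] at b2
            have b3 := Int.le_ceil ((u : ℝ) + (l + ε) * r)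
            have b4 : ((f (sp (k + s') c q, k + s')).2 : ℝ) ≤
              ((⌈u + (l + ε) * r⌉ + K * M : ℤ) : ℝ) := by push_cast; linarith
            exact_mod_cast b4) hj
        simp only [e1] at b1
        exact b1
  have hcard := h.count (S := (Bx q k (k + r)).filter p) (i := k + r)
    (h1 := ⌈u + (l - ε) * r⌉) (h2 := ⌊u + (l + ε) * r⌋) (lo := lo) (hi := hi) (A0 := A0)
    fun a ha => (Finset.mem_filter.1 ha).2
  rw [pr_eq_card_div, card_Bx] at hprob
  rw [show (k + (r : ℤ) - k).toNat = r by omega] at hprob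
  push_cast at hprob
  rw [← hn, le_div_iff₀ (by positivity)] at hprob
  have hcard' : (((Bx q k (k + r)).filter p).card : ℝ) ≤ n ^ (4 * K).toNat *
      ((⌊u + (l + ε) * r⌋ + 1 - ⌈u + (l - ε) * r⌉).toNat * m ^ (hi - lo).toNat) := by
    rw [hn, hm]; exact_mod_cast hcard
  have w1 : ((⌊u + (l + ε) * r⌋ + 1 - ⌈u + (l - ε) * r⌉).toNat : ℝ) ≤ 2 * ε * r + 1 := by
    have b1 := Int.floor_le ((u : ℝ) + (l + ε) * r)
    have b2 := Int.le_ceil ((u : ℝ) + (l - ε) * r)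
    rw [← Int.cast_natCast, Int.toNat_eq_max, Int.cast_max]
    refine max_le ?_ (by simp only [Int.cast_zero]; positivity)
    push_cast; linarith
  have w2 : m ^ (hi - lo).toNat ≤ n ^ (5 / 8 * r + (l / 2 + 1 + 2 * K * (M + 1)) / l) := by
    rw [← hrpow, ← Real.rpow_natCast]
    refine Real.rpow_le_rpow_of_exponent_le hm1.le ?_
    rw [← Int.cast_natCast, Int.toNat_of_nonneg (by omega)]
    have b1 := Int.ceil_lt_add_one ((u : ℝ) + (l + ε) * r)
    have e : l * (5 / 8 * r + (l / 2 + 1 + 2 * K * (M + 1)) / l) =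
      5 / 8 * (l * r) + (l / 2 + 1 + 2 * K * (M + 1)) := by field_simp
    rw [e, hhi, hlo]; push_cast
    linarith
  have w3 : 4 / 3 * (2 * ε * r + 1) ≤ R1 * n ^ ((1 : ℝ) / 8 * r) := by
    have b1 := Real.add_one_le_exp (Real.log n * (1 / 8 * r))
    rw [← Real.rpow_def_of_pos (by linarith)] at b1
    have b2 := mul_le_mul_of_nonneg_left b1 (by linarith : 0 ≤ R1)
    refine le_trans ?_ b2
    rw [hR1]
    have e : 4 / 3 * (16 * ε / Real.log n + 1) * (Real.log n * (1 / 8 * r) + 1) =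
      4 / 3 * (2 * ε * r + 1) + 4 / 3 * (16 * ε / Real.log n + Real.log n * (1 / 8 * r)) := by
        field_simp; ring
    rw [e]
    have : 0 ≤ 4 / 3 * (16 * ε / Real.log n + Real.log n * (1 / 8 * r)) := by positivity
    linarith
  set b : ℝ := (l / 2 + 1 + 2 * K * (M + 1)) / l with hb
  have w4 : n ^ (r : ℝ) ≤ n ^ (4 * (K : ℝ)) * (R1 * n ^ ((1 : ℝ) / 8 * r)) *
      n ^ (5 / 8 * (r : ℝ) + b) := by
    have e4 : n ^ (4 * K).toNat = n ^ (4 * (K : ℝ)) := by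
      rw [← Real.rpow_natCast, ← Int.cast_natCast, Int.toNat_of_nonneg (by linarith [h.one_le])]
      push_cast; rfl
    rw [e4] at hcard'
    rw [Real.rpow_natCast]
    have p1 : 0 ≤ n ^ (4 * (K : ℝ)) := by positivity
    calc n ^ r ≤ 4 / 3 * (n ^ (4 * (K : ℝ)) * ((2 * ε * r + 1) *
          n ^ (5 / 8 * (r : ℝ) + b))) := by
          have := mul_le_mul w1 w2 (by positivity) (by positivity)
          have := hcard'.trans (mul_le_mul_of_nonneg_left this p1)
          have := hprob.trans (le_trans (le_of_eq (by congr!)) this)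
          linarith
      _ = n ^ (4 * (K : ℝ)) * (4 / 3 * (2 * ε * r + 1)) * n ^ (5 / 8 * (r : ℝ) + b) := by ring
      _ ≤ _ := by gcongr
  have w5 := Real.log_le_log (by positivity) w4
  have hnpos : 0 < n := by linarith
  rw [Real.log_mul (by positivity) (by positivity), Real.log_mul (by positivity) (by positivity),
    Real.log_mul (by positivity) (by positivity), Real.log_rpow hnpos, Real.log_rpow hnpos,
    Real.log_rpow hnpos, Real.log_rpow hnpos] at w5
  have w6 : (1 / 4 : ℝ) * r ≤ 4 * K + b + Real.log R1 / Real.log n := by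
    have e : (4 * K + b + Real.log R1 / Real.log n) =
      (4 * K * Real.log n + b * Real.log n + Real.log R1) / Real.log n := by field_simp
    rw [e, le_div_iff₀ hlog]
    linarith
  have w7 := mul_le_mul_of_nonneg_left w6 (by positivity : (0 : ℝ) ≤ 2 * l)
  have : 0 ≤ l * M := by positivity
  linarith

/-- Good bottoms of a box have nearly the same height and nearly the same configuration below. -/
lemma CQ.exists_cluster (K : ℤ) (hα : 1 < Fintype.card α) (hβ : 1 < Fintype.card β)
    {ε : ℝ} (hε : 0 < ε) (hεl : ε ≤ lam α β / 8) :
    ∃ T1 T2 : ℕ, ∀ (f : (ℤ →₀ α) × ℤ → (ℤ →₀ β) × ℤ) (g : (ℤ →₀ β) × ℤ → (ℤ →₀ α) × ℤ),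
      CQ f g K → ∀ M D : ℕ, M ≤ D → ∀ (k : ℤ) (q q' : ℤ →₀ α), q' ∈ Bx q k (k + D) →
      upG f (lam α β) ε M D k q → upG f (lam α β) ε M D k q' →
      |(f (q, k)).2 - (f (q', k)).2| ≤ T1 + T2 * M ∧
      ∀ i, i < (f (q, k)).2 - (T1 + T2 * M) → (f (q, k)).1 i = (f (q', k)).1 i := by
  have hl := lam_pos hα hβ
  obtain ⟨a, ha⟩ := exists_nat_ge (2 * lam α β * (4 * K + (lam α β / 2 + 1 + 2 * K) / lam α β +
      Real.log (4 / 3 * (16 * ε / Real.log (Fintype.card α) + 1)) /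
        Real.log (Fintype.card α)) + K)
  obtain ⟨b, hb⟩ := exists_nat_ge (lam α β + 2 * lam α β * (2 * K / lam α β) + K)
  refine ⟨a, b, fun f g h M D hMD k q q' hq' h1 h2 => ?_⟩
  have hq : q ∈ Bx q' k (k + D) := mem_Bx_comm.1 hq'
  have hK : (1 : ℝ) ≤ K := by exact_mod_cast h.one_le
  have key : ∀ x : ℝ, x ≤ lam α β * M + 2 * lam α β * (4 * K +
      (lam α β / 2 + 1 + 2 * K * (M + 1)) / lam α β +
      Real.log (4 / 3 * (16 * ε / Real.log (Fintype.card α) + 1)) /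
        Real.log (Fintype.card α)) → x + K * M + K ≤ a + b * M := by
    intro x hx
    have e : lam α β * M + 2 * lam α β * (4 * K +
      (lam α β / 2 + 1 + 2 * K * (M + 1)) / lam α β +
      Real.log (4 / 3 * (16 * ε / Real.log (Fintype.card α) + 1)) /
        Real.log (Fintype.card α)) = 2 * lam α β * (4 * K + (lam α β / 2 + 1 + 2 * K) / lam α β +
      Real.log (4 / 3 * (16 * ε / Real.log (Fintype.card α) + 1)) /
        Real.log (Fintype.card α)) + (lam α β + 2 * lam α β * (2 * K / lam α β)) * M := by
      field_simp; ring
    have := mul_le_mul_of_nonneg_right hb (by positivity : (0 : ℝ) ≤ M)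
    linarith
  have g1 := key _ (h.height_diff_le hα hβ hε hεl hMD hq' h1 h2)
  have g2 := key _ (h.height_diff_le hα hβ hε hεl hMD hq h2 h1)
  have g1' : (f (q', k)).2 - (f (q, k)).2 + K * M + K ≤ (a : ℤ) + b * M := by exact_mod_cast g1
  have g2' : (f (q, k)).2 - (f (q', k)).2 + K * M + K ≤ (a : ℤ) + b * M := by exact_mod_cast g2
  have hKM : 0 ≤ K * M := mul_nonneg (by linarith [h.one_le]) (by positivity)
  have hK1 := h.one_le
  obtain ⟨c, hc, hc'⟩ := exists_of_pr_pos (lt_of_lt_of_le (by norm_num) (pr_not_far_pair hq' h1 h2))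
  push Not at hc'
  refine ⟨abs_le.2 ⟨by linarith, by linarith⟩, fun i hi => ?_⟩
  exact h.agree_below (by linarith) hq' hc hc'.1 hc'.2 (by linarith) (by linarith)

end Cluster

lemma card_window_le {S : Finset ℤ} {c r : ℝ} (hr : 0 ≤ r) (hS : ∀ j ∈ S, |(j : ℝ) - c| ≤ r) :
    (S.card : ℝ) ≤ 2 * r + 1 := by
  have h1 : S ⊆ Finset.Icc ⌈c - r⌉ ⌊c + r⌋ := fun j hj => by
    have := abs_le.1 (hS j hj)
    exact Finset.mem_Icc.2 ⟨Int.ceil_le.2 (by linarith), Int.le_floor.2 (by linarith)⟩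
  have h2 : (S.card : ℝ) ≤ ((⌊c + r⌋ + 1 - ⌈c - r⌉).toNat : ℝ) := by
    have := Finset.card_le_card h1
    rw [Int.card_Icc] at this
    exact_mod_cast this
  refine h2.trans ?_
  have b1 := Int.floor_le (c + r)
  have b2 := Int.le_ceil (c - r)
  rw [← Int.cast_natCast, Int.toNat_eq_max, Int.cast_max]
  refine max_le ?_ (by simp only [Int.cast_zero]; positivity)
  push_cast; linarith

section Crossing

variable {α β : Type*} [Zero α] [Zero β] [Fintype α] [Fintype β]
variable {f : (ℤ →₀ α) × ℤ → (ℤ →₀ β) × ℤ} {g : (ℤ →₀ β) × ℤ → (ℤ →₀ α) × ℤ} {K : ℤ}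

omit [Fintype α] in
/-- A pulled-back walk from a given point meets a given set of tops with small probability. -/
lemma CQ.pr_upw_mem_le (h : CQ f g K) (p : (ℤ →₀ α) × ℤ) (Z : Finset ((ℤ →₀ α) × ℤ)) {i ℓ : ℤ}
    (hil : i ≤ ℓ) :
    pr (Bx (f p).1 (f p).2 ((f p).2 + ℓ)) (fun d => upw f g p d i ∈ Z) ≤
      (Fintype.card β : ℝ) ^ (4 * K).toNat * Z.card / (Fintype.card β : ℝ) ^ i.toNat := by
  have h1 := pr_sp_left (f p).1 (k := (f p).2) (r := (f p).2 + i) (l := (f p).2 + ℓ) (by omega)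
    (fun e => g (e, (f p).2 + i) ∈ Z)
  unfold upw
  rw [h1, pr_eq_card_div, card_Bx, show ((f p).2 + i - (f p).2).toNat = i.toNat by congr 1; omega]
  push_cast
  refine div_le_div_of_nonneg_right ?_ (by positivity)
  set S := (Bx (f p).1 (f p).2 ((f p).2 + i)).filter fun e => g (e, (f p).2 + i) ∈ Z
  have h2 := Finset.card_le_mul_card_image (f := fun a => g (a, (f p).2 + i)) S
    (Fintype.card β ^ (4 * K).toNat) fun y _ => h.symm.card_fibre_le _ y S
  have h3 : (S.image fun a => g (a, (f p).2 + i)).card ≤ Z.card := by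
    refine Finset.card_le_card fun z hz => ?_
    obtain ⟨a, ha, rfl⟩ := Finset.mem_image.1 hz
    exact (Finset.mem_filter.1 ha).2
  have h4 : (S.card : ℝ) ≤ (Fintype.card β : ℝ) ^ (4 * K).toNat * Z.card := by
    exact_mod_cast h2.trans (Nat.mul_le_mul_left _ h3)
  exact le_trans (le_of_eq (by congr!)) h4

/-- Pulled-back upward walks that are unlikely to leave a box except through its good tops force
the box to be high. -/
lemma CQ.crossing (h : CQ f g K) (hβ : 1 ≤ Fintype.card β) {o : ℤ →₀ α} {k L τ : ℤ}
    {GB GT : (ℤ →₀ α) → Prop} {hw U T S v θ : ℝ} (hT : 0 ≤ T) (hS : 0 ≤ S)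
    (hGB : ∀ b ∈ Bx o k L, GB b → ((f (b, k)).2 : ℝ) ≤ hw + T)
    (hGT : ∀ b ∈ Bx o k L, GT b → |((f (b, L)).2 : ℝ) - U| ≤ T)
    (hP : 3 / 4 ≤ pr (Bx o k L) fun a => |((f (a, k + τ)).2 : ℝ) - v| ≤ S)
    (hv : hw + T + K * K + K < v - S) (hτ : 2 * K ≤ τ) (hτ' : k + τ ≤ L - 2 * K)
    (hB : pr (Bx o k L) (fun b => ¬ GB b) ≤ θ) (hB' : pr (Bx o k L) (fun b => ¬ GT b) ≤ θ)
    (hθ : walkC α β K * (2 * (K + 1) * θ) * (2 * (S + K) + 1) ≤ 1 / 4) :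
    (Fintype.card β : ℝ) ^ (U - v - (T + K * K + K + S)) ≤
      2 * ((2 * (T + K * K + K + S) + 1) * (K + 1) * (Fintype.card β : ℝ) ^ (4 * K).toNat *
        (Fintype.card α : ℝ) ^ (L - k).toNat) := by
  have hK1 := h.one_le
  have hK : (1 : ℝ) ≤ K := by exact_mod_cast h.one_le
  set m : ℝ := (Fintype.card β : ℝ) with hm
  set n : ℝ := (Fintype.card α : ℝ) with hn
  set R : ℝ := T + K * K + K + S with hR
  have hR0 : 0 ≤ R := by positivity
  have hm1 : 1 ≤ m := by rw [hm]; exact_mod_cast hβ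
  have hcardB : ((Bx o k L).card : ℝ) = n ^ (L - k).toNat := by rw [card_Bx, hn]; push_cast; rfl
  have hcardBpos : (0 : ℝ) < (Bx o k L).card := by exact_mod_cast card_Bx_pos o k L
  obtain ⟨B, hBd⟩ := ((Bx o k L ×ˢ Finset.Icc k L).image fun z => |(f z).2|).exists_le
  have hBd' : ∀ b ∈ Bx o k L, ∀ s, k ≤ s → s ≤ L → |(f (b, s)).2| ≤ B := fun b hb s h1 h2 =>
    hBd _ (Finset.mem_image_of_mem _ (Finset.mem_product.2 ⟨hb, Finset.mem_Icc.2 ⟨h1, h2⟩⟩))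
  have hB0 : 0 ≤ B := (abs_nonneg _).trans (hBd' o (self_mem_Bx _ _ _) k le_rfl (by omega))
  set ℓ : ℤ := 2 * B + K + 1 with hℓ
  have hit : ∀ a ∈ Bx o k L, ∀ d ∈ Bx (f (a, k + τ)).1 (f (a, k + τ)).2 ((f (a, k + τ)).2 + ℓ),
      ∃ j ∈ Finset.Icc 0 ℓ, upw f g (a, k + τ) d j ∈ bdry o k L K := by
    intro a ha d hd
    by_contra! hno
    obtain ⟨h1, h2, h3⟩ := h.walk_stay (p := (a, k + τ)) ha (by simp only; omega)
      (by simp only; omega) hd (i := ℓ) (by omega)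
      fun j hj1 hj2 => hno j (Finset.mem_Icc.2 ⟨hj1, hj2⟩)
    have h4 := h.f_upw (a, k + τ) d ℓ
    have h4' : |(f (upw f g (a, k + τ) d ℓ)).2 - ((f (a, k + τ)).2 + ℓ)| ≤ K := by
      exact_mod_cast h4
    have h5 := abs_le.1 (hBd' _ h1 _ (by omega : k ≤ (upw f g (a, k + τ) d ℓ).2) (by omega))
    have h6 := abs_le.1 (hBd' a ha (k + τ) (by omega) (by omega))
    have h7 := abs_le.1 h4'
    have : (upw f g (a, k + τ) d ℓ) =
      ((upw f g (a, k + τ) d ℓ).1, (upw f g (a, k + τ) d ℓ).2) := rfl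
    rw [← this] at h5
    omega
  set Zb : Finset ((ℤ →₀ α) × ℤ) := ((Bx o k L).filter fun b => ¬ GB b) ×ˢ Finset.Icc k (k + K) ∪
    ((Bx o k L).filter fun b => ¬ GT b) ×ˢ Finset.Icc (L - K) L with hZb
  set Zt : Finset ((ℤ →₀ α) × ℤ) := Bx o k L ×ˢ Finset.Icc (L - K) L with hZt
  have hbadcard : ∀ G : (ℤ →₀ α) → Prop, pr (Bx o k L) (fun b => ¬ G b) ≤ θ →
      (((Bx o k L).filter fun b => ¬ G b).card : ℝ) ≤ θ * (Bx o k L).card := by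
    intro G hG
    rw [pr_eq_card_div, div_le_iff₀ hcardBpos] at hG
    exact le_trans (le_of_eq (by congr!)) hG
  have hZbc : (Zb.card : ℝ) ≤ 2 * (K + 1) * θ * (Bx o k L).card := by
    have e1 : (Zb.card : ℝ) ≤ ((((Bx o k L).filter fun b => ¬ GB b).card * (K + 1).toNat +
        ((Bx o k L).filter fun b => ¬ GT b).card * (K + 1).toNat : ℕ) : ℝ) := by
      have := Finset.card_union_le (((Bx o k L).filter fun b => ¬ GB b) ×ˢ Finset.Icc k (k + K))
        (((Bx o k L).filter fun b => ¬ GT b) ×ˢ Finset.Icc (L - K) L)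
      rw [Finset.card_product, Finset.card_product, Int.card_Icc, Int.card_Icc,
        show k + K + 1 - k = K + 1 by ring, show L + 1 - (L - K) = K + 1 by ring] at this
      exact_mod_cast this
    have e2 : (((K + 1).toNat : ℕ) : ℝ) = K + 1 := by
      rw [← Int.cast_natCast, Int.toNat_of_nonneg (by omega)]; push_cast; rfl
    push_cast at e1
    rw [e2] at e1
    have a1 := mul_le_mul_of_nonneg_right (hbadcard GB hB) (by linarith : (0 : ℝ) ≤ K + 1)
    have a2 := mul_le_mul_of_nonneg_right (hbadcard GT hB') (by linarith : (0 : ℝ) ≤ K + 1)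
    linarith
  have hZtc : (Zt.card : ℝ) ≤ (K + 1) * n ^ (L - k).toNat := by
    rw [hZt, Finset.card_product, Int.card_Icc, show L + 1 - (L - K) = K + 1 by ring]
    push_cast
    rw [hcardB, ← Int.cast_natCast, Int.toNat_of_nonneg (by omega)]
    push_cast
    exact le_of_eq (by ring)
  set Pa := (Bx o k L).filter fun a => |((f (a, k + τ)).2 : ℝ) - v| ≤ S with hPa
  have hPacard : 3 / 4 * ((Bx o k L).card : ℝ) ≤ Pa.card := by
    rw [pr_eq_card_div, le_div_iff₀ hcardBpos] at hP
    exact hP.trans (le_of_eq (by congr!))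
  set P : Finset ((ℤ →₀ α) × ℤ) := Pa.image fun a => (a, k + τ) with hPdef
  have hPcard : P.card = Pa.card := Finset.card_image_of_injective _ (Prod.mk_left_injective _)
  set Zj : ℤ → Finset ((ℤ →₀ α) × ℤ) := fun j =>
    Zb.filter fun z => |(j : ℝ) - ((f z).2 - v)| ≤ S + K with hZj
  set PB : (ℤ →₀ α) × ℤ → ℝ := fun p => pr (Bx (f p).1 (f p).2 ((f p).2 + ℓ))
    (fun d => ∃ j ∈ Finset.Icc 0 ℓ, upw f g p d j ∈ Zj j) with hPB
  have hsum : ∑ p ∈ P, PB p ≤ 1 / 4 * (Bx o k L).card := by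
    have a1 : ∑ p ∈ P, PB p ≤ ∑ p ∈ P, ∑ j ∈ Finset.Icc 0 ℓ,
        pr (Bx (f p).1 (f p).2 ((f p).2 + ℓ)) (fun d => upw f g p d j ∈ Zj j) :=
      Finset.sum_le_sum fun p _ => pr_exists_le _ _ _
    rw [Finset.sum_comm] at a1
    have a2 : ∑ j ∈ Finset.Icc 0 ℓ, ∑ p ∈ P,
        pr (Bx (f p).1 (f p).2 ((f p).2 + ℓ)) (fun d => upw f g p d j ∈ Zj j) ≤
        ∑ j ∈ Finset.Icc 0 ℓ, (walkC α β K : ℝ) * (Zj j).card :=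
      Finset.sum_le_sum fun j hj =>
        h.walk_count P (Zj j) (Finset.mem_Icc.1 hj).1 (Finset.mem_Icc.1 hj).2
    rw [← Finset.mul_sum] at a2
    have a3 : ∑ j ∈ Finset.Icc 0 ℓ, ((Zj j).card : ℝ) ≤ (2 * (S + K) + 1) * Zb.card := by
      have e : ∑ j ∈ Finset.Icc 0 ℓ, (Zj j).card = ∑ z ∈ Zb, ((Finset.Icc 0 ℓ).filter fun j : ℤ =>
          |(j : ℝ) - ((f z).2 - v)| ≤ S + K).card := by
        simp only [hZj, Finset.card_filter]
        rw [Finset.sum_comm]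
      have e' : ∑ j ∈ Finset.Icc 0 ℓ, ((Zj j).card : ℝ) = ∑ z ∈ Zb,
          (((Finset.Icc 0 ℓ).filter fun j : ℤ =>
          |(j : ℝ) - ((f z).2 - v)| ≤ S + K).card : ℝ) := by exact_mod_cast e
      rw [e']
      refine (Finset.sum_le_card_nsmul _ _ (2 * (S + K) + 1) fun z _ =>
        card_window_le (by linarith) fun j hj => (Finset.mem_filter.1 hj).2).trans
        (le_of_eq ?_)
      rw [nsmul_eq_mul]; ring
    have hwc : (0 : ℝ) ≤ walkC α β K := by positivity
    have b1 := mul_le_mul_of_nonneg_left a3 hwc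
    have b2 := mul_le_mul_of_nonneg_left hZbc
      (mul_nonneg hwc (by linarith : (0 : ℝ) ≤ 2 * (S + K) + 1))
    have b3 := mul_le_mul_of_nonneg_right hθ hcardBpos.le
    refine a1.trans (a2.trans (b1.trans ?_))
    refine le_trans (le_of_eq (by ring)) (b2.trans (le_trans (le_of_eq (by ring)) b3))
  obtain ⟨p, hp, hpB⟩ : ∃ p ∈ P, PB p ≤ 1 / 3 := by
    by_contra! hcon
    have hne : P.Nonempty := by
      rw [← Finset.card_pos, hPcard]
      have : (0 : ℝ) < Pa.card := by linarith
      exact_mod_cast this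
    have b1 := Finset.sum_lt_sum_of_nonempty hne hcon
    rw [Finset.sum_const, nsmul_eq_mul, hPcard] at b1
    linarith
  obtain ⟨a, ha, rfl⟩ := Finset.mem_image.1 hp
  obtain ⟨haB, haS⟩ := Finset.mem_filter.1 ha
  set D := Bx (f (a, k + τ)).1 (f (a, k + τ)).2 ((f (a, k + τ)).2 + ℓ) with hD
  set Jw := (Finset.Icc 0 ℓ).filter fun j : ℤ => |(j : ℝ) - (U - v)| ≤ R with hJw
  have hcov : ∀ d ∈ D, ¬ (∃ j ∈ Finset.Icc 0 ℓ, upw f g (a, k + τ) d j ∈ Zj j) →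
      ∃ j ∈ Jw, upw f g (a, k + τ) d j ∈ Zt := by
    intro d hd hnb
    obtain ⟨j, hj, hz⟩ := hit a haB d hd
    set z := upw f g (a, k + τ) d j with hzdef
    have hfu := abs_le.1 (h.f_upw (a, k + τ) d j)
    rw [← hzdef] at hfu
    have haS' := abs_le.1 haS
    have hznb : z ∉ Zb := fun hzb => hnb ⟨j, hj, by
      rw [hZj]; refine Finset.mem_filter.2 ⟨hzb, abs_le.2 ⟨?_, ?_⟩⟩ <;> linarith [hfu.1, hfu.2]⟩
    obtain ⟨hz1, hz2⟩ := Finset.mem_product.1 hz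
    rw [hZb, Finset.mem_union, Finset.mem_product, Finset.mem_product, Finset.mem_filter,
      Finset.mem_filter] at hznb
    push Not at hznb
    have hj0 : (0 : ℝ) ≤ j := by exact_mod_cast (Finset.mem_Icc.1 hj).1
    rcases Finset.mem_union.1 hz2 with hz2 | hz2
    · exfalso
      have hg : GB z.1 := by
        by_contra hg; exact hznb.1 ⟨hz1, hg⟩ hz2
      have b1 := hGB _ hz1 hg
      have b2 := Finset.mem_Icc.1 hz2
      have b3 := (abs_le.1 (h.vert_lip z.1 b2.1)).2
      have b4 : K * (z.2 - k) ≤ K * K := mul_le_mul_of_nonneg_left (by omega) (by omega)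
      have b5 : (K : ℝ) * (z.2 - k) ≤ K * K := by exact_mod_cast b4
      linarith [hfu.1]
    · have hg : GT z.1 := by
        by_contra hg; exact hznb.2 ⟨hz1, hg⟩ hz2
      refine ⟨j, ?_, Finset.mem_product.2 ⟨hz1, hz2⟩⟩
      have b1 := abs_le.1 (hGT _ hz1 hg)
      have b2 := Finset.mem_Icc.1 hz2
      have b3 : K * (L - z.2) ≤ K * K := mul_le_mul_of_nonneg_left (by omega) (by omega)
      have b4 : (K : ℝ) * (L - z.2) ≤ K * K := by exact_mod_cast b3
      have b5 := abs_le.1 ((h.vert_lip z.1 b2.2).trans b4)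
      refine Finset.mem_filter.2 ⟨hj, abs_le.2 ⟨?_, ?_⟩⟩ <;>
          linarith [b1.1, b1.2, b5.1, b5.2, hfu.1, hfu.2]
  have hprob : 2 / 3 ≤ pr D fun d => ∃ j ∈ Jw, upw f g (a, k + τ) d j ∈ Zt := by
    have e1 := pr_add_not (Bx_nonempty (f (a, k + τ)).1 (f (a, k + τ)).2 ((f (a, k + τ)).2 + ℓ))
      fun d => ∃ j ∈ Finset.Icc 0 ℓ, upw f g (a, k + τ) d j ∈ Zj j
    have e2 := pr_mono hcov
    rw [← hD] at e1
    rw [hPB] at hpB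
    linarith
  have hmpos : 0 < m ^ (U - v - R) := by positivity
  have hlast : 2 / 3 ≤ (2 * R + 1) *
      (m ^ (4 * K).toNat * ((K + 1) * n ^ (L - k).toNat) / m ^ (U - v - R)) := by
    refine hprob.trans ((pr_exists_le _ _ _).trans ?_)
    have e1 : ∀ j ∈ Jw, pr D (fun d => upw f g (a, k + τ) d j ∈ Zt) ≤
        m ^ (4 * K).toNat * ((K + 1) * n ^ (L - k).toNat) / m ^ (U - v - R) := by
      intro j hj
      obtain ⟨hj1, hj2⟩ := Finset.mem_filter.1 hj
      obtain ⟨hj3, hj4⟩ := Finset.mem_Icc.1 hj1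
      refine (h.pr_upw_mem_le (a, k + τ) Zt hj4).trans ?_
      have e2 : m ^ (U - v - R) ≤ m ^ j.toNat := by
        rw [← Real.rpow_natCast, ← Int.cast_natCast, Int.toNat_of_nonneg hj3]
        exact Real.rpow_le_rpow_of_exponent_le hm1 (by linarith [(abs_le.1 hj2).1])
      have e3 : m ^ (4 * K).toNat * Zt.card ≤ m ^ (4 * K).toNat * ((K + 1) * n ^ (L - k).toNat) :=
        mul_le_mul_of_nonneg_left hZtc (by positivity)
      exact div_le_div₀ (le_trans (by positivity) e3) e3 hmpos e2
    refine (Finset.sum_le_card_nsmul _ _ _ e1).trans ?_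
    rw [nsmul_eq_mul]
    refine mul_le_mul_of_nonneg_right
      (card_window_le hR0 fun j hj => (Finset.mem_filter.1 hj).2) ?_
    have : (0 : ℝ) ≤ K + 1 := by linarith
    positivity
  rw [← mul_div_assoc, le_div_iff₀ hmpos] at hlast
  have : 0 ≤ (2 * R + 1) * (m ^ (4 * K).toNat * ((K + 1) * n ^ (L - k).toNat)) := by
    have : (0 : ℝ) ≤ K + 1 := by linarith
    positivity
  linarith

end Crossing

lemma exists_succ_mul_pow_le {x δ : ℝ} (hx0 : 0 ≤ x) (hx1 : x < 1) (hδ : 0 < δ) :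
    ∃ M : ℕ, (M + 1) * x ^ M ≤ δ := by
  have h1 := tendsto_self_mul_const_pow_of_lt_one hx0 hx1
  have h2 := tendsto_pow_atTop_nhds_zero_of_lt_one hx0 hx1
  have h3 := h1.add h2
  simp only [add_zero] at h3
  obtain ⟨M, hM⟩ := ((h3.eventually (gt_mem_nhds hδ)).exists)
  exact ⟨M, by rw [add_mul, one_mul]; exact hM.le⟩

section Down

variable {α β : Type*} [Zero α] [Zero β] [Fintype α]
variable {f : (ℤ →₀ α) × ℤ → (ℤ →₀ β) × ℤ} {g : (ℤ →₀ β) × ℤ → (ℤ →₀ α) × ℤ} {K : ℤ}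

/-- Most paths downwards from `c` at level `k` keep speed `l`. -/
def downG (f : (ℤ →₀ α) × ℤ → (ℤ →₀ β) × ℤ) (l ε : ℝ) (M D : ℕ) (k : ℤ) (c : ℤ →₀ α) : Prop :=
  upG (fun p => rho (f (rho p))) l ε M D (-k) (rev c)

lemma pr_not_downG_le [Fintype β] {l ε C x : ℝ} (hf : Tail f l ε C x) (hC : 0 ≤ C) (hx0 : 0 < x)
    (hx1 : x < 1) (hα : 1 ≤ Fintype.card α) (o : ℤ →₀ α) (k : ℤ) {M E D : ℕ} (hED : E ≤ D) :
    pr (Bx o (k - E) k) (fun c => ¬ downG f l ε M D k c) ≤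
      8 * (C / (1 - x)) * (x ^ M + (Fintype.card α : ℝ) ^ (D - E) * x ^ E) := by
  have h1 : Tail (fun p => rho (f (rho p))) l ε C x := fun r => (hf r).rho
  have h2 := pr_not_upG_le h1 hC hx0 hx1 hα (rev o) (-k) (M := M) hED
  refine le_trans (le_of_eq ?_) h2
  have h3 := expect_Bx_rev o (k - E) k
    fun c => if ¬ upG (fun p => rho (f (rho p))) l ε M D (-k) c then (1 : ℝ) else 0
  rw [show -(k - (E : ℤ)) = -k + E by ring] at h3
  unfold pr downG
  convert h3

/-- Most points of a level of a box lie at the expected height. -/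
lemma pr_level_le {l ε θ T H0 : ℝ} {M D : ℕ} {k : ℤ} {o : ℤ →₀ α} {τ : ℕ} (hMτ : M ≤ τ)
    (hτD : τ ≤ D) (hθ : θ ≤ 1 / 8) (hB : pr (Bx o k (k + D)) (fun q => ¬ upG f l ε M D k q) ≤ θ)
    (hT : ∀ q ∈ Bx o k (k + D), upG f l ε M D k q → |((f (q, k)).2 : ℝ) - H0| ≤ T) :
    3 / 4 ≤ pr (Bx o k (k + D)) fun a => |((f (a, k + τ)).2 : ℝ) - (H0 + l * τ)| ≤ T + ε * τ := by
  have h1 := expect_level o (k := k) (l := k + D) (r := k + τ) (by omega)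
    fun a => if |((f (a, k + τ)).2 : ℝ) - (H0 + l * τ)| ≤ T + ε * τ then (1 : ℝ) else 0
  unfold pr
  rw [← h1]
  unfold Bx2
  rw [Finset.expect_product]
  have h2 := pr_add_not (Bx_nonempty o k (k + D)) (upG f l ε M D k)
  have h3 : 𝔼 q ∈ Bx o k (k + D), 7 / 8 * (if upG f l ε M D k q then (1 : ℝ) else 0) ≤
      𝔼 q ∈ Bx o k (k + D), 𝔼 c ∈ Bx o k (k + D),
        if |((f (sp (k + τ) c q, k + τ)).2 : ℝ) - (H0 + l * τ)| ≤ T + ε * τ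
          then (1 : ℝ) else 0 := by
    refine Finset.expect_le_expect fun q hq => ?_
    split_ifs with hg
    · have e1 := pr_add_not (Bx_nonempty q k (k + D)) (far f l ε M D k q)
      have e2 : pr (Bx q k (k + D)) (fun c => ¬ far f l ε M D k q c) ≤
          pr (Bx q k (k + D)) fun c =>
            |((f (sp (k + τ) c q, k + τ)).2 : ℝ) - (H0 + l * τ)| ≤ T + ε * τ := by
        refine pr_mono fun c hc hfar => ?_
        have b1 := abs_le.1 (far_not hfar hMτ hτD)
        have b2 := abs_le.1 (hT q hq hg)
        simp only [pth, sp_bot (self_mem_Bx _ _ _) hc] at b1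
        exact abs_le.2 ⟨by linarith [b1.1, b2.1], by linarith [b1.2, b2.2]⟩
      rw [Bx_eq_of_mem hq] at e1 e2
      unfold upG at hg
      rw [Bx_eq_of_mem hq] at hg
      unfold pr at e1 e2 hg
      linarith
    · rw [mul_zero]
      exact Finset.expect_nonneg fun x _ => by split_ifs <;> norm_num
  rw [← Finset.mul_expect] at h3
  refine le_trans ?_ h3
  unfold pr at h2 hB
  linarith

/-- A bottom which is good at two consecutive levels. -/
lemma exists_upG_pair {l ε θ : ℝ} {M D : ℕ} {k : ℤ} {w w' : ℤ →₀ α} (hw' : w' ∈ Bx w k (k + 1))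
    (hθ : (Fintype.card α + 1) * θ < 1)
    (hB : pr (Bx w k (k + (D + 1 : ℕ))) (fun q => ¬ upG f l ε M (D + 1) k q) ≤ θ)
    (hB' : pr (Bx w' (k + 1) (k + 1 + D)) (fun q => ¬ upG f l ε M D (k + 1) q) ≤ θ) :
    ∃ q ∈ Bx w' (k + 1) (k + 1 + D), upG f l ε M (D + 1) k q ∧ upG f l ε M D (k + 1) q := by
  have hn : 0 < (Fintype.card α : ℝ) := by exact_mod_cast Fintype.card_pos
  have h1 : pr (Bx w' (k + 1) (k + 1 + D)) (fun q => ¬ upG f l ε M (D + 1) k q) ≤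
      Fintype.card α * θ := by
    refine le_trans ?_ (mul_le_mul_of_nonneg_left hB hn.le)
    rw [pr_eq_card_div, pr_eq_card_div, card_Bx, card_Bx,
      show (k + 1 + (D : ℤ) - (k + 1)).toNat = D by omega,
      show (k + ((D + 1 : ℕ) : ℤ) - k).toNat = D + 1 by omega]
    push_cast
    rw [pow_succ, ← mul_div_assoc, div_le_div_iff₀ (by positivity) (by positivity)]
    have h2 : (((Bx w' (k + 1) (k + 1 + D)).filter
        fun q => ¬ upG f l ε M (D + 1) k q).card : ℝ) ≤
        ((Bx w k (k + (D + 1 : ℕ))).filter fun q => ¬ upG f l ε M (D + 1) k q).card := by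
      have h3 : Bx w' (k + 1) (k + 1 + D) ⊆ Bx w k (k + (D + 1 : ℕ)) :=
        Bx_subset (by omega) (by push_cast; omega)
          (Bx_subset le_rfl (by push_cast; omega) (self_mem_Bx _ _ _) hw')
      exact_mod_cast Finset.card_le_card (Finset.filter_subset_filter _ h3)
    have := mul_le_mul_of_nonneg_right h2
      (by positivity : 0 ≤ (Fintype.card α : ℝ) ^ D * Fintype.card α)
    push_cast at this
    have e' : ∀ X p : ℝ, X * (p * Fintype.card α) = (Fintype.card α * X) * p := fun X p => by ring
    convert this.trans_eq (e' _ _)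
  have h2 := pr_or_le (Bx w' (k + 1) (k + 1 + D)) (fun q => ¬ upG f l ε M (D + 1) k q)
    fun q => ¬ upG f l ε M D (k + 1) q
  obtain ⟨q, hq, hq'⟩ := exists_not_of_pr_lt (Bx_nonempty _ _ _)
    (lt_of_le_of_lt h2 (by linarith : _ < (1 : ℝ)))
  push Not at hq'
  exact ⟨q, hq, hq'⟩

end Down

section Scale

variable {α β : Type*} [Zero α] [Zero β] [Fintype α] [Fintype β]
variable {f : (ℤ →₀ α) × ℤ → (ℤ →₀ β) × ℤ} {g : (ℤ →₀ β) × ℤ → (ℤ →₀ α) × ℤ} {K : ℤ}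

/-- Constants for which good bottoms and tops are abundant and have nearby images. -/
structure Scale (f : (ℤ →₀ α) × ℤ → (ℤ →₀ β) × ℤ) (K : ℤ) (M τ T : ℕ) (θ : ℝ) : Prop where
  up : ∀ (D : ℕ) (k : ℤ) (q q' : ℤ →₀ α), M ≤ D → q' ∈ Bx q k (k + D) →
    upG f (lam α β) (lam α β / 8) M D k q → upG f (lam α β) (lam α β / 8) M D k q' →
    |(f (q, k)).2 - (f (q', k)).2| ≤ T ∧
      ∀ i, i < (f (q, k)).2 - T → (f (q, k)).1 i = (f (q', k)).1 i
  down : ∀ (D : ℕ) (k : ℤ) (c c' : ℤ →₀ α), M ≤ D → c' ∈ Bx c (k - D) k →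
    downG f (lam α β) (lam α β / 8) M D k c → downG f (lam α β) (lam α β / 8) M D k c' →
    |(f (c, k)).2 - (f (c', k)).2| ≤ T ∧
      ∀ i, (f (c, k)).2 + T ≤ i → (f (c, k)).1 i = (f (c', k)).1 i
  θ_le : θ ≤ 1 / 8
  θ_lt : (Fintype.card α + 1) * θ < 1
  cross : walkC α β K * (2 * (K + 1) * θ) * (2 * (T + lam α β / 8 * τ + K) + 1) ≤ 1 / 4
  M_le : M ≤ τ
  K_le : 2 * K ≤ τ
  speed : 2 * T + K * K + K < 7 / 8 * (lam α β * τ)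
  pr_up : ∀ (D : ℕ) (o : ℤ →₀ α) (k : ℤ), M ≤ D →
    pr (Bx o k (k + D)) (fun q => ¬ upG f (lam α β) (lam α β / 8) M D k q) ≤ θ
  pr_down : ∀ J : ℕ, ∃ H : ℕ, J + M ≤ H ∧ J + τ + 2 * K ≤ H ∧ ∀ j : ℕ, j ≤ J → ∀ o : ℤ →₀ α,
    pr (Bx o j H) (fun c => ¬ downG f (lam α β) (lam α β / 8) M H H c) ≤ θ

set_option maxHeartbeats 800000 in
lemma CQ.exists_scale (h : CQ f g K) (hα : 2 ≤ Fintype.card α) (hβ : 2 ≤ Fintype.card β)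
    {C x : ℝ} (hC : 0 < C) (hx0 : 0 < x) (hx1 : x < 1)
    (hf : Tail f (lam α β) (lam α β / 8) C x) :
    ∃ (M τ T : ℕ) (θ : ℝ), Scale f K M τ T θ := by
  have hl := lam_pos hα hβ
  have hx1' : 0 < 1 - x := by linarith
  obtain ⟨T1, T2, hT⟩ := CQ.exists_cluster (α := α) (β := β) K hα hβ (ε := lam α β / 8)
    (by positivity) le_rfl
  have hK1 := h.one_le
  have hK : (1 : ℝ) ≤ K := by exact_mod_cast h.one_le
  obtain ⟨k0, rfl⟩ : ∃ k0 : ℕ, K = k0 := ⟨K.toNat, by omega⟩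
  obtain ⟨a, ha⟩ := exists_nat_gt ((2 * (T1 + T2) + k0 * k0 + k0 : ℝ) / (7 / 8 * lam α β))
  rw [div_lt_iff₀ (by positivity)] at ha
  set b : ℕ := a + 2 * k0 + 1 with hb
  set n : ℝ := (Fintype.card α : ℝ) with hn
  have hn1 : 1 ≤ n := by rw [hn]; exact_mod_cast (by omega : 1 ≤ Fintype.card α)
  set C' : ℝ := C / (1 - x) with hC'
  have hC'0 : 0 < C' := by positivity
  set s : ℝ := T1 + T2 + lam α β / 8 * b + k0 + 1 with hs
  have hs0 : 0 < s := by positivity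
  obtain ⟨W, hW0, hW⟩ : ∃ W : ℝ, 0 ≤ W ∧ (walkC α β (k0 : ℤ) : ℝ) = W := ⟨_, by positivity, rfl⟩
  set Z : ℝ := 128 * C' + 32 * (n + 1) * C' +
    256 * (W * ((k0 + 1) * C' * s)) with hZ
  have hZ0 : 0 < Z := by positivity
  obtain ⟨M, hM⟩ := exists_succ_mul_pow_le hx0.le hx1 (by positivity : 0 < 1 / Z)
  rw [le_div_iff₀ hZ0] at hM
  have hxM : 0 < x ^ M := by positivity
  set P : ℝ := (M + 1) * x ^ M with hP
  have hP0 : 0 < P := by positivity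
  have hxP : x ^ M ≤ P := by
    rw [hP]; nlinarith [(by positivity : (0 : ℝ) ≤ M)]
  have hw0 : (0 : ℝ) ≤ W * ((k0 + 1) * C' * s) := by positivity
  have hM1 : P * (128 * C') ≤ 1 := by
    refine le_trans (mul_le_mul_of_nonneg_left ?_ hP0.le) hM
    rw [hZ]; have : 0 ≤ 32 * (n + 1) * C' := by positivity
    linarith
  have hM2 : P * (32 * (n + 1) * C') ≤ 1 := by
    refine le_trans (mul_le_mul_of_nonneg_left ?_ hP0.le) hM
    rw [hZ]; linarith
  have hM3 : P * (256 * (W * ((k0 + 1) * C' * s))) ≤ 1 := by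
    refine le_trans (mul_le_mul_of_nonneg_left ?_ hP0.le) hM
    rw [hZ]; have : 0 ≤ 32 * (n + 1) * C' := by positivity
    linarith
  have hbM : b ≤ b * (M + 1) := Nat.le_mul_of_pos_right _ (by omega)
  have hMb : M ≤ b * (M + 1) := le_trans (by omega) (Nat.le_mul_of_pos_left (M + 1) (by omega))
  have hCM : 16 * C' * x ^ M ≤ 16 * C' * P := mul_le_mul_of_nonneg_left hxP (by positivity)
  refine ⟨M, b * (M + 1), T1 + T2 * M, 16 * C' * x ^ M, ?_, ?_, ?_, ?_, ?_, ?_, ?_, ?_, ?_, ?_⟩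
  · intro D k q q' hMD hq h1 h2
    have := hT f g h M D hMD k q q' hq h1 h2
    push_cast
    exact this
  · intro D k c c' hMD hc h1 h2
    have hq : rev c' ∈ Bx (rev c) (-k) (-k + D) := by
      rw [show -k + (D : ℤ) = -(k - D) by ring]; exact rev_mem_Bx.2 hc
    have := hT _ _ h.rho_right.rho_left M D hMD (-k) (rev c) (rev c') hq h1 h2
    simp only [rho, rev_rev, neg_neg] at this
    push_cast
    refine ⟨?_, fun i hi => ?_⟩
    · rw [abs_le] at *; constructor <;> linarith [this.1.1, this.1.2]
    · have := this.2 (-1 - i) (by omega)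
      simpa using this
  · linarith
  · nlinarith
  · rw [hW]
    push_cast
    have e1 : 2 * ((T1 + T2 * M : ℝ) + lam α β / 8 * (b * (M + 1)) + k0) + 1 ≤
        2 * s * (M + 1) := by
      rw [hs]
      have : (0 : ℝ) ≤ T1 * M := by positivity
      have : (0 : ℝ) ≤ k0 * M := by positivity
      have : (0 : ℝ) ≤ T2 := by positivity
      have : (0 : ℝ) ≤ M := by positivity
      nlinarith
    refine le_trans (mul_le_mul_of_nonneg_left e1 (by positivity)) ?_
    have e2 : W * (2 * (k0 + 1) * (16 * C' * x ^ M)) * (2 * s * (M + 1)) =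
        P * (256 * (W * ((k0 + 1) * C' * s))) / 4 := by
      rw [hP]; ring
    rw [e2]
    linarith
  · exact hMb
  · push_cast
    exact_mod_cast (by omega : 2 * k0 ≤ b * (M + 1))
  · push_cast
    have e1 : (a : ℝ) * (7 / 8 * lam α β) ≤ b * (7 / 8 * lam α β) := by
      refine mul_le_mul_of_nonneg_right ?_ (by positivity)
      exact_mod_cast (by omega : a ≤ b)
    have e2 : (2 * (T1 + T2) + k0 * k0 + k0 : ℝ) * (M + 1) <
        b * (7 / 8 * lam α β) * (M + 1) :=
      mul_lt_mul_of_pos_right (by linarith) (by positivity)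
    have : (0 : ℝ) ≤ T1 * M := by positivity
    have : (0 : ℝ) ≤ k0 * k0 * M := by positivity
    have : (0 : ℝ) ≤ k0 * M := by positivity
    nlinarith
  · intro D o k hMD
    refine (pr_not_upG_le hf hC.le hx0 hx1 (by omega) o k (le_refl D)).trans ?_
    have := pow_le_pow_of_le_one hx0.le hx1.le hMD
    rw [Nat.sub_self, pow_zero, one_mul]
    have := mul_le_mul_of_nonneg_left this hC'0.le
    linarith
  · intro J
    obtain ⟨N0, hN0⟩ := exists_pow_lt_of_lt_one (by positivity : 0 < 1 / n ^ J) hx1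
    refine ⟨J + M + (N0 + b * (M + 1) + 2 * k0), by omega, by push_cast; omega, fun j hj o => ?_⟩
    set H : ℕ := J + M + (N0 + b * (M + 1) + 2 * k0) with hH
    have e := pr_not_downG_le hf hC.le hx0 hx1 (by omega) o H (M := M) (Nat.sub_le H j)
    rw [show (H : ℤ) - (H - j : ℕ) = j by omega, show H - (H - j) = j by omega] at e
    refine e.trans ?_
    have e1 : n ^ j * x ^ (H - j) ≤ x ^ M := by
      have e2 : x ^ (H - j) ≤ x ^ (N0 + M) := pow_le_pow_of_le_one hx0.le hx1.le (by omega)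
      have e3 : n ^ j ≤ n ^ J := pow_le_pow_right₀ hn1 hj
      have e4 : n ^ J * x ^ N0 ≤ 1 := by
        rw [lt_div_iff₀ (by positivity)] at hN0; linarith
      calc n ^ j * x ^ (H - j) ≤ n ^ J * x ^ (N0 + M) := by gcongr
        _ = n ^ J * x ^ N0 * x ^ M := by ring
        _ ≤ 1 * x ^ M := mul_le_mul_of_nonneg_right e4 hxM.le
        _ = x ^ M := one_mul _
    have := mul_le_mul_of_nonneg_left e1 hC'0.le
    linarith

end Scale

section Tree

variable {α β : Type*} [Zero α] [Zero β] [Fintype α] [Fintype β]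
variable {f : (ℤ →₀ α) × ℤ → (ℤ →₀ β) × ℤ} {g : (ℤ →₀ β) × ℤ → (ℤ →₀ α) × ℤ} {K : ℤ}
variable {M τ T : ℕ} {θ : ℝ}

/-- The image of a good bottom is not much lower than expected. -/
lemma Scale.height_ge (s : Scale f K M τ T θ) (h : CQ f g K) (hα : 2 ≤ Fintype.card α)
    (hβ : 2 ≤ Fintype.card β) {R : ℝ} (hR : R = T + K * K + K + (T + lam α β / 8 * τ))
    {o q : ℤ →₀ α} {j H D : ℕ} {U : ℝ} (hjH : j + D = H) (hMD : M ≤ D) (hD : τ + 2 * K ≤ D)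
    (hq : q ∈ Bx o j H) (hgq : upG f (lam α β) (lam α β / 8) M D j q)
    (hU : ∀ b ∈ Bx o j H, downG f (lam α β) (lam α β / 8) M H H b →
      |((f (b, (H : ℤ))).2 : ℝ) - U| ≤ T)
    (hB : pr (Bx o j H) (fun c => ¬ downG f (lam α β) (lam α β / 8) M H H c) ≤ θ) :
    U - lam α β * D - (lam α β * τ + R + Real.logb (Fintype.card β)
      (2 * ((2 * R + 1) * (K + 1) * (Fintype.card β : ℝ) ^ (4 * K).toNat))) ≤ (f (q, (j : ℤ))).2 := by
  have hl := lam_pos (α := α) (β := β) hα hβ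
  have hK1 := h.one_le
  have hK : (1 : ℝ) ≤ K := by exact_mod_cast h.one_le
  have hm1 : (1 : ℝ) < Fintype.card β := by exact_mod_cast (by omega : 1 < Fintype.card β)
  have hn0 : (0 : ℝ) < Fintype.card α := by exact_mod_cast (by omega : 0 < Fintype.card α)
  have hR0 : 0 ≤ R := by rw [hR]; positivity
  have hHj : (H : ℤ) = j + D := by omega
  have hup := s.pr_up D o j hMD
  rw [← hHj] at hup
  have hclu : ∀ b ∈ Bx o j H, upG f (lam α β) (lam α β / 8) M D j b →
      |((f (b, (j : ℤ))).2 : ℝ) - (f (q, (j : ℤ))).2| ≤ T := by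
    intro b hb hgb
    have h1 := (s.up D j b q hMD (by rw [← hHj, Bx_eq_of_mem hb]; exact hq) hgb hgq).1
    exact_mod_cast h1
  have hlev := pr_level_le (f := f) (l := lam α β) (ε := lam α β / 8) (θ := θ) (T := T)
    (H0 := (f (q, (j : ℤ))).2) (M := M) (D := D) (k := (j : ℤ)) (o := o) (τ := τ) s.M_le
    (by omega) s.θ_le (by rw [← hHj]; exact hup) (by rw [← hHj]; exact hclu)
  rw [← hHj] at hlev
  have hcr := h.crossing (by omega) (o := o) (k := (j : ℤ)) (L := (H : ℤ)) (τ := (τ : ℤ))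
    (GB := upG f (lam α β) (lam α β / 8) M D j)
    (GT := downG f (lam α β) (lam α β / 8) M H H)
    (hw := (f (q, (j : ℤ))).2) (U := U) (T := T) (S := T + lam α β / 8 * τ)
    (v := (f (q, (j : ℤ))).2 + lam α β * τ) (θ := θ) (by positivity) (by positivity)
    (fun b hb hg => by linarith [(abs_le.1 (hclu b hb hg)).2]) hU hlev
    (by linarith [s.speed]) s.K_le (by omega) hup hB s.cross
  rw [← hR, show ((H : ℤ) - j).toNat = D by omega, ← Real.rpow_natCast _ D,
    ← card_rpow_lam hα hβ, ← mul_assoc 2] at hcr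
  have hQ : (0 : ℝ) < 2 * ((2 * R + 1) * (K + 1) * (Fintype.card β : ℝ) ^ (4 * K).toNat) := by
    positivity
  have h3 := Real.logb_le_logb_of_le hm1 (by positivity) hcr
  rw [Real.logb_rpow (by linarith) hm1.ne'] at h3
  have h4 : Real.logb (Fintype.card β) (2 * ((2 * R + 1) * (K + 1) *
      (Fintype.card β : ℝ) ^ (4 * K).toNat) * (Fintype.card β : ℝ) ^ (lam α β * (D : ℝ))) =
      Real.logb (Fintype.card β) (2 * ((2 * R + 1) * (K + 1) *
        (Fintype.card β : ℝ) ^ (4 * K).toNat)) + lam α β * D := by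
    rw [Real.logb_mul hQ.ne' (by positivity), Real.logb_rpow (by linarith) hm1.ne']
  have h5 := h3.trans (le_of_eq h4)
  linarith

/-- Images of good bottoms of neighbouring boxes agree far below. -/
lemma Scale.child (s : Scale f K M τ T θ) (h : CQ f g K) {w w' q q' : ℤ →₀ α} {k : ℤ} {D : ℕ}
    (hMD : M ≤ D) (hw' : w' ∈ Bx w k (k + 1)) (hq : q ∈ Bx w k (k + (D + 1 : ℕ)))
    (hq' : q' ∈ Bx w' (k + 1) (k + 1 + D)) (hg : upG f (lam α β) (lam α β / 8) M (D + 1) k q)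
    (hg' : upG f (lam α β) (lam α β / 8) M D (k + 1) q') {i : ℤ}
    (hi : i < (f (q, k)).2 - 2 * T - 2 * K) : (f (q', k + 1)).1 i = (f (q, k)).1 i := by
  obtain ⟨p, hp, hp1, hp2⟩ := exists_upG_pair hw' s.θ_lt (s.pr_up (D + 1) w k (by omega))
    (s.pr_up D w' (k + 1) hMD)
  have hpw : p ∈ Bx w k (k + (D + 1 : ℕ)) :=
    Bx_subset (by omega) (by push_cast; omega)
      (Bx_subset le_rfl (by push_cast; omega) (self_mem_Bx _ _ _) hw') hp
  have h1 := s.up (D + 1) k q p (by omega) (by rw [Bx_eq_of_mem hq]; exact hpw) hg hp1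
  have h2 := s.up D (k + 1) p q' hMD (by rw [Bx_eq_of_mem hp]; exact hq') hp2 hg'
  have h3 := h.vert p k
  have h4 := h3.symm.snd_le
  have h5 := h3.snd_le
  have h6 := abs_le.1 h1.1
  have := h.one_le
  rw [h1.2 i (by omega), h3.eq_below (by omega), h2.2 i (by omega)]

/-- Paths upwards from a good bottom see the same image configuration below. -/
lemma Scale.card_le (s : Scale f K M τ T θ) (h : CQ f g K) (hα : 2 ≤ Fintype.card α)
    (hβ : 2 ≤ Fintype.card β) {j H D : ℕ} {v : ℤ} {cT : ℤ →₀ α} {y : ℤ →₀ β} (hjH : j + D = H)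
    (hMH : M ≤ H) (hgT : downG f (lam α β) (lam α β / 8) M H H cT)
    (hB : ∀ o, pr (Bx o j H) (fun c => ¬ downG f (lam α β) (lam α β / 8) M H H c) ≤ θ)
    (hcT : cT ∈ Bx 0 0 H)
    {q : (ℤ →₀ α) → (ℤ →₀ α)} (hq : ∀ w, q w ∈ Bx w j H)
    (hgq : ∀ w, upG f (lam α β) (lam α β / 8) M D j (q w)) {W : Finset (ℤ →₀ α)}
    (hW : ∀ w ∈ W, w ∈ Bx 0 0 j ∧ (∀ i < v, (f (q w, (j : ℤ))).1 i = y i) ∧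
      v ≤ (f (q w, (j : ℤ))).2 - K * M - K) :
    (W.card : ℝ) * (Fintype.card α : ℝ) ^ D ≤ 2 * ((Fintype.card α : ℝ) ^ (4 * K).toNat *
      ((2 * T + 1) * (Fintype.card β : ℝ) ^ ((f (cT, (H : ℤ))).2 + T - v).toNat)) := by
  have hl := lam_pos (α := α) (β := β) hα hβ
  have hHj : (H : ℤ) = j + D := by omega
  set G : (ℤ →₀ α) → Finset (ℤ →₀ α) := fun w => (Bx w j H).filter fun c =>
    ¬ (¬ downG f (lam α β) (lam α β / 8) M H H c ∨
      far f (lam α β) (lam α β / 8) M D j (q w) c) with hG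
  have hn0 : (0 : ℝ) < Fintype.card α := by exact_mod_cast (by omega : 0 < Fintype.card α)
  have hcard : ∀ w, (Fintype.card α : ℝ) ^ D ≤ 2 * (G w).card := by
    intro w
    have h1 := pr_add_not (Bx_nonempty w j H) fun c =>
      ¬ downG f (lam α β) (lam α β / 8) M H H c ∨ far f (lam α β) (lam α β / 8) M D j (q w) c
    have h2 := pr_or_le (Bx w j H) (fun c => ¬ downG f (lam α β) (lam α β / 8) M H H c)
      (far f (lam α β) (lam α β / 8) M D j (q w))
    have h3 := hgq w
    unfold upG at h3
    rw [← hHj, Bx_eq_of_mem (hq w)] at h3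
    have h4 := hB w
    have h5 := s.θ_le
    have h6 : 1 / 2 ≤ pr (Bx w j H) fun c => ¬ (¬ downG f (lam α β) (lam α β / 8) M H H c ∨
      far f (lam α β) (lam α β / 8) M D j (q w) c) := by linarith
    rw [pr_eq_card_div, card_Bx, show ((H : ℤ) - j).toNat = D by omega,
      le_div_iff₀ (by push_cast; positivity)] at h6
    push_cast at h6
    have h7 : 1 / 2 * (Fintype.card α : ℝ) ^ D ≤ (G w).card :=
      h6.trans (le_of_eq (by simp only [hG]; congr!))
    linarith
  have hdis : ∀ w ∈ W, ∀ w' ∈ W, w ≠ w' → Disjoint (G w) (G w') := by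
    intro w hw w' hw' hne
    rw [Finset.disjoint_left]
    intro c hc hc'
    refine hne (Finsupp.ext fun i => ?_)
    have e1 := mem_Bx.1 (Finset.mem_filter.1 hc).1 i
    have e2 := mem_Bx.1 (Finset.mem_filter.1 hc').1 i
    have e3 := mem_Bx.1 (hW w hw).1 i
    have e4 := mem_Bx.1 (hW w' hw').1 i
    by_cases hi : i < j ∨ (H : ℤ) ≤ i
    · rw [← e1 hi, ← e2 hi]
    · push Not at hi
      rw [e3 (by omega), e4 (by omega)]
  have hcnt := h.count (S := W.biUnion G) (i := (H : ℤ)) (h1 := (f (cT, (H : ℤ))).2 - T)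
    (h2 := (f (cT, (H : ℤ))).2 + T) (lo := v) (hi := (f (cT, (H : ℤ))).2 + T)
    (A0 := sp v y (f (cT, (H : ℤ))).1) (by
      intro c hc
      obtain ⟨w, hw, hcw⟩ := Finset.mem_biUnion.1 hc
      obtain ⟨hcB, hc2⟩ := Finset.mem_filter.1 hcw
      push Not at hc2
      obtain ⟨hd, hfar⟩ := hc2
      obtain ⟨hw0, hwy, hwv⟩ := hW w hw
      have hcT' : c ∈ Bx cT ((H : ℤ) - H) H := by
        rw [sub_self, Bx_eq_of_mem hcT]
        exact Bx_subset (by omega) le_rfl (Bx_subset le_rfl (by omega) (self_mem_Bx _ _ _) hw0) hcB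
      have h1 := s.down H H cT c hMH hcT' hgT hd
      have h2 := abs_le.1 h1.1
      refine ⟨by omega, by omega, fun i hi => ?_⟩
      rw [sp_apply]
      split_ifs with hiv
      · have hcq : c ∈ Bx (q w) j H := by rw [Bx_eq_of_mem (hq w)]; exact hcB
        have e1 : sp (j : ℤ) c (q w) = q w := sp_bot (self_mem_Bx _ _ _) hcq
        have e3 : sp (H : ℤ) c (q w) = c := sp_top (self_mem_Bx _ _ _) hcq
        have a1 := walk_eq_below (γ := fun r => f (sp r c (q w), r)) (h.path c (q w))
          (show (j : ℤ) ≤ H by omega) (v := (f (q w, (j : ℤ))).2 - K * M) (i := i)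
          (fun r b1 b2 => by
            have := h.far_low (by linarith) hfar b1 (by omega); rwa [e1] at this) (by omega)
        simp only [e1, e3] at a1
        rw [a1, hwy i hiv]
      · exact (h1.2 i (by omega)).symm)
  rw [Finset.card_biUnion hdis, show ((f (cT, (H : ℤ))).2 + T + 1 - ((f (cT, (H : ℤ))).2 - T)).toNat
    = 2 * T + 1 by omega] at hcnt
  have hcnt' : (∑ w ∈ W, ((G w).card : ℝ)) ≤ (Fintype.card α : ℝ) ^ (4 * K).toNat *
      ((2 * T + 1) * (Fintype.card β : ℝ) ^ ((f (cT, (H : ℤ))).2 + T - v).toNat) := by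
    exact_mod_cast hcnt
  have h9 : (W.card : ℝ) * (Fintype.card α : ℝ) ^ D ≤ ∑ w ∈ W, 2 * ((G w).card : ℝ) := by
    rw [← nsmul_eq_mul]
    exact Finset.card_nsmul_le_sum _ _ _ fun w _ => hcard w
  rw [← Finset.mul_sum] at h9
  linarith

end Tree

section Tree

variable {α β : Type*} [Zero α] [Zero β] [Fintype α] [Fintype β]
variable {f : (ℤ →₀ α) × ℤ → (ℤ →₀ β) × ℤ} {g : (ℤ →₀ β) × ℤ → (ℤ →₀ α) × ℤ} {K : ℤ}
variable {M τ T : ℕ} {θ : ℝ}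

/-- Images of boxes form a tree, where each configuration has boundedly many branches in
comparison with the expected number. -/
lemma Scale.tree (s : Scale f K M τ T θ) (h : CQ f g K) (hα : 2 ≤ Fintype.card α)
    (hβ : 2 ≤ Fintype.card β) :
    ∃ A0 : ℝ, ∀ J : ℕ, ∃ (c0 : ℝ) (A : ℕ → (ℤ →₀ α) → (ℤ →₀ β)),
      (∀ j < J, ∀ w ∈ Bx (0 : ℤ →₀ α) 0 j, ∀ w' ∈ Bx w j (j + 1), ∀ i : ℤ,
        (i : ℝ) < c0 + lam α β * j → A (j + 1) w' i = A j w i) ∧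
      ∀ j ≤ J, ∀ v : ℤ, (v : ℝ) ≤ c0 + lam α β * j → ∀ y : ℤ →₀ β,
        (((Bx (0 : ℤ →₀ α) 0 j).filter fun w => ∀ i < v, A j w i = y i).card : ℝ) ≤
          A0 * (Fintype.card β : ℝ) ^ (c0 + lam α β * j - v) := by
  have hl := lam_pos (α := α) (β := β) hα hβ
  have hK1 := h.one_le
  have hK : (1 : ℝ) ≤ K := by exact_mod_cast h.one_le
  have hm1 : (1 : ℝ) < Fintype.card β := by exact_mod_cast (by omega : 1 < Fintype.card β)
  have hn0 : (0 : ℝ) < Fintype.card α := by exact_mod_cast (by omega : 0 < Fintype.card α)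
  set R : ℝ := T + K * K + K + (T + lam α β / 8 * τ) with hR
  have hR0 : 0 ≤ R := by positivity
  set Q : ℝ := Real.logb (Fintype.card β)
      (2 * ((2 * R + 1) * (K + 1) * (Fintype.card β : ℝ) ^ (4 * K).toNat)) with hQ
  have hQ0 : 0 ≤ Q := by
    refine Real.logb_nonneg hm1 ?_
    have e1 : 1 ≤ (Fintype.card β : ℝ) ^ (4 * K).toNat := one_le_pow₀ hm1.le
    have e2 : 1 ≤ (2 * R + 1) * (K + 1) := one_le_mul_of_one_le_of_one_le (by linarith)
      (by linarith)
    have := one_le_mul_of_one_le_of_one_le e2 e1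
    linarith
  set c1 : ℝ := lam α β * τ + R + Q + 2 * T + 2 * K + K * M with hc1
  have hc10 : 0 ≤ c1 := by positivity
  refine ⟨2 * ((Fintype.card α : ℝ) ^ (4 * K).toNat * (2 * T + 1)) *
    (Fintype.card β : ℝ) ^ (T + c1), fun J => ?_⟩
  obtain ⟨H, hH1, hH2, hB⟩ := s.pr_down J
  have hθ := s.θ_le
  obtain ⟨cT, hcT, hgT⟩ := exists_not_of_pr_lt (Bx_nonempty (0 : ℤ →₀ α) 0 H)
    (lt_of_le_of_lt (hB 0 (by omega) 0) (by linarith))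
  rw [not_not] at hgT
  have hex : ∀ (j : ℕ) (w : ℤ →₀ α), ∃ q ∈ Bx w j H, j ≤ J →
      upG f (lam α β) (lam α β / 8) M (H - j) j q := by
    intro j w
    rcases le_or_gt j J with hj | hj
    · have h1 := s.pr_up (H - j) w j (by omega)
      rw [show (j : ℤ) + (H - j : ℕ) = H by omega] at h1
      obtain ⟨q, hq, hgq⟩ := exists_not_of_pr_lt (Bx_nonempty w j H)
        (lt_of_le_of_lt h1 (by linarith))
      exact ⟨q, hq, fun _ => not_not.1 hgq⟩
    · exact ⟨w, self_mem_Bx _ _ _, fun h => by omega⟩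
  choose q hq hgq using hex
  set U : ℝ := ((f (cT, (H : ℤ))).2 : ℝ) with hU
  have hHJ : (J : ℝ) + τ + 2 * K ≤ H := by exact_mod_cast hH2
  have hlow : ∀ j ≤ J, ∀ w ∈ Bx (0 : ℤ →₀ α) 0 j,
      U - lam α β * H - c1 + lam α β * j + (2 * T + 2 * K + K * M) ≤ (f (q j w, (j : ℤ))).2 := by
    intro j hj w hw
    have h1 := s.height_ge h hα hβ hR (U := U) (D := H - j) (j := j) (H := H) (by omega)
      (by omega) (by omega) (hq j w) (hgq j w hj) (fun b hb hgb => by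
        have hb' : b ∈ Bx cT ((H : ℤ) - H) H := by
          rw [sub_self, Bx_eq_of_mem hcT]
          exact Bx_subset (by omega) le_rfl (Bx_subset le_rfl (by omega) (self_mem_Bx _ _ _) hw) hb
        have h2 := (s.down H H cT b (by omega) hb' hgT hgb).1
        rw [hU, abs_sub_comm]
        exact_mod_cast h2) (hB j hj w)
    rw [Nat.cast_sub (by omega)] at h1
    linarith
  refine ⟨U - lam α β * H - c1, fun j w => (f (q j w, (j : ℤ))).1, ?_, ?_⟩
  · intro j hj w hw w' hw' i hi
    have hi' : i < (f (q j w, (j : ℤ))).2 - 2 * T - 2 * K := by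
      have h1 := hlow j hj.le w hw
      have h2 : 0 ≤ (K : ℝ) * M := by positivity
      have h3 : (i : ℝ) < (f (q j w, (j : ℤ))).2 - 2 * T - 2 * K := by linarith
      exact_mod_cast h3
    have e1 := hq j w
    have e2 := hq (j + 1) w'
    have e3 := hgq j w hj.le
    have e4 := hgq (j + 1) w' (by omega)
    push_cast at e2 e4 ⊢
    refine s.child h (D := H - (j + 1)) (by omega) hw' ?_ ?_ ?_ e4 hi'
    · rwa [show (j : ℤ) + (H - (j + 1) + 1 : ℕ) = H by omega]
    · rwa [show (j : ℤ) + 1 + (H - (j + 1) : ℕ) = H by omega]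
    · rwa [show H - (j + 1) + 1 = H - j by omega]
  · intro j hj v hv y
    have hHj : (j : ℝ) ≤ H := by exact_mod_cast (by omega : j ≤ H)
    have hvU : v ≤ (f (cT, (H : ℤ))).2 := by
      have h1 : (v : ℝ) ≤ U := by
        have := mul_le_mul_of_nonneg_left hHj hl.le
        linarith
      rw [hU] at h1
      exact_mod_cast h1
    have h1 := s.card_le h hα hβ (j := j) (H := H) (D := H - j) (v := v) (y := y) (by omega)
      (by omega) hgT (hB j hj) hcT (hq j) (fun w => hgq j w hj)
      (W := (Bx (0 : ℤ →₀ α) 0 j).filter fun w => ∀ i < v, (f (q j w, (j : ℤ))).1 i = y i) (by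
        intro w hw
        obtain ⟨hw1, hw2⟩ := Finset.mem_filter.1 hw
        refine ⟨hw1, hw2, ?_⟩
        have h1 := hlow j hj w hw1
        have h2 : (v : ℝ) ≤ (f (q j w, (j : ℤ))).2 - K * M - K := by
          have : (0 : ℝ) ≤ T := by positivity
          linarith
        exact_mod_cast h2)
    have e1 : (Fintype.card β : ℝ) ^ ((f (cT, (H : ℤ))).2 + T - v).toNat =
        (Fintype.card β : ℝ) ^ (T + c1) *
          (Fintype.card β : ℝ) ^ (U - lam α β * H - c1 + lam α β * j - v) *
          (Fintype.card α : ℝ) ^ (H - j) := by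
      rw [← Real.rpow_natCast _ (H - j), ← card_rpow_lam hα hβ, ← Real.rpow_add (by linarith),
        ← Real.rpow_add (by linarith), ← Real.rpow_natCast]
      congr 1
      rw [← Int.cast_natCast, Int.toNat_of_nonneg (by omega), Nat.cast_sub (by omega), hU]
      push_cast
      ring
    rw [e1] at h1
    have hp : 0 < (Fintype.card α : ℝ) ^ (H - j) := by positivity
    refine le_of_mul_le_mul_right (h1.trans (le_of_eq ?_)) hp
    ring

end Tree

/-- The combinatorial conclusion of the coarse analysis. -/
lemma CQ.exists_tree {α β : Type*} [Zero α] [Zero β] [Fintype α] [Fintype β]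
    {f : (ℤ →₀ α) × ℤ → (ℤ →₀ β) × ℤ} {g : (ℤ →₀ β) × ℤ → (ℤ →₀ α) × ℤ} {K : ℤ}
    (h : CQ f g K) (hα : 2 ≤ Fintype.card α) (hβ : 2 ≤ Fintype.card β) :
    ∃ A0 : ℝ, ∀ J : ℕ, ∃ (c0 : ℝ) (A : ℕ → (ℤ →₀ α) → (ℤ →₀ β)),
      (∀ j < J, ∀ w ∈ Bx (0 : ℤ →₀ α) 0 j, ∀ w' ∈ Bx w j (j + 1), ∀ i : ℤ,
        (i : ℝ) < c0 + lam α β * j → A (j + 1) w' i = A j w i) ∧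
      ∀ j ≤ J, ∀ v : ℤ, (v : ℝ) ≤ c0 + lam α β * j → ∀ y : ℤ →₀ β,
        (((Bx (0 : ℤ →₀ α) 0 j).filter fun w => ∀ i < v, A j w i = y i).card : ℝ) ≤
          A0 * (Fintype.card β : ℝ) ^ (c0 + lam α β * j - v) := by
  have hl := lam_pos (α := α) (β := β) hα hβ
  obtain ⟨f', g', C, x, h', hC, hx0, hx1, ht⟩ := h.exists_tail hα hβ
    (ε := lam α β / 8) (by positivity)
  obtain ⟨M, τ, T, θ, s⟩ := h'.exists_scale hα hβ hC hx0 hx1 ht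
  exact s.tree h' hα hβ

section Count

variable {α β : Type*} [Zero α] [Zero β] [Fintype α] {A : ℕ → (ℤ →₀ α) → (ℤ →₀ β)}

/-- The number of branches at level `j` which agree with `y` below `v`. -/
def cnt (A : ℕ → (ℤ →₀ α) → (ℤ →₀ β)) (j : ℕ) (v : ℤ) (y : ℤ →₀ β) : ℕ :=
  ((Bx (0 : ℤ →₀ α) 0 j).filter fun w => ∀ i < v, A j w i = y i).card

lemma cnt_succ {j : ℕ} {v : ℤ} (hA : ∀ w ∈ Bx (0 : ℤ →₀ α) 0 j, ∀ w' ∈ Bx w j (j + 1), ∀ i < v,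
    A (j + 1) w' i = A j w i) (y : ℤ →₀ β) : cnt A (j + 1) v y = Fintype.card α * cnt A j v y := by
  have h0 : ∀ w' ∈ Bx (0 : ℤ →₀ α) 0 ((j + 1 : ℕ) : ℤ), sp (j : ℤ) w' 0 ∈ Bx (0 : ℤ →₀ α) 0 j ∧
      w' ∈ Bx (sp (j : ℤ) w' 0) j (j + 1) := by
    intro w' hw'
    have h1 := mem_Bx.1 hw'
    push_cast at h1
    refine ⟨mem_Bx.2 fun i hi => ?_, mem_Bx.2 fun i hi => ?_⟩
    · rw [sp_apply]
      split_ifs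
      · exact h1 i (by omega)
      · rfl
    · rw [sp_apply]
      split_ifs
      · rfl
      · exact h1 i (by omega)
  have hmaps : Set.MapsTo (fun w' : ℤ →₀ α => sp (j : ℤ) w' 0)
      ((Bx (0 : ℤ →₀ α) 0 ((j + 1 : ℕ) : ℤ)).filter fun w => ∀ i < v, A (j + 1) w i = y i)
      ((Bx (0 : ℤ →₀ α) 0 j).filter fun w => ∀ i < v, A j w i = y i) := by
    intro w' hw'
    obtain ⟨h1, h2⟩ := Finset.mem_filter.1 hw'
    obtain ⟨h3, h4⟩ := h0 w' h1
    exact Finset.mem_filter.2 ⟨h3, fun i hi => by rw [← hA _ h3 w' h4 i hi, h2 i hi]⟩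
  unfold cnt
  rw [Finset.card_eq_sum_card_fiberwise hmaps, mul_comm, ← smul_eq_mul, ← Finset.sum_const]
  refine Finset.sum_congr rfl fun w hw => ?_
  obtain ⟨h1, h2⟩ := Finset.mem_filter.1 hw
  have h3 := mem_Bx.1 h1
  have e : (Bx w j (j + 1 : ℤ)).card = Fintype.card α := by
    rw [card_Bx, show ((j : ℤ) + 1 - j).toNat = 1 by omega, pow_one]
  rw [← e]
  congr 1
  ext w'
  rw [Finset.mem_filter, Finset.mem_filter]
  constructor
  · rintro ⟨⟨h4, -⟩, rfl⟩
    exact (h0 w' h4).2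
  · intro h4
    refine ⟨⟨mem_Bx.2 fun i hi => ?_, fun i hi => by rw [hA w h1 w' h4 i hi, h2 i hi]⟩, ?_⟩
    · push_cast at hi
      rw [mem_Bx.1 h4 i (by omega), h3 i (by omega)]
    · ext i
      rw [sp_apply]
      split_ifs with hi
      · exact mem_Bx.1 h4 i (by omega)
      · rw [h3 i (by omega)]

lemma cnt_of_le {c0 l : ℝ} (hl : 0 ≤ l) {J : ℕ} (hA : ∀ j < J, ∀ w ∈ Bx (0 : ℤ →₀ α) 0 j,
      ∀ w' ∈ Bx w j (j + 1), ∀ i : ℤ, (i : ℝ) < c0 + l * j → A (j + 1) w' i = A j w i)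
    {j j' : ℕ} (hj : j ≤ j') (hj' : j' ≤ J) {v : ℤ} (hv : (v : ℝ) ≤ c0 + l * j) (y : ℤ →₀ β) :
    cnt A j' v y = Fintype.card α ^ (j' - j) * cnt A j v y := by
  induction j', hj using Nat.le_induction with
  | base => simp
  | succ k hk ih =>
    rw [cnt_succ (fun w hw w' hw' i hi => hA k (by omega) w hw w' hw' i ?_), ih (by omega),
      Nat.succ_sub hk, pow_succ]
    · ring
    · have h1 : (i : ℝ) < v := by exact_mod_cast hi
      have h2 : l * j ≤ l * k := mul_le_mul_of_nonneg_left (by exact_mod_cast hk) hl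
      linarith

lemma cnt_split [Fintype β] (j : ℕ) (v : ℤ) (y : ℤ →₀ β) :
    cnt A j v y = ∑ s : β, cnt A j (v + 1) (y.update v s) := by
  unfold cnt
  rw [Finset.card_eq_sum_card_fiberwise (f := fun w => A j w v) (t := Finset.univ)
    (fun _ _ => Finset.mem_coe.2 (Finset.mem_univ _))]
  refine Finset.sum_congr rfl fun s _ => ?_
  congr 1
  ext w
  simp only [Finset.mem_filter, Finsupp.coe_update]
  constructor
  · rintro ⟨⟨h1, h2⟩, h3⟩
    refine ⟨h1, fun i hi => ?_⟩
    rcases eq_or_ne i v with rfl | hne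
    · rw [Function.update_self, h3]
    · rw [Function.update_of_ne hne, h2 i (by omega)]
  · rintro ⟨h1, h2⟩
    refine ⟨⟨h1, fun i hi => ?_⟩, ?_⟩
    · rw [h2 i (by omega), Function.update_of_ne (by omega)]
    · rw [h2 v (by omega), Function.update_self]

lemma exists_cnt_max (A : ℕ → (ℤ →₀ α) → (ℤ →₀ β)) (j : ℕ) (v : ℤ) :
    ∃ y, ∀ y', cnt A j v y' ≤ cnt A j v y := by
  have hb : BddAbove (Set.range (cnt A j v)) :=
    ⟨(Bx (0 : ℤ →₀ α) 0 j).card, by rintro _ ⟨y, rfl⟩; exact Finset.card_filter_le _ _⟩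
  obtain ⟨y, hy⟩ := Nat.sSup_mem (Set.range_nonempty (cnt A j v)) hb
  exact ⟨y, fun y' => hy ▸ le_csSup hb ⟨y', rfl⟩⟩

end Count

/-- Integers in a sufficiently small ratio are equal. -/
lemma eq_of_ratio {Z δ : ℝ} {u w : ℕ} (hZ : 2 ≤ Z) (hδ : δ * (4 * Z ^ 2) = 1) (hu : (u : ℝ) ≤ Z)
    (h1 : (u : ℝ) * (1 - Z * δ) ≤ w * (1 + δ)) (h2 : (w : ℝ) * (1 - Z * δ) ≤ u * (1 + δ)) :
    u = w := by
  have hδ0 : 0 < δ := by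
    by_contra! h
    nlinarith [sq_nonneg Z]
  have key : ∀ a b : ℕ, (a : ℝ) ≤ Z → (b : ℝ) * (1 - Z * δ) ≤ a * (1 + δ) → ¬ a < b := by
    intro a b ha hab hlt
    have h3 : (a : ℝ) + 1 ≤ b := by exact_mod_cast hlt
    have h4 : Z * δ ≤ 1 / 8 := by nlinarith
    have h5 : ((a : ℝ) + 1) * (1 - Z * δ) ≤ b * (1 - Z * δ) :=
      mul_le_mul_of_nonneg_right h3 (by linarith)
    have h6 : (a : ℝ) * δ ≤ Z * δ := mul_le_mul_of_nonneg_right ha hδ0.le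
    have h7 : (a : ℝ) * (Z * δ) ≤ Z * (Z * δ) := mul_le_mul_of_nonneg_right ha (by positivity)
    nlinarith
  rcases lt_trichotomy u w with h | h | h
  · exact absurd h (key u w hu h2)
  · exact h
  · refine absurd h (key w u (le_trans ?_ hu) h1)
    exact_mod_cast h.le

section Density

variable {α β : Type*} [Zero α] [Zero β] [Fintype α] [Fintype β]

/-- The bounds on the counting functions extracted from the tree. -/
structure TreeBd (α β : Type*) [Zero α] [Zero β] [Fintype α] [Fintype β] (A0 c0 : ℝ) (J : ℕ)
    (A : ℕ → (ℤ →₀ α) → (ℤ →₀ β)) : Prop where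
  pos : 0 ≤ A0
  agree : ∀ j < J, ∀ w ∈ Bx (0 : ℤ →₀ α) 0 j, ∀ w' ∈ Bx w j (j + 1), ∀ i : ℤ,
    (i : ℝ) < c0 + lam α β * j → A (j + 1) w' i = A j w i
  le : ∀ j ≤ J, ∀ v : ℤ, (v : ℝ) ≤ c0 + lam α β * j → ∀ y : ℤ →₀ β,
    (cnt A j v y : ℝ) ≤ A0 * (Fintype.card β : ℝ) ^ (c0 + lam α β * j - v)

variable {A0 c0 : ℝ} {J : ℕ} {A : ℕ → (ℤ →₀ α) → (ℤ →₀ β)}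

/-- The first level at which the image is determined below `v`. -/
def lev (α β : Type*) [Fintype α] [Fintype β] (c0 : ℝ) (v : ℤ) : ℕ := ⌈((v : ℝ) - c0) / lam α β⌉₊

omit [Zero α] [Zero β] in
lemma le_lev (hα : 2 ≤ Fintype.card α) (hβ : 2 ≤ Fintype.card β) (c0 : ℝ) (v : ℤ) :
    (v : ℝ) ≤ c0 + lam α β * lev α β c0 v := by
  have hl := lam_pos (α := α) (β := β) hα hβ
  have := Nat.le_ceil (((v : ℝ) - c0) / lam α β)
  rw [div_le_iff₀ hl] at this
  unfold lev
  linarith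

omit [Zero α] [Zero β] in
lemma lev_mono (hα : 2 ≤ Fintype.card α) (hβ : 2 ≤ Fintype.card β) (c0 : ℝ) {v v' : ℤ}
    (h : v ≤ v') : lev α β c0 v ≤ lev α β c0 v' := by
  have hl := lam_pos (α := α) (β := β) hα hβ
  have : (v : ℝ) ≤ v' := by exact_mod_cast h
  exact Nat.ceil_mono (div_le_div_of_nonneg_right (by linarith) hl.le)

omit [Zero α] [Zero β] in
lemma lev_le (hα : 2 ≤ Fintype.card α) (hβ : 2 ≤ Fintype.card β) {c0 : ℝ} {v : ℤ}
    (h : (v : ℝ) ≤ c0 + lam α β * J) : lev α β c0 v ≤ J := by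
  have hl := lam_pos (α := α) (β := β) hα hβ
  refine Nat.ceil_le.2 ?_
  rw [div_le_iff₀ hl]
  linarith

omit [Zero α] [Zero β] in
lemma lev_lt (hα : 2 ≤ Fintype.card α) (hβ : 2 ≤ Fintype.card β) {c0 : ℝ} {v : ℤ}
    (h : c0 - 1 ≤ v) : c0 + lam α β * lev α β c0 v - v ≤ lam α β + 1 := by
  have hl := lam_pos (α := α) (β := β) hα hβ
  unfold lev
  rcases le_or_gt 0 (((v : ℝ) - c0) / lam α β) with h0 | h0
  · have h1 := Nat.ceil_lt_add_one h0
    have h2 : (⌈((v : ℝ) - c0) / lam α β⌉₊ : ℝ) * lam α β ≤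
        (((v : ℝ) - c0) / lam α β + 1) * lam α β := mul_le_mul_of_nonneg_right h1.le hl.le
    rw [add_mul, div_mul_cancel₀ _ hl.ne'] at h2
    linarith
  · rw [Nat.ceil_eq_zero.2 h0.le]
    push_cast
    linarith

lemma TreeBd.cnt_eq (h : TreeBd α β A0 c0 J A) (hα : 2 ≤ Fintype.card α)
    (hβ : 2 ≤ Fintype.card β) {v : ℤ} (hv : (v : ℝ) ≤ c0 + lam α β * J) (y : ℤ →₀ β) :
    cnt A J v y = Fintype.card α ^ (J - lev α β c0 v) * cnt A (lev α β c0 v) v y :=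
  cnt_of_le (lam_pos hα hβ).le h.agree (lev_le hα hβ hv) le_rfl (le_lev hα hβ c0 v) y

lemma TreeBd.cnt_lev_le (h : TreeBd α β A0 c0 J A) (hα : 2 ≤ Fintype.card α)
    (hβ : 2 ≤ Fintype.card β) {v : ℤ} (hv0 : c0 - 1 ≤ v) (hv : (v : ℝ) ≤ c0 + lam α β * J)
    (y : ℤ →₀ β) :
    (cnt A (lev α β c0 v) v y : ℝ) ≤ A0 * (Fintype.card β : ℝ) ^ (lam α β + 1) := by
  have hm1 : (1 : ℝ) ≤ Fintype.card β := by exact_mod_cast (by omega : 1 ≤ Fintype.card β)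
  refine (h.le _ (lev_le hα hβ hv) v (le_lev hα hβ c0 v) y).trans
    (mul_le_mul_of_nonneg_left ?_ h.pos)
  exact Real.rpow_le_rpow_of_exponent_le hm1 (lev_lt hα hβ hv0)

lemma TreeBd.cnt_mul_le (h : TreeBd α β A0 c0 J A) (hα : 2 ≤ Fintype.card α)
    (hβ : 2 ≤ Fintype.card β) {t : ℕ} (hv : ((⌊c0⌋ + t : ℤ) : ℝ) ≤ c0 + lam α β * J)
    (y : ℤ →₀ β) :
    (cnt A J (⌊c0⌋ + t) y : ℝ) * (Fintype.card β : ℝ) ^ t ≤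
      A0 * Fintype.card β * (Fintype.card α : ℝ) ^ J := by
  have hm1 : (1 : ℝ) ≤ Fintype.card β := by exact_mod_cast (by omega : 1 ≤ Fintype.card β)
  have hm0 : (0 : ℝ) < Fintype.card β := by linarith
  set v : ℤ := ⌊c0⌋ + t with hvd
  set j := lev α β c0 v with hj
  have hjJ : j ≤ J := lev_le hα hβ hv
  rw [h.cnt_eq hα hβ hv y]
  push_cast
  have h1 := h.le j hjJ v (le_lev hα hβ c0 v) y
  have h2 : (Fintype.card β : ℝ) ^ (c0 + lam α β * j - v) * (Fintype.card β : ℝ) ^ t ≤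
      Fintype.card β * (Fintype.card α : ℝ) ^ j := by
    rw [← Real.rpow_natCast _ j, ← card_rpow_lam hα hβ, ← Real.rpow_natCast _ t,
      ← Real.rpow_add hm0]
    nth_rewrite 2 [← Real.rpow_one (Fintype.card β : ℝ)]
    rw [← Real.rpow_add hm0]
    refine Real.rpow_le_rpow_of_exponent_le hm1 ?_
    have := Int.lt_floor_add_one c0
    rw [hvd]
    push_cast
    linarith
  have h0 := h.pos
  calc (Fintype.card α : ℝ) ^ (J - j) * (cnt A j v y) * (Fintype.card β : ℝ) ^ t
      ≤ (Fintype.card α : ℝ) ^ (J - j) * (A0 * (Fintype.card β : ℝ) ^ (c0 + lam α β * j - v)) *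
        (Fintype.card β : ℝ) ^ t := by gcongr
    _ = A0 * (Fintype.card α : ℝ) ^ (J - j) *
        ((Fintype.card β : ℝ) ^ (c0 + lam α β * j - v) * (Fintype.card β : ℝ) ^ t) := by ring
    _ ≤ A0 * (Fintype.card α : ℝ) ^ (J - j) * (Fintype.card β * (Fintype.card α : ℝ) ^ j) := by
        gcongr
    _ = A0 * Fintype.card β * ((Fintype.card α : ℝ) ^ (J - j) * (Fintype.card α : ℝ) ^ j) := by
        ring
    _ = A0 * Fintype.card β * (Fintype.card α : ℝ) ^ J := by
        rw [← pow_add, Nat.sub_add_cancel hjJ]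

/-- The root image is shared by all branches. -/
lemma TreeBd.cnt_root (h : TreeBd α β A0 c0 J A) (hα : 2 ≤ Fintype.card α)
    (hβ : 2 ≤ Fintype.card β) : cnt A J ⌊c0⌋ (A 0 0) = Fintype.card α ^ J := by
  have h1 := cnt_of_le (lam_pos hα hβ).le h.agree (Nat.zero_le J) le_rfl
    (v := ⌊c0⌋) (by simpa using Int.floor_le c0) (A 0 0)
  have h2 : cnt A 0 ⌊c0⌋ (A 0 0) = 1 := by
    unfold cnt
    rw [Finset.card_eq_one]
    refine ⟨0, ?_⟩
    ext w
    rw [Finset.mem_filter, Finset.mem_singleton, mem_Bx]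
    constructor
    · rintro ⟨h3, -⟩
      ext i
      exact h3 i (by push_cast; omega)
    · rintro rfl
      exact ⟨fun _ _ => rfl, fun _ _ => rfl⟩
  rw [h1, h2, Nat.sub_zero, mul_one]

/-- A bounded sequence cannot grow all the time. -/
lemma exists_slow_growth {q : ℕ → ℝ} {b δ : ℝ} (N : ℕ) {s : ℕ} (h0 : b ≤ q 0) (hδ : 0 ≤ δ)
    (hs : q (s * N) < (1 + δ) ^ s * b) : ∃ t < s, q ((t + 1) * N) ≤ (1 + δ) * q (t * N) := by
  by_contra! h
  have : ∀ t ≤ s, (1 + δ) ^ t * b ≤ q (t * N) := by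
    intro t ht
    induction t with
    | zero => simpa using h0
    | succ k ih =>
      have h1 := ih (by omega)
      have h2 := h k (by omega)
      rw [pow_succ]
      nlinarith
  linarith [this s le_rfl]

lemma cnt_le_mul_max (A : ℕ → (ℤ →₀ α) → (ℤ →₀ β)) {j : ℕ} {v : ℤ} {y y' : ℤ →₀ β}
    (hy' : ∀ z, cnt A j (v + 1) z ≤ cnt A j (v + 1) y') :
    cnt A j v y ≤ Fintype.card β * cnt A j (v + 1) y' := by
  rw [cnt_split, ← smul_eq_mul, ← Finset.card_univ]
  exact Finset.sum_le_card_nsmul _ _ _ fun s _ => hy' _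

lemma mul_cnt_le_succ (A : ℕ → (ℤ →₀ α) → (ℤ →₀ β)) {j : ℕ} {v : ℤ} (y y' : ℤ →₀ β)
    (hy' : ∀ z, cnt A j (v + 1) z ≤ cnt A j (v + 1) y') :
    cnt A j v y ≤ cnt A j (v + 1) y + (Fintype.card β - 1) * cnt A j (v + 1) y' := by
  have e : y.update v (y v) = y := by simp
  rw [cnt_split, ← Finset.add_sum_erase _ _ (Finset.mem_univ (y v)), e, ← smul_eq_mul,
    ← Finset.card_univ, ← Finset.card_erase_of_mem (Finset.mem_univ (y v))]
  exact Nat.add_le_add_left (Finset.sum_le_card_nsmul _ _ _ fun s _ => hy' _) _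

end Density

section Density

variable {α β : Type*} [Zero α] [Zero β] [Fintype α] [Fintype β]
variable {A0 c0 : ℝ} {J : ℕ} {A : ℕ → (ℤ →₀ α) → (ℤ →₀ β)}

/-- Below an almost maximal density all densities are almost equal. -/
lemma cnt_chain (hβ : 2 ≤ Fintype.card β) {v : ℤ} {N : ℕ} {y : ℤ →₀ β} {Y : ℤ → (ℤ →₀ β)} {δ : ℝ}
    (hY : ∀ v z, cnt A J v z ≤ cnt A J v (Y v)) (hδ : 0 ≤ δ)
    (hy : (cnt A J (v + N) (Y (v + N)) : ℝ) * (Fintype.card β : ℝ) ^ N ≤ (1 + δ) * cnt A J v y)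
    {i : ℕ} (hi : i ≤ N) :
    cnt A J v y * (1 - (Fintype.card β : ℝ) ^ N * δ) ≤
        cnt A J (v + i) y * (Fintype.card β : ℝ) ^ i ∧
      cnt A J (v + i) y * (Fintype.card β : ℝ) ^ i ≤ cnt A J v y * (1 + δ) := by
  set m : ℝ := (Fintype.card β : ℝ) with hm
  have hm1 : 1 ≤ m := by rw [hm]; exact_mod_cast (by omega : 1 ≤ Fintype.card β)
  set P : ℝ := (cnt A J v y : ℝ) with hP
  have hP0 : 0 ≤ P := by rw [hP]; positivity
  have hmono : Monotone fun t : ℕ => (cnt A J (v + t) (Y (v + t)) : ℝ) * m ^ t := by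
    refine monotone_nat_of_le_succ fun t => ?_
    have h1 : cnt A J (v + t) (Y (v + t)) ≤
        Fintype.card β * cnt A J (v + t + 1) (Y (v + t + 1)) := cnt_le_mul_max A (hY _)
    have h2 : (cnt A J (v + t) (Y (v + t)) : ℝ) ≤ m * cnt A J (v + t + 1) (Y (v + t + 1)) := by
      rw [hm]; exact_mod_cast h1
    have h3 := mul_le_mul_of_nonneg_right h2 (by positivity : 0 ≤ m ^ t)
    push_cast
    rw [← add_assoc, pow_succ]
    linarith
  have hup : ∀ t ≤ N, cnt A J (v + t) (Y (v + t)) * m ^ t ≤ P * (1 + δ) := fun t ht => by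
    rw [mul_comm P]
    exact (hmono ht).trans hy
  refine ⟨?_, ?_⟩
  · have key : ∀ t ≤ N, P * (1 - (m ^ t - 1) * δ) ≤ cnt A J (v + t) y * m ^ t := by
      intro t ht
      induction t with
      | zero => simp [hP]
      | succ t ih =>
        have h1 := ih (by omega)
        have h2 := mul_cnt_le_succ A y (Y (v + t + 1)) (hY (v + t + 1))
        have h3 : (cnt A J (v + t) y : ℝ) ≤ cnt A J (v + t + 1) y +
            (m - 1) * cnt A J (v + t + 1) (Y (v + t + 1)) := by
          have h4 : ((Fintype.card β - 1 : ℕ) : ℝ) = m - 1 := by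
            rw [Nat.cast_sub (by omega), hm, Nat.cast_one]
          rw [← h4]
          exact_mod_cast h2
        have h4 := hup (t + 1) ht
        have h5 := mul_le_mul_of_nonneg_right h3 (by positivity : 0 ≤ m ^ (t + 1))
        have h6 := mul_le_mul_of_nonneg_left h4 (by linarith : 0 ≤ m - 1)
        have h7 := mul_le_mul_of_nonneg_left h1 (by linarith : 0 ≤ m)
        push_cast at h4 h6 ⊢
        rw [← add_assoc] at h4 h6 ⊢
        rw [pow_succ] at *
        linarith
    refine le_trans (mul_le_mul_of_nonneg_left ?_ hP0) (key i hi)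
    have h1 : m ^ i ≤ m ^ N := pow_le_pow_right₀ hm1 hi
    have h2 := mul_le_mul_of_nonneg_right h1 hδ
    linarith
  · refine le_trans (mul_le_mul_of_nonneg_right ?_ (by positivity)) (hup i hi)
    exact_mod_cast hY _ _

/-- Bounded trees exist for all depths only if the cardinalities have a common power. -/
lemma exists_pow_eq (hα : 2 ≤ Fintype.card α) (hβ : 2 ≤ Fintype.card β)
    (h : ∀ J : ℕ, ∃ (c0 : ℝ) (A : ℕ → (ℤ →₀ α) → (ℤ →₀ β)), TreeBd α β A0 c0 J A) :
    ∃ r p : ℕ, 0 < r ∧ 0 < p ∧ Fintype.card α ^ r = Fintype.card β ^ p := by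
  have hl := lam_pos (α := α) (β := β) hα hβ
  set m : ℝ := (Fintype.card β : ℝ) with hm
  set n : ℝ := (Fintype.card α : ℝ) with hn
  have hm2 : 2 ≤ m := by rw [hm]; exact_mod_cast hβ
  have hn2 : 2 ≤ n := by rw [hn]; exact_mod_cast hα
  set B : ℕ := ⌊A0 * m ^ (lam α β + 1)⌋₊ with hB
  set N : ℕ := B + 1 with hN
  set Z : ℝ := m ^ N with hZ
  have hZ2 : 2 ≤ Z := by
    rw [hZ, hN]
    calc 2 ≤ m := hm2
      _ = m ^ 1 := (pow_one m).symm
      _ ≤ m ^ (B + 1) := pow_le_pow_right₀ (by linarith) (by omega)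
  set δ : ℝ := 1 / (4 * Z ^ 2) with hδ
  have hδ0 : 0 < δ := by positivity
  have hδ1 : δ * (4 * Z ^ 2) = 1 := by rw [hδ]; field_simp
  obtain ⟨s, hs⟩ := pow_unbounded_of_one_lt (A0 * m) (by linarith : 1 < 1 + δ)
  obtain ⟨J, hJ⟩ := exists_nat_ge ((s * N : ℝ) / lam α β)
  rw [div_le_iff₀ hl] at hJ
  obtain ⟨c0, A, ht⟩ := h J
  choose Y hY using exists_cnt_max A J
  have hv : ∀ t ≤ s * N, ((⌊c0⌋ + (t : ℕ) : ℤ) : ℝ) ≤ c0 + lam α β * J := by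
    intro t h1
    have h2 : (t : ℝ) ≤ s * N := by exact_mod_cast h1
    have h3 := Int.floor_le c0
    push_cast
    linarith
  set q : ℕ → ℝ := fun t => cnt A J (⌊c0⌋ + t) (Y (⌊c0⌋ + t)) * m ^ t with hq
  have hnJ : 0 < n ^ J := by positivity
  have hq0 : n ^ J ≤ q 0 := by
    have h1 := ht.cnt_root hα hβ ▸ hY ⌊c0⌋ (A 0 0)
    simp only [hq, Nat.cast_zero, add_zero, pow_zero, mul_one]
    rw [hn]
    exact_mod_cast h1
  obtain ⟨t, hts, hgr⟩ := exists_slow_growth N (s := s) hq0 hδ0.le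
    (lt_of_le_of_lt (ht.cnt_mul_le hα hβ (hv _ le_rfl) _) (mul_lt_mul_of_pos_right hs hnJ))
  have htN : (t + 1) * N ≤ s * N := Nat.mul_le_mul_right _ hts
  set v : ℤ := ⌊c0⌋ + (t * N : ℕ) with hvd
  have hmt : 0 < m ^ (t * N) := by positivity
  have hy : (cnt A J (v + N) (Y (v + N)) : ℝ) * m ^ N ≤ (1 + δ) * cnt A J v (Y v) := by
    refine le_of_mul_le_mul_right ?_ hmt
    have e : ⌊c0⌋ + (((t + 1) * N : ℕ) : ℤ) = v + N := by rw [hvd]; push_cast; ring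
    have e2 : m ^ ((t + 1) * N) = m ^ N * m ^ (t * N) := by rw [← pow_add]; congr 1; ring
    simp only [hq, e, e2, ← hvd] at hgr
    linarith
  have hchain := fun i hi => cnt_chain (A := A) (J := J) (i := i) hβ hY hδ0.le hy hi
  have hqmono : ∀ u : ℕ, n ^ J ≤ q u := by
    intro u
    induction u with
    | zero => exact hq0
    | succ u ih =>
      refine ih.trans ?_
      have h1 : cnt A J (⌊c0⌋ + u) (Y (⌊c0⌋ + u)) ≤
        Fintype.card β * cnt A J (⌊c0⌋ + u + 1) (Y (⌊c0⌋ + u + 1)) := cnt_le_mul_max A (hY _)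
      have h2 : (cnt A J (⌊c0⌋ + u) (Y (⌊c0⌋ + u)) : ℝ) ≤
          m * cnt A J (⌊c0⌋ + u + 1) (Y (⌊c0⌋ + u + 1)) := by
        rw [hm]; exact_mod_cast h1
      have h3 := mul_le_mul_of_nonneg_right h2 (by positivity : 0 ≤ m ^ u)
      simp only [hq]
      push_cast
      rw [← add_assoc, pow_succ]
      linarith
  set P : ℝ := (cnt A J v (Y v) : ℝ) with hP
  have hP0 : 0 < P := by
    have h1 : n ^ J ≤ P * m ^ (t * N) := hqmono (t * N)
    exact pos_of_mul_pos_left (lt_of_lt_of_le hnJ h1) hmt.le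
  have hvi : ∀ i ≤ N, ((v + (i : ℕ) : ℤ) : ℝ) ≤ c0 + lam α β * J := by
    intro i hi
    have := hv (t * N + i) (by nlinarith)
    rw [hvd, add_assoc]
    exact_mod_cast this
  have hv0 : ∀ i : ℕ, c0 - 1 ≤ ((v + i : ℤ) : ℝ) := by
    intro i
    have h1 := Int.lt_floor_add_one c0
    have h2 : (0 : ℝ) ≤ (t * N : ℕ) := by positivity
    rw [hvd]
    push_cast at h2 ⊢
    linarith [(by positivity : (0 : ℝ) ≤ i)]
  set a : ℕ → ℕ := fun i => cnt A (lev α β c0 (v + i)) (v + i) (Y v) with ha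
  obtain ⟨i, hi, i', hi', hne, haa⟩ := Finset.exists_ne_map_eq_of_card_lt_of_maps_to
    (s := Finset.range (N + 1)) (t := Finset.range (B + 1)) (f := a) (by simp; omega) (by
      intro i hi
      have hi' : i ≤ N := by have := Finset.mem_range.1 hi; omega
      have h1 := ht.cnt_lev_le hα hβ (hv0 i) (hvi i hi') (Y v)
      have h2 : a i ≤ B := Nat.le_floor h1
      exact Finset.mem_range.2 (by omega))
  rw [Finset.mem_range] at hi hi'
  wlog hlt : i < i' generalizing i i'
  · exact this i' hi' i hi hne.symm haa.symm (by omega)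
  have h1 := hchain i (by omega)
  have h2 := hchain i' (by omega)
  set X : ℝ := cnt A J (v + i) (Y v) * m ^ i with hX
  set X' : ℝ := cnt A J (v + i') (Y v) * m ^ i' with hX'
  have hlev : lev α β c0 (v + i) ≤ lev α β c0 (v + i') := lev_mono hα hβ c0 (by omega)
  have hlevJ : lev α β c0 (v + i') ≤ J := lev_le hα hβ (hvi i' (by omega))
  set r : ℕ := lev α β c0 (v + i') - lev α β c0 (v + i) with hr
  set p : ℕ := i' - i with hp
  have hrel : X' * n ^ r = X * m ^ p := by
    rw [hX, hX', ht.cnt_eq hα hβ (hvi i (by omega)), ht.cnt_eq hα hβ (hvi i' (by omega))]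
    have e1 : cnt A (lev α β c0 (v + i)) (v + i) (Y v) = a i := rfl
    have e2 : cnt A (lev α β c0 (v + i')) (v + i') (Y v) = a i' := rfl
    rw [e1, e2, haa]
    push_cast
    have e3 : n ^ (J - lev α β c0 (v + i)) = n ^ (J - lev α β c0 (v + i')) * n ^ r := by
      rw [← pow_add]; congr 1; omega
    have e4 : m ^ i' = m ^ i * m ^ p := by rw [← pow_add]; congr 1; omega
    rw [← hn, e3, e4]
    ring
  have hmp : 0 < m ^ p := by positivity
  have hnr : 0 < n ^ r := by positivity
  have hpZ : m ^ p ≤ Z := pow_le_pow_right₀ (by linarith) (by omega)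
  have b1 : m ^ p * (1 - Z * δ) ≤ n ^ r * (1 + δ) := by
    refine le_of_mul_le_mul_left ?_ hP0
    have c1 := mul_le_mul_of_nonneg_right h1.1 hmp.le
    have c2 := mul_le_mul_of_nonneg_right h2.2 hnr.le
    linarith
  have b2 : n ^ r * (1 - Z * δ) ≤ m ^ p * (1 + δ) := by
    refine le_of_mul_le_mul_left ?_ hP0
    have c1 := mul_le_mul_of_nonneg_right h2.1 hnr.le
    have c2 := mul_le_mul_of_nonneg_right h1.2 hmp.le
    linarith
  have heq : Fintype.card β ^ p = Fintype.card α ^ r :=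
    eq_of_ratio (u := Fintype.card β ^ p) (w := Fintype.card α ^ r) hZ2 hδ1
      (by push_cast; exact hpZ) (by push_cast; exact b1) (by push_cast; exact b2)
  have hp0 : 0 < p := by omega
  refine ⟨r, p, Nat.pos_of_ne_zero fun hr0 => ?_, hp0, heq.symm⟩
  rw [hr0, pow_zero] at heq
  have := Nat.one_lt_pow hp0.ne' (by omega : 1 < Fintype.card β)
  omega

/-- Coarsely equivalent lamplighter graphs have commensurable lamp cardinalities. -/
lemma CQ.exists_pow_eq {f : (ℤ →₀ α) × ℤ → (ℤ →₀ β) × ℤ} {g : (ℤ →₀ β) × ℤ → (ℤ →₀ α) × ℤ} {K : ℤ}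
    (h : CQ f g K) (hα : 2 ≤ Fintype.card α) (hβ : 2 ≤ Fintype.card β) :
    ∃ r p : ℕ, 0 < r ∧ 0 < p ∧ Fintype.card α ^ r = Fintype.card β ^ p := by
  obtain ⟨A0, hA0⟩ := h.exists_tree hα hβ
  refine LampQI.exists_pow_eq (A0 := |A0|) hα hβ fun J => ?_
  obtain ⟨c0, A, h1, h2⟩ := hA0 J
  refine ⟨c0, A, abs_nonneg _, h1, fun j hj v hv y => ?_⟩
  exact (h2 j hj v hv y).trans
    (mul_le_mul_of_nonneg_right (le_abs_self A0) (by positivity))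

end Density

section Word

variable {Γ : Type*} [Group Γ] {S : Set Γ}

lemma IsFinSymmGen.exists_list (hS : IsFinSymmGen S) (g : Γ) :
    ∃ l : List Γ, (∀ x ∈ l, x ∈ S) ∧ l.prod = g := by
  have hg : g ∈ (Subgroup.closure S).toSubmonoid := by rw [hS.2.2]; exact Subgroup.mem_top g
  rw [Subgroup.closure_toSubmonoid] at hg
  obtain ⟨l, hl, h⟩ := Submonoid.exists_list_of_mem_closure hg
  refine ⟨l, fun x hx => ?_, h⟩
  rcases hl x hx with h1 | h1
  · exact h1
  · simpa using hS.2.1 _ h1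

lemma IsFinSymmGen.exists_list_length (hS : IsFinSymmGen S) (g : Γ) :
    ∃ l : List Γ, (∀ x ∈ l, x ∈ S) ∧ l.prod = g ∧ l.length = wordNorm S g := by
  obtain ⟨l, hl, h⟩ := IsFinSymmGen.exists_list hS g
  exact Nat.sInf_mem (s := {m : ℕ | ∃ l : List Γ, (∀ x ∈ l, x ∈ S) ∧ l.prod = g ∧ l.length = m})
    ⟨l.length, l, hl, h, rfl⟩

lemma wordNorm_le {l : List Γ} (hl : ∀ x ∈ l, x ∈ S) : wordNorm S l.prod ≤ l.length :=
  Nat.sInf_le ⟨l, hl, rfl, rfl⟩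

lemma wordNorm_one : wordNorm S (1 : Γ) = 0 := by
  simpa using wordNorm_le (S := S) (l := []) (by simp)

lemma wordNorm_mul_le (hS : IsFinSymmGen S) (g h : Γ) :
    wordNorm S (g * h) ≤ wordNorm S g + wordNorm S h := by
  obtain ⟨l, hl, h1, h2⟩ := IsFinSymmGen.exists_list_length hS g
  obtain ⟨l', hl', h1', h2'⟩ := IsFinSymmGen.exists_list_length hS h
  rw [← h1, ← h1', ← List.prod_append]
  refine (wordNorm_le fun x hx => ?_).trans (by simp [h1, h1', h2, h2'])
  rcases List.mem_append.1 hx with hx | hx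
  · exact hl x hx
  · exact hl' x hx

lemma wordDist_triangle (hS : IsFinSymmGen S) (a b c : Γ) :
    wordDist S a c ≤ wordDist S a b + wordDist S b c := by
  have h := wordNorm_mul_le hS (a⁻¹ * b) (b⁻¹ * c)
  rw [show a⁻¹ * b * (b⁻¹ * c) = a⁻¹ * c by group] at h
  unfold wordDist
  exact_mod_cast h

lemma wordDist_self (a : Γ) : wordDist S a a = 0 := by
  simp [wordDist, wordNorm_one]

/-- A map that moves generator steps by at most `R` is `R`-Lipschitz. -/
lemma wordDist_lip {Γ' : Type*} [Group Γ'] {S' : Set Γ'} (hS : IsFinSymmGen S)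
    (hS' : IsFinSymmGen S') {f : Γ → Γ'} {R : ℝ}
    (hf : ∀ a, ∀ s ∈ S, wordDist S' (f a) (f (a * s)) ≤ R) (a b : Γ) :
    wordDist S' (f a) (f b) ≤ R * wordDist S a b := by
  obtain ⟨l, hl, h1, h2⟩ := IsFinSymmGen.exists_list_length hS (a⁻¹ * b)
  have key : ∀ l : List Γ, (∀ x ∈ l, x ∈ S) → ∀ a,
      wordDist S' (f a) (f (a * l.prod)) ≤ R * l.length := by
    intro l
    induction l with
    | nil => intro _ a; simp [wordDist_self]
    | cons s l ih =>
      intro hl a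
      have e1 := hf a s (hl s (by simp))
      have e2 := ih (fun x hx => hl x (by simp [hx])) (a * s)
      have e3 := wordDist_triangle hS' (f a) (f (a * s)) (f (a * s * l.prod))
      rw [List.prod_cons, ← mul_assoc, List.length_cons]
      push_cast
      linarith
  have h := key l hl a
  rw [h1, h2, mul_inv_cancel_left] at h
  exact h

end Word

section Lamp

variable {F : Type*} [Group F]

/-- An element of the lamplighter group as a configuration and a level. -/
def toC (a : Lamp F) : (ℤ →₀ Additive F) × ℤ :=
  (Finsupp.ofSupportFinite (fun i => Additive.ofMul (a.1.1 i)) a.2, a.1.2)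

/-- The element of the lamplighter group given by a configuration and a level. -/
def ofC (p : (ℤ →₀ Additive F) × ℤ) : Lamp F :=
  ⟨(fun i => (p.1 i).toMul, p.2), p.1.hasFiniteSupport⟩

@[simp] lemma toC_ofC (p : (ℤ →₀ Additive F) × ℤ) : toC (ofC p) = p := by
  refine Prod.ext ?_ rfl
  ext i; rfl

@[simp] lemma ofC_toC (a : Lamp F) : ofC (toC a) = a := rfl

lemma cl_toC {r : ℤ} {a b : Lamp F} : cl r (toC a) (toC b) ↔
    ∃ lo hi, hi ≤ lo + r ∧ lo ≤ a.1.2 ∧ a.1.2 ≤ hi ∧ lo ≤ b.1.2 ∧ b.1.2 ≤ hi ∧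
      ∀ i, i < lo ∨ hi ≤ i → a.1.1 i = b.1.1 i := Iff.rfl

lemma cl_mul_left {r : ℤ} {a b : Lamp F} (g : Lamp F) (h : cl r (toC a) (toC b)) :
    cl r (toC (g * a)) (toC (g * b)) := by
  rw [cl_toC] at h ⊢
  obtain ⟨lo, hi, h1, h2, h3, h4, h5, h6⟩ := h
  refine ⟨g.1.2 + lo, g.1.2 + hi, by omega, ?_, ?_, ?_, ?_, fun i hi => ?_⟩
  · exact add_le_add_right h2 _
  · exact add_le_add_right h3 _
  · exact add_le_add_right h4 _
  · exact add_le_add_right h5 _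
  · change g.1.1 i * a.1.1 (i - g.1.2) = g.1.1 i * b.1.1 (i - g.1.2)
    rw [h6 _ (by omega)]

lemma exists_cl (a b : Lamp F) : ∃ r, 0 ≤ r ∧ cl r (toC a) (toC b) := by
  obtain ⟨M, hM⟩ : ∃ M : ℤ, ∀ i ∈ ({i | a.1.1 i ≠ 1} ∪ {i | b.1.1 i ≠ 1}) ∪ {a.1.2, b.1.2},
      |i| ≤ M := by
    have hfin := ((a.2.union b.2).union (toFinite {a.1.2, b.1.2})).image fun i => |i|
    obtain ⟨M, hM⟩ := hfin.bddAbove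
    exact ⟨M, fun i hi => hM ⟨i, hi, rfl⟩⟩
  have ha := abs_le.1 (hM a.1.2 (by simp))
  have hb := abs_le.1 (hM b.1.2 (by simp))
  refine ⟨2 * M + 1, by omega, cl_toC.2 ⟨-M, M + 1, by omega, by omega, by omega, by omega,
    by omega, fun i hi => ?_⟩⟩
  have hi' : ¬ |i| ≤ M := fun h => by have := abs_le.1 h; omega
  have h1 : a.1.1 i = 1 := by by_contra h; exact hi' (hM i (by simp [h]))
  have h2 : b.1.1 i = 1 := by by_contra h; exact hi' (hM i (by simp [h]))
  rw [h1, h2]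

lemma exists_cl_step {S : Set (Lamp F)} (hS : S.Finite) :
    ∃ M : ℤ, 0 ≤ M ∧ ∀ a, ∀ s ∈ S, cl M (toC a) (toC (a * s)) := by
  choose r hr0 hr using fun s : Lamp F => exists_cl 1 s
  obtain ⟨M, hM⟩ := (hS.image r).bddAbove
  refine ⟨max M 0, le_max_right _ _, fun a s hs => ?_⟩
  have h := cl_mul_left a (hr s)
  rw [mul_one] at h
  exact h.mono (le_max_of_le_left (hM ⟨s, hs, rfl⟩))

lemma cl_of_wordDist_le {S : Set (Lamp F)} (hS : IsFinSymmGen S) (R : ℝ) :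
    ∃ M : ℤ, 0 ≤ M ∧ ∀ a b, wordDist S a b ≤ R → cl M (toC a) (toC b) := by
  obtain ⟨M, hM0, hM⟩ := exists_cl_step hS.1
  have key : ∀ l : List (Lamp F), (∀ x ∈ l, x ∈ S) → ∀ a,
      cl (M * l.length) (toC a) (toC (a * l.prod)) := by
    intro l
    induction l with
    | nil => intro _ a; simpa using cl_refl le_rfl (toC a)
    | cons s l ih =>
      intro hl a
      have e1 := hM a s (hl s (by simp))
      have e2 := ih (fun x hx => hl x (by simp [hx])) (a * s)
      rw [List.prod_cons, ← mul_assoc, List.length_cons]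
      refine (e1.trans e2).mono ?_
      push_cast
      linarith
  refine ⟨M * ⌊R⌋₊, by positivity, fun a b hab => ?_⟩
  obtain ⟨l, hl, h1, h2⟩ := IsFinSymmGen.exists_list_length hS (a⁻¹ * b)
  have h := key l hl a
  rw [h1, mul_inv_cancel_left] at h
  refine h.mono (mul_le_mul_of_nonneg_left ?_ hM0)
  have : l.length ≤ ⌊R⌋₊ := Nat.le_floor (by rw [h2]; exact hab)
  exact_mod_cast this

variable [Fintype F]

lemma finite_cl_one (r : ℤ) : {g : Lamp F | cl r (toC 1) (toC g)}.Finite := by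
  have hfin : ((Bx (0 : ℤ →₀ Additive F) (-r) r : Set (ℤ →₀ Additive F)) ×ˢ
      (Finset.Icc (-r) r : Set ℤ)).Finite := (Finset.finite_toSet _).prod (Finset.finite_toSet _)
  refine (hfin.image ofC).subset fun g hg => ⟨toC g, ⟨?_, ?_⟩, ofC_toC g⟩
  · obtain ⟨lo, hi, h1, h2, h3, h4, h5, h6⟩ := hg
    change lo ≤ 0 at h2
    change 0 ≤ hi at h3
    exact Finset.mem_coe.2 (mem_Bx.2 fun i hi' => (h6 i (by omega)).symm)
  · obtain ⟨lo, hi, h1, h2, h3, h4, h5, h6⟩ := hg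
    change lo ≤ 0 at h2
    change 0 ≤ hi at h3
    exact Finset.mem_coe.2 (Finset.mem_Icc.2 ⟨by omega, by omega⟩)

lemma wordDist_le_of_cl (S : Set (Lamp F)) (r : ℤ) :
    ∃ N : ℝ, 0 ≤ N ∧ ∀ a b, cl r (toC a) (toC b) → wordDist S a b ≤ N := by
  obtain ⟨N, hN⟩ := ((finite_cl_one (F := F) r).image (wordNorm S)).bddAbove
  refine ⟨N, by positivity, fun a b h => ?_⟩
  have h1 := cl_mul_left a⁻¹ h
  rw [inv_mul_cancel] at h1
  unfold wordDist
  exact_mod_cast hN ⟨_, h1, rfl⟩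

end Lamp

section Equivalence

variable {F F' : Type*} [Group F] [Fintype F] [Group F'] [Fintype F']

/-- A quasi-isometry of lamplighter groups gives a coarse equivalence of configuration spaces. -/
lemma exists_CQ {S : Set (Lamp F)} {S' : Set (Lamp F')} (hS : IsFinSymmGen S)
    (hS' : IsFinSymmGen S') (h : QuasiIsometric (wordDist S) (wordDist S')) :
    ∃ (f : (ℤ →₀ Additive F) × ℤ → (ℤ →₀ Additive F') × ℤ)
      (g : (ℤ →₀ Additive F') × ℤ → (ℤ →₀ Additive F) × ℤ) (K : ℤ), CQ f g K := by
  obtain ⟨K, C, φ, hK, hC, hφ, hs⟩ := h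
  have hK0 : 0 < K := by linarith
  choose ψ hψ using hs
  have hlow : ∀ a b, wordDist S a b ≤ K * (wordDist S' (φ a) (φ b) + C) := fun a b => by
    have := mul_le_mul_of_nonneg_left (hφ a b).1 hK0.le
    have e : K * (1 / K * wordDist S a b) = wordDist S a b := by field_simp
    linarith
  obtain ⟨M0, hM0, hfg⟩ := cl_of_wordDist_le hS' C
  obtain ⟨N1, hN1, hd1⟩ := wordDist_le_of_cl S 1
  obtain ⟨M1, hM1, hf⟩ := cl_of_wordDist_le hS' (K * N1 + C)
  obtain ⟨N2, hN2, hd2⟩ := wordDist_le_of_cl S' (M0 + 1 + M0)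
  obtain ⟨M2, hM2, hg⟩ := cl_of_wordDist_le hS (K * (N2 + C))
  obtain ⟨M3, hM3, hgf⟩ := cl_of_wordDist_le hS (K * (C + C))
  refine ⟨fun p => toC (φ (ofC p)), fun p => toC (ψ (ofC p)), M0 + M1 + M2 + M3 + 1, by omega,
    fun p p' hp => ?_, fun p p' hp => ?_, fun p => ?_, fun p => ?_⟩
  · refine (hf _ _ ?_).mono (by omega)
    have h1 := hd1 (ofC p) (ofC p') (by simpa using hp)
    have h2 := mul_le_mul_of_nonneg_left h1 hK0.le
    linarith [(hφ (ofC p) (ofC p')).2]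
  · refine (hg _ _ ?_).mono (by omega)
    have h0 : cl 1 (toC (ofC p)) (toC (ofC p')) := by simpa using hp
    have h1 := hd2 _ _ (((hfg _ _ (hψ (ofC p))).trans h0).trans (hfg _ _ (hψ (ofC p'))).symm)
    exact (hlow _ _).trans (mul_le_mul_of_nonneg_left (by linarith) hK0.le)
  · have h1 : cl M3 (toC (ψ (φ (ofC p)))) (toC (ofC p)) :=
      hgf _ _ ((hlow _ _).trans (mul_le_mul_of_nonneg_left (by linarith [hψ (φ (ofC p))]) hK0.le))
    rw [toC_ofC] at h1
    simpa using h1.mono (by omega : M3 ≤ M0 + M1 + M2 + M3 + 1)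
  · have h1 : cl M0 (toC (φ (ψ (ofC p)))) (toC (ofC p)) := hfg _ _ (hψ _)
    rw [toC_ofC] at h1
    simpa using h1.mono (by omega : M0 ≤ M0 + M1 + M2 + M3 + 1)

end Equivalence

section CardOne

variable {α β : Type*} [Zero α] [Zero β] [Fintype α] [Fintype β]
variable {f : (ℤ →₀ α) × ℤ → (ℤ →₀ β) × ℤ} {g : (ℤ →₀ β) × ℤ → (ℤ →₀ α) × ℤ} {K : ℤ}

/-- A lamplighter graph with nontrivial lamps is not coarsely equivalent to a line. -/
lemma CQ.card_lt_two (h : CQ f g K) (hβ : Fintype.card β = 1) : Fintype.card α < 2 := by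
  by_contra! hα
  have : Subsingleton β := Fintype.card_le_one_iff_subsingleton.1 hβ.le
  obtain ⟨k, hk⟩ := Int.eq_ofNat_of_zero_le (by linarith [h.one_le] : 0 ≤ K)
  have hk1 : 1 ≤ k := by have := h.one_le; omega
  set A : ℕ := Fintype.card α ^ (4 * K).toNat with hA
  have hA1 : 1 ≤ A := Nat.one_le_pow _ _ (by omega)
  set N : ℕ := 13 * k * A with hN
  have hN1 : 1 ≤ N := by rw [hN]; exact Nat.mul_pos (by omega) hA1
  have e : (Bx (0 : ℤ →₀ α) 0 (2 * N : ℕ)).card ≤ A * (12 * k * N + 1) := by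
    have h1 := h.count (S := Bx (0 : ℤ →₀ α) 0 (2 * N : ℕ)) (i := 0)
      (h1 := (f (0, 0)).2 - 6 * k * N) (h2 := (f (0, 0)).2 + 6 * k * N) (lo := 0) (hi := 0)
      (A0 := 0) fun a ha => by
        have c1 : cl (2 * N : ℕ) ((0 : ℤ →₀ α), (0 : ℤ)) (a, 0) :=
          ⟨0, (2 * N : ℕ), by simp, le_rfl, by simp, le_rfl, by simp,
            fun i hi => (mem_Bx.1 ha i hi).symm⟩
        have c2 := (h.f_cl_of c1).snd_le
        have c3 := (h.f_cl_of c1).symm.snd_le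
        have c4 : 3 * K * ((2 * N : ℕ) : ℤ) = 6 * k * N := by rw [hk]; push_cast; ring
        exact ⟨by linarith, by linarith, fun j _ => Subsingleton.elim _ _⟩
    refine h1.trans (Nat.mul_le_mul_left _ ?_)
    rw [sub_self, Int.toNat_zero, pow_zero, mul_one]
    have c5 : (f (0, 0)).2 + 6 * k * N + 1 - ((f (0, 0)).2 - 6 * k * N) =
        ((12 * k * N + 1 : ℕ) : ℤ) := by push_cast; ring
    rw [c5, Int.toNat_natCast]
  rw [card_Bx, sub_zero, Int.toNat_natCast] at e
  have e1 : 2 ^ (2 * N) ≤ Fintype.card α ^ (2 * N) := Nat.pow_le_pow_left hα _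
  have e2 : N < 2 ^ N := Nat.lt_two_pow_self
  have e3 : A * (12 * k * N + 1) ≤ N * N := by
    have : 12 * k * N + 1 ≤ 13 * k * N := by nlinarith
    calc A * (12 * k * N + 1) ≤ A * (13 * k * N) := Nat.mul_le_mul_left _ this
      _ = 13 * k * A * N := by ring
      _ = N * N := by rw [← hN]
  have e4 : N * N < 2 ^ N * 2 ^ N := Nat.mul_lt_mul'' e2 e2
  have e5 : 2 ^ (2 * N) = 2 ^ N * 2 ^ N := by rw [two_mul, pow_add]
  omega

end CardOne

/-- Natural numbers with a common power are powers of a common number. -/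
lemma exists_common_base {n m r p : ℕ} (hn : 0 < n) (hr : 0 < r) (hp : 0 < p)
    (h : n ^ r = m ^ p) :
    ∃ d s t : ℕ, 0 < d ∧ 0 < s ∧ 0 < t ∧ n = d ^ s ∧ m = d ^ t := by
  obtain ⟨c, r', p', hc, hco, rfl, rfl⟩ := Nat.exists_coprime' (Nat.gcd_pos_of_pos_left p hr)
  have hr' : 0 < r' := Nat.pos_of_mul_pos_right hr
  have hp' : 0 < p' := Nat.pos_of_mul_pos_right hp
  rw [pow_mul, pow_mul] at h
  have h' := Nat.pow_left_injective hc.ne' h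
  obtain ⟨d, hd1, hd2⟩ := Nat.exists_eq_pow_of_exponent_coprime_of_pow_eq_pow hco h'
  refine ⟨d, p', r', Nat.pos_of_ne_zero fun h0 => ?_, hp', hr', hd1, hd2⟩
  rw [h0, zero_pow hp'.ne'] at hd1
  omega

section Regroup

variable {α β γ : Type*} [Zero α] [Zero β] [Zero γ]

/-- Being coarsely equivalent. -/
def CEquiv (α β : Type*) [Zero α] [Zero β] : Prop :=
  ∃ (f : (ℤ →₀ α) × ℤ → (ℤ →₀ β) × ℤ) (g : (ℤ →₀ β) × ℤ → (ℤ →₀ α) × ℤ) (K : ℤ), CQ f g K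

lemma CEquiv.symm (h : CEquiv α β) : CEquiv β α := by
  obtain ⟨f, g, K, h⟩ := h
  exact ⟨g, f, K, h.symm⟩

lemma CEquiv.trans (h : CEquiv α β) (h' : CEquiv β γ) : CEquiv α γ := by
  obtain ⟨f, g, K, h⟩ := h
  obtain ⟨f', g', K', h'⟩ := h'
  have h1 := h.one_le
  have h1' := h'.one_le
  have e : 0 ≤ K * K' := by positivity
  refine ⟨f' ∘ f, g ∘ g', 3 * (K * K') + K + K', by linarith, fun p p' hp => ?_, fun p p' hp => ?_,
    fun p => ?_, fun p => ?_⟩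
  · exact (h'.f_cl_of (h.f_cl _ _ hp)).mono (by linarith)
  · exact (h.symm.f_cl_of (h'.g_cl _ _ hp)).mono (by linarith)
  · exact ((h.symm.f_cl_of (h'.gf (f p))).trans (h.gf p)).mono (by linarith)
  · exact ((h'.f_cl_of (h.fg (g' p))).trans (h'.fg p)).mono (by linarith)

/-- Blocks of `s` consecutive lamps may be regarded as single lamps. -/
lemma cequiv_pi {s : ℕ} (hs : 0 < s) (e : β ≃ (Fin s → γ)) (he : e 0 = 0) : CEquiv β γ := by
  have hsz : (0 : ℤ) < s := by exact_mod_cast hs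
  have he' : ∀ x, x ≠ 0 → e x ≠ 0 := fun x hx h0 => hx (e.injective (h0.trans he.symm))
  have hr : ∀ i : ℤ, (i % s).toNat < s := fun i => by
    have h1 := Int.emod_nonneg i hsz.ne'
    have h2 := Int.emod_lt_of_pos i hsz
    omega
  set φ : (ℤ →₀ β) → ℤ → γ := fun x i => e (x (i / s)) ⟨(i % s).toNat, hr i⟩ with hφ
  set ψ : (ℤ →₀ γ) → ℤ → β := fun y i => e.symm fun j => y (s * i + j) with hψ
  have hdm : ∀ (i : ℤ) (j : Fin s), (s * i + j) / (s : ℤ) = i := fun i j => by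
    rw [Int.add_comm, Int.add_mul_ediv_left _ _ hsz.ne', Int.ediv_eq_zero_of_lt (by positivity)
      (by exact_mod_cast j.2), zero_add]
  have hmm : ∀ (i : ℤ) (j : Fin s), (s * i + j) % (s : ℤ) = j := fun i j => by
    rw [Int.mul_add_emod_self_left, Int.emod_eq_of_lt (by positivity) (by exact_mod_cast j.2)]
  have hφf : ∀ x, (φ x).support.Finite := fun x => by
    refine (x.support.finite_toSet.biUnion fun k _ =>
      Set.finite_Icc (s * k : ℤ) (s * k + s)).subset fun i hi => ?_
    refine Set.mem_biUnion (x := i / s) ?_ ?_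
    · refine Finset.mem_coe.2 (Finsupp.mem_support_iff.2 fun h0 => hi ?_)
      simp only [hφ, h0, he, Pi.zero_apply]
    · have h1 := Int.mul_ediv_add_emod i s
      have h2 := Int.emod_nonneg i hsz.ne'
      have h3 := Int.emod_lt_of_pos i hsz
      exact ⟨by omega, by omega⟩
  have hψf : ∀ y, (ψ y).support.Finite := fun y => by
    refine (y.support.finite_toSet.image (· / (s : ℤ))).subset fun i hi => ?_
    by_contra hc
    refine hi ?_
    have : (fun j : Fin s => y (s * i + j)) = 0 := by
      funext j
      by_contra h0
      exact hc ⟨s * i + j, Finset.mem_coe.2 (Finsupp.mem_support_iff.2 h0), hdm i j⟩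
    simp only [hψ, this, ← he, Equiv.symm_apply_apply]
  refine ⟨fun p => (Finsupp.ofSupportFinite (φ p.1) (hφf p.1), s * p.2),
    fun p => (Finsupp.ofSupportFinite (ψ p.1) (hψf p.1), p.2 / s), s + 2, by omega,
    fun p p' hp => ?_, fun p p' hp => ?_, fun p => ?_, fun p => ?_⟩
  · obtain ⟨lo, hi, h1, h2, h3, h4, h5, h6⟩ := hp
    refine ⟨s * lo, s * hi, by nlinarith, mul_le_mul_of_nonneg_left h2 hsz.le,
      mul_le_mul_of_nonneg_left h3 hsz.le, mul_le_mul_of_nonneg_left h4 hsz.le,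
      mul_le_mul_of_nonneg_left h5 hsz.le, fun i hi => ?_⟩
    simp only [Finsupp.ofSupportFinite_coe, hφ]
    rw [h6]
    rcases hi with hi | hi
    · exact Or.inl (Int.ediv_lt_of_lt_mul hsz (by rwa [mul_comm]))
    · exact Or.inr (Int.le_ediv_of_mul_le hsz (by rwa [mul_comm]))
  · obtain ⟨lo, hi, h1, h2, h3, h4, h5, h6⟩ := hp
    have a1 := Int.mul_ediv_add_emod lo s
    have a2 := Int.emod_nonneg lo hsz.ne'
    have a3 := Int.mul_ediv_add_emod hi s
    have a4 := Int.emod_lt_of_pos hi hsz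
    have a5 : hi / s ≤ lo / s + 1 := by
      refine Int.lt_add_one_iff.1 (Int.ediv_lt_of_lt_mul hsz ?_)
      have a6 := Int.emod_lt_of_pos lo hsz
      linarith
    refine ⟨lo / s, hi / s + 1, by omega, Int.ediv_le_ediv hsz h2,
      (Int.ediv_le_ediv hsz h3).trans (by omega), Int.ediv_le_ediv hsz h4,
      (Int.ediv_le_ediv hsz h5).trans (by omega), fun i hi' => ?_⟩
    simp only [Finsupp.ofSupportFinite_coe, hψ]
    congr 1
    funext j
    have hj : (j : ℤ) < s := by exact_mod_cast j.2
    refine h6 _ ?_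
    rcases hi' with hi' | hi'
    · left
      have := mul_le_mul_of_nonneg_left (by omega : i + 1 ≤ lo / s) hsz.le
      linarith
    · right
      have := mul_le_mul_of_nonneg_left hi' hsz.le
      have hj0 : (0 : ℤ) ≤ j := by positivity
      linarith
  · have h1 : (s * p.2) / (s : ℤ) = p.2 := Int.mul_ediv_cancel_left _ hsz.ne'
    have h2 : Finsupp.ofSupportFinite (ψ (Finsupp.ofSupportFinite (φ p.1) (hφf p.1)))
        (hψf _) = p.1 := by
      ext i
      simp only [Finsupp.ofSupportFinite_coe, hψ, hφ, hdm, hmm, Int.toNat_natCast]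
      exact e.symm_apply_apply _
    simp only [h1, h2]
    exact cl_refl (by omega) p
  · have h2 : Finsupp.ofSupportFinite (φ (Finsupp.ofSupportFinite (ψ p.1) (hψf p.1)))
        (hφf _) = p.1 := by
      ext i
      simp only [Finsupp.ofSupportFinite_coe, hψ, hφ, Equiv.apply_symm_apply]
      congr 1
      rw [Int.toNat_of_nonneg (Int.emod_nonneg i hsz.ne')]
      exact Int.mul_ediv_add_emod i s
    have a1 := Int.mul_ediv_add_emod p.2 s
    have a2 := Int.emod_nonneg p.2 hsz.ne'
    have a3 := Int.emod_lt_of_pos p.2 hsz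
    simp only [h2]
    exact ⟨s * (p.2 / s), p.2, by omega, le_rfl, by simp only; omega, by omega, le_rfl,
      fun _ _ => rfl⟩

lemma cequiv_fin [Fintype α] {d s : ℕ} [NeZero d] (hs : 0 < s) (hα : Fintype.card α = d ^ s) :
    CEquiv α (Fin d) := by
  obtain ⟨e⟩ : Nonempty (α ≃ (Fin s → Fin d)) := ⟨Fintype.equivOfCardEq (by simp [hα])⟩
  exact cequiv_pi hs (e.trans (Equiv.swap (e 0) 0)) (by simp)

end Regroup

section Generators

variable (F : Type*) [Group F]

/-- The elements at coarse distance one from the identity. -/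
def gens : Set (Lamp F) := {g | cl 1 (toC 1) (toC g)}

variable {F}

lemma ofC_mul_of_snd_eq_zero (f : ℤ →₀ Additive F) (p : (ℤ →₀ Additive F) × ℤ) :
    ofC (f, 0) * ofC p = ofC (f + p.1, p.2) := by
  refine Subtype.ext (Prod.ext (funext fun i => ?_) (zero_add p.2))
  change (f i).toMul * (p.1 (i - 0)).toMul = (f i).toMul * (p.1 i).toMul
  rw [sub_zero]

lemma ofC_shift_mem (k : ℤ) : ofC (0, k) ∈ Subgroup.closure (gens F) := by
  have h1 : ofC (0, 1) ∈ Subgroup.closure (gens F) :=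
    Subgroup.subset_closure ⟨0, 1, by simp, le_rfl, zero_le_one, zero_le_one, le_rfl,
      fun _ _ => rfl⟩
  have hmul : ∀ a b : ℤ, (ofC (0, a) * ofC (0, b) : Lamp F) = ofC (0, a + b) := fun a b =>
    Subtype.ext (Prod.ext (funext fun i => mul_one (1 : F)) rfl)
  have hone : (ofC (0, 0) : Lamp F) = 1 := rfl
  induction k using Int.induction_on with
  | zero => rw [hone]; exact one_mem _
  | succ k ih => rw [← hmul]; exact mul_mem ih h1
  | pred k ih =>
    refine (Subgroup.mul_mem_cancel_right _ h1).1 ?_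
    rw [hmul, sub_add_cancel]
    exact ih

lemma ofC_single_mem (i : ℤ) (x : Additive F) :
    ofC (Finsupp.single i x, 0) ∈ Subgroup.closure (gens F) := by
  have h1 : ofC (Finsupp.single 0 x, 0) ∈ Subgroup.closure (gens F) := by
    refine Subgroup.subset_closure ⟨0, 1, by simp, le_rfl, zero_le_one, le_rfl, zero_le_one,
      fun j hj => ?_⟩
    change 0 = (Finsupp.single 0 x : ℤ →₀ Additive F) j
    rw [Finsupp.single_eq_of_ne (by omega)]
  have h2 := mul_mem (mul_mem (ofC_shift_mem i) h1) (ofC_shift_mem (-i))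
  convert h2 using 1
  refine Subtype.ext (Prod.ext (funext fun j => ?_) ?_)
  · change (Finsupp.single i x j).toMul = 1 * (Finsupp.single 0 x (j - i)).toMul * 1
    rw [one_mul, mul_one, Finsupp.single_apply, Finsupp.single_apply]
    congr 1
    exact if_congr (by omega) rfl rfl
  · change 0 = i + 0 + -i
    omega

variable (F) in
lemma closure_gens : Subgroup.closure (gens F) = ⊤ := by
  refine (Subgroup.eq_top_iff' _).2 fun g => ?_
  have h : ∀ x : ℤ →₀ Additive F, ofC (x, 0) ∈ Subgroup.closure (gens F) := fun x => by
    induction x using Finsupp.induction with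
    | zero => exact ofC_shift_mem 0
    | single_add i b x _ _ ih =>
      have := mul_mem (ofC_single_mem i b) ih
      rwa [ofC_mul_of_snd_eq_zero] at this
  have h2 := mul_mem (h (toC g).1) (ofC_shift_mem (toC g).2)
  rwa [ofC_mul_of_snd_eq_zero, add_zero] at h2

variable (F) in
lemma isFinSymmGen_gens [Fintype F] : IsFinSymmGen (gens F) := by
  refine ⟨finite_cl_one 1, fun g hg => ?_, closure_gens F⟩
  have h := cl_mul_left g⁻¹ hg
  rw [mul_one, inv_mul_cancel] at h
  exact h.symm

end Generators

section Final

variable {F F' : Type*} [Group F] [Fintype F] [Group F'] [Fintype F']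

lemma CQ.exists_lip {f : (ℤ →₀ Additive F) × ℤ → (ℤ →₀ Additive F') × ℤ}
    {g : (ℤ →₀ Additive F') × ℤ → (ℤ →₀ Additive F) × ℤ} {K : ℤ} (h : CQ f g K) :
    ∃ R : ℝ, 0 ≤ R ∧ ∀ a b : Lamp F, wordDist (gens F') (ofC (f (toC a))) (ofC (f (toC b))) ≤
      R * wordDist (gens F) a b := by
  obtain ⟨R, hR, hd⟩ := wordDist_le_of_cl (gens F') K
  refine ⟨R, hR, wordDist_lip (isFinSymmGen_gens F) (isFinSymmGen_gens F') fun a s hs => hd _ _ ?_⟩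
  rw [toC_ofC, toC_ofC]
  have h1 := cl_mul_left a hs
  rw [mul_one] at h1
  exact h.f_cl _ _ h1

/-- A coarse equivalence of configuration spaces gives a quasi-isometry. -/
lemma CQ.quasiIsometric {f : (ℤ →₀ Additive F) × ℤ → (ℤ →₀ Additive F') × ℤ}
    {g : (ℤ →₀ Additive F') × ℤ → (ℤ →₀ Additive F) × ℤ} {K : ℤ} (h : CQ f g K) :
    QuasiIsometric (wordDist (gens F)) (wordDist (gens F')) := by
  obtain ⟨R, hR, hf⟩ := h.exists_lip
  obtain ⟨R', hR', hg⟩ := h.symm.exists_lip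
  obtain ⟨N, hN, hgf⟩ := wordDist_le_of_cl (gens F) K
  obtain ⟨N', hN', hfg⟩ := wordDist_le_of_cl (gens F') K
  refine ⟨R + R' + 1, 2 * N + N', fun a => ofC (f (toC a)), by linarith, by linarith,
    fun a b => ⟨?_, ?_⟩, fun y => ⟨ofC (g (toC y)), ?_⟩⟩
  · set D := wordDist (gens F') (ofC (f (toC a))) (ofC (f (toC b))) with hD
    have hD0 : 0 ≤ D := Nat.cast_nonneg _
    have e1 := hg (ofC (f (toC a))) (ofC (f (toC b)))
    simp only [toC_ofC, ← hD] at e1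
    have e2 := hgf (ofC (g (f (toC a)))) a (by rw [toC_ofC]; exact h.gf _)
    have e2' := hgf a (ofC (g (f (toC a)))) (by rw [toC_ofC]; exact (h.gf _).symm)
    have e3 := hgf (ofC (g (f (toC b)))) b (by rw [toC_ofC]; exact h.gf _)
    have t1 := wordDist_triangle (isFinSymmGen_gens F) a (ofC (g (f (toC a)))) b
    have t2 := wordDist_triangle (isFinSymmGen_gens F) (ofC (g (f (toC a))))
      (ofC (g (f (toC b)))) b
    have hK : 0 < R + R' + 1 := by linarith
    have e4 : wordDist (gens F) a b ≤ (R + R' + 1) * (D + (2 * N + N')) := by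
      have p1 := mul_nonneg hR hD0
      have p2 := mul_nonneg (add_nonneg hR hR') (by linarith : 0 ≤ 2 * N + N')
      linarith
    rw [one_div, sub_le_iff_le_add, inv_mul_le_iff₀ hK]
    exact e4
  · have p : 0 ≤ wordDist (gens F) a b := Nat.cast_nonneg _
    have p1 := mul_nonneg hR' p
    linarith [hf a b]
  · have := hfg (ofC (f (toC (ofC (g (toC y)))))) y (by rw [toC_ofC, toC_ofC]; exact h.fg _)
    linarith

end Final

end LampQI

/-- **Theorem (Eskin–Fisher–Whyte).** The lamplighter groups `ℤ ≀ F` and `ℤ ≀ F'` are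
quasi-isometric if and only if `|F| = dˢ` and `|F'| = dʳ` for some positive integers
`d, s, r`. -/
theorem lamplighter_qi_iff
    (F F' : Type*) [Group F] [Fintype F] [Group F'] [Fintype F'] :
    (∃ (S : Set (Lamp F)) (S' : Set (Lamp F')),
        IsFinSymmGen S ∧ IsFinSymmGen S' ∧
        QuasiIsometric (wordDist S) (wordDist S')) ↔
    (∃ d s r : ℕ, 0 < d ∧ 0 < s ∧ 0 < r ∧
        Fintype.card F = d ^ s ∧ Fintype.card F' = d ^ r) := by
  have cF : Fintype.card (Additive F) = Fintype.card F := Fintype.card_additive F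
  have cF' : Fintype.card (Additive F') = Fintype.card F' := Fintype.card_additive F'
  rw [← cF, ← cF']
  constructor
  · rintro ⟨S, S', hS, hS', h⟩
    obtain ⟨f, g, K, hC⟩ := LampQI.exists_CQ hS hS' h
    have hF : 0 < Fintype.card (Additive F) := Fintype.card_pos
    have hF' : 0 < Fintype.card (Additive F') := Fintype.card_pos
    rcases (by omega : Fintype.card (Additive F) = 1 ∨ 2 ≤ Fintype.card (Additive F)) with h1 | h1
    · have h2 := hC.symm.card_lt_two h1
      exact ⟨1, 1, 1, one_pos, one_pos, one_pos, by omega, by omega⟩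
    rcases (by omega : Fintype.card (Additive F') = 1 ∨ 2 ≤ Fintype.card (Additive F')) with h2 | h2
    · have h3 := hC.card_lt_two h2
      omega
    obtain ⟨r, p, hr, hp, e⟩ := hC.exists_pow_eq h1 h2
    exact LampQI.exists_common_base hF hr hp e
  · rintro ⟨d, s, r, hd, hs, hr, hF, hF'⟩
    have : NeZero d := ⟨hd.ne'⟩
    obtain ⟨f, g, K, h⟩ :=
      (LampQI.cequiv_fin (α := Additive F) hs hF).trans
          (LampQI.cequiv_fin (α := Additive F') hr hF').symm
    exact ⟨LampQI.gens F, LampQI.gens F', LampQI.isFinSymmGen_gens F, LampQI.isFinSymmGen_gens F',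
        h.quasiIsometric⟩

end
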